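/- For constrained-degree percolation on ℤ^d, d ≥ 2, with κ ∈ {2,…,2d}, the critical point coincides with the susceptibility critical point: p_c = p̂_c, where p̂_c = sup{p ∈ [0,1] : Σ_{x∈ℤ^d} ℙ(0 is connected to x by a p-open path) < ∞}. -/

import Mathlib

open MeasureTheory

namespace CDP

/-- Vertices of the hypercubic lattice `ℤ^d`. -/
abbrev Vertex (d : ℕ) := Fin d → ℤ

/-- Nearest-neighbour adjacency in `ℤ^d`. -/
def adj {d : ℕ} (x y : Vertex d) : Prop := (∑ i, |x i - y i|) = 1

/-- `e` is a nearest-neighbour (non-oriented) edge of `ℤ^d`, i.e. an element of `𝓔`. -/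
def IsNNEdge {d : ℕ} (e : Sym2 (Vertex d)) : Prop := ∃ x y, adj x y ∧ e = s(x, y)

/-- Configurations: labels attached to (unordered) pairs of vertices; only the labels of
nearest-neighbour edges (elements of `𝓔`) are ever relevant. -/
abbrev Config (d : ℕ) := Sym2 (Vertex d) → ℝ

/-- `ℓ^1` norm of a vertex. -/
def norm1 {d : ℕ} (x : Vertex d) : ℤ := ∑ i, |x i|

/-- The set `Ω`: configurations with values in `[0,1]`, pairwise distinct coordinates on `𝓔`,
and no infinite walk along which the labels are strictly monotone. -/
def goodConfigs (d : ℕ) : Set (Config d) :=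
  {U | (∀ e, IsNNEdge e → U e ∈ Set.Icc (0 : ℝ) 1) ∧
    (∀ e f, IsNNEdge e → IsNNEdge f → U e = U f → e = f) ∧
    ¬ ∃ w : ℕ → Vertex d, (∀ i, adj (w i) (w (i + 1))) ∧
      (StrictMono (fun i => U s(w i, w (i + 1))) ∨ StrictAnti (fun i => U s(w i, w (i + 1))))}

/-- A labelling `σ` of the edges by "ever opens" which is consistent with the
constrained-degree dynamics driven by `U`: an edge (attempting to open at time `U e`)
opens iff at that moment both of its end-vertices have degree `< κ` among the
previously opened edges. -/
def Consistent {d : ℕ} (κ : ℕ) (U : Config d) (σ : Sym2 (Vertex d) → Prop) : Prop :=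
  ∀ e, IsNNEdge e →
    (σ e ↔ ∀ v ∈ e,
      Set.ncard {f : Sym2 (Vertex d) | IsNNEdge f ∧ v ∈ f ∧ f ≠ e ∧ U f < U e ∧ σ f} < κ)

/-- `ω_p(U, e) = 1`, i.e. the edge `e` is `p`-open in the constrained-degree percolation
process with constraint `κ` driven by `U`. -/
def openEdge {d : ℕ} (κ : ℕ) (U : Config d) (p : ℝ) (e : Sym2 (Vertex d)) : Prop :=
  IsNNEdge e ∧ U e ≤ p ∧ ∃ σ, Consistent κ U σ ∧ σ e

/-- `x 0, …, x k` is a path: consecutive vertices adjacent, all vertices distinct. -/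
def IsPathOn {d : ℕ} (k : ℕ) (x : ℕ → Vertex d) : Prop :=
  (∀ i < k, adj (x i) (x (i + 1))) ∧ ∀ i ≤ k, ∀ j ≤ k, x i = x j → i = j

/-- The modified one-arm event `E_n(p)`: a path `x_0, …, x_k` with `‖x_0‖₁ = n`,
`‖x_i‖₁ < n` for `1 ≤ i ≤ k`, `x_k = 0`, whose head consists of `p`-open edges and whose
tail is decreasing (values `≤ p`, strictly decreasing towards the origin). -/
def modifiedOneArm {d : ℕ} (κ n : ℕ) (p : ℝ) (U : Config d) : Prop :=
  ∃ (k : ℕ) (x : ℕ → Vertex d),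
    IsPathOn k x ∧ norm1 (x 0) = (n : ℤ) ∧ (∀ i, 1 ≤ i → i ≤ k → norm1 (x i) < (n : ℤ)) ∧
    x k = 0 ∧
    ∃ l ≤ k,
      (∀ i < l, openEdge κ U p s(x i, x (i + 1))) ∧
      (∀ i, l ≤ i → i < k → U s(x i, x (i + 1)) ≤ p) ∧
      (∀ i, l ≤ i → i + 1 < k → U s(x (i + 1), x (i + 2)) < U s(x i, x (i + 1)))

/-- `a` and `b` are connected by a `p`-open path. -/
def openConn {d : ℕ} (κ : ℕ) (U : Config d) (p : ℝ) (a b : Vertex d) : Prop :=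
  ∃ (k : ℕ) (x : ℕ → Vertex d), IsPathOn k x ∧ x 0 = a ∧ x k = b ∧
    ∀ i < k, openEdge κ U p s(x i, x (i + 1))

/-- There is an infinite `p`-open path starting at the origin. -/
def zeroToInf {d : ℕ} (κ : ℕ) (U : Config d) (p : ℝ) : Prop :=
  ∃ x : ℕ → Vertex d, x 0 = 0 ∧ (∀ i, adj (x i) (x (i + 1))) ∧ Function.Injective x ∧
    ∀ i, openEdge κ U p s(x i, x (i + 1))

/-- `P` is the law of i.i.d. `Uniform[0,1]` labels: a probability measure whose
finite-dimensional cylinder probabilities are products of uniform probabilities. -/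
def IsProductUniform {d : ℕ} (P : Measure (Config d)) : Prop :=
  IsProbabilityMeasure P ∧
    ∀ (s : Finset (Sym2 (Vertex d))) (f : Sym2 (Vertex d) → Set ℝ),
      (∀ e ∈ s, MeasurableSet (f e)) →
      P {U | ∀ e ∈ s, U e ∈ f e} = ∏ e ∈ s, volume (f e ∩ Set.Icc 0 1)

/-- The one-arm probability `θ_n(p)`. -/
noncomputable def theta {d : ℕ} (κ : ℕ) (P : Measure (Config d)) (n : ℕ) (p : ℝ) : ℝ :=
  (P {U | U ∈ goodConfigs d ∧ ∃ b, norm1 b = (n : ℤ) ∧ openConn κ U p 0 b}).toReal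

/-- `θ(p) = ℙ(0 ↔ ∞)`. -/
noncomputable def thetaInf {d : ℕ} (κ : ℕ) (P : Measure (Config d)) (p : ℝ) : ℝ :=
  (P {U | U ∈ goodConfigs d ∧ zeroToInf κ U p}).toReal

/-- The critical point `p_c`. -/
noncomputable def pc {d : ℕ} (κ : ℕ) (P : Measure (Config d)) : ℝ :=
  sSup {p : ℝ | p ∈ Set.Icc (0 : ℝ) 1 ∧ thetaInf κ P p = 0}

/-- The modified one-arm probability `τ_n(p)`. -/
noncomputable def tau {d : ℕ} (κ : ℕ) (P : Measure (Config d)) (n : ℕ) (p : ℝ) : ℝ :=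
  (P {U | U ∈ goodConfigs d ∧ modifiedOneArm κ n p U}).toReal

/-- `e` is `p`-pivotal for `E_n(p)` at `U`. -/
def pPivotal {d : ℕ} (κ n : ℕ) (p : ℝ) (e : Sym2 (Vertex d)) (U : Config d) : Prop :=
  U ∈ goodConfigs d ∧ p < U e ∧ Function.update U e p ∈ goodConfigs d ∧
    ¬ (modifiedOneArm κ n p U ↔ modifiedOneArm κ n p (Function.update U e p))

/-- `e` is `U`-pivotal for `E_n(p)` at `U`. -/
def uPivotal {d : ℕ} (κ n : ℕ) (p : ℝ) (e : Sym2 (Vertex d)) (U : Config d) : Prop :=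
  U ∈ goodConfigs d ∧ ∃ U' ∈ goodConfigs d, (∀ f, f ≠ e → U' f = U f) ∧
    ¬ (modifiedOneArm κ n p U ↔ modifiedOneArm κ n p U')


/-- The susceptibility critical threshold `p̂_c`. -/
noncomputable def pcHat {d : ℕ} (κ : ℕ) (P : Measure (Config d)) : ℝ :=
  sSup {p : ℝ | p ∈ Set.Icc (0 : ℝ) 1 ∧
    ∑' b : Vertex d, P {U | U ∈ goodConfigs d ∧ openConn κ U p 0 b} < ⊤}

/-! ### The product measure -/

/-- Pairs of vertices, the index set of the labels. -/
abbrev Edge (d : ℕ) := Sym2 (Vertex d)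

open Classical in
/-- The configuration equal to `X` on `F` and to `Y` off `F`. -/
noncomputable def mix {d : ℕ} (F : Finset (Edge d)) (X Y : Config d) : Config d :=
  fun e => if e ∈ F then X e else Y e

section Measure

variable {d : ℕ} {P : Measure (Config d)}

lemma mix_of_mem {F : Finset (Edge d)} {X Y : Config d} {e : Edge d} (h : e ∈ F) :
    mix F X Y e = X e := by simp [mix, h]

lemma mix_of_notMem {F : Finset (Edge d)} {X Y : Config d} {e : Edge d} (h : e ∉ F) :
    mix F X Y e = Y e := by simp [mix, h]

lemma measurable_mix (F : Finset (Edge d)) :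
    Measurable (fun z : Config d × Config d => mix F z.1 z.2) := by
  refine measurable_pi_lambda _ fun e => ?_
  by_cases h : e ∈ F
  · simp only [mix, h, if_true]; fun_prop
  · simp only [mix, h, if_false]; fun_prop

lemma measurable_mix_right (F : Finset (Edge d)) (X : Config d) : Measurable (mix F X) :=
  (measurable_mix F).comp (measurable_const.prodMk measurable_id)

lemma measurable_mix_left (F : Finset (Edge d)) (Y : Config d) :
    Measurable (fun X => mix F X Y) :=
  (measurable_mix F).comp (measurable_id.prodMk measurable_const)

lemma IsProductUniform.eq_infinitePi (hP : IsProductUniform P) :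
    P = Measure.infinitePi (fun _ : Edge d => volume.restrict (Set.Icc (0 : ℝ) 1)) := by
  have : ∀ _ : Sym2 (Vertex d), IsProbabilityMeasure (volume.restrict (Set.Icc (0 : ℝ) 1)) :=
    fun _ => ⟨by simp⟩
  refine @Measure.eq_infinitePi _ _ _ (fun _ => volume.restrict (Set.Icc (0 : ℝ) 1)) this P
    fun s t ht => ?_
  have := hP.2 s t fun e _ => ht e
  simp_rw [Measure.restrict_apply (ht _)]
  rw [← this]
  rfl

lemma IsProductUniform.unique {Q : Measure (Config d)} (hP : IsProductUniform P)
    (hQ : IsProductUniform Q) : P = Q :=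
  hP.eq_infinitePi.trans hQ.eq_infinitePi.symm

lemma measurableSet_cylinder (s : Finset (Edge d)) (f : Edge d → Set ℝ)
    (hf : ∀ e ∈ s, MeasurableSet (f e)) : MeasurableSet {U : Config d | ∀ e ∈ s, U e ∈ f e} := by
  have : {U : Config d | ∀ e ∈ s, U e ∈ f e} = ⋂ e ∈ s, (fun U : Config d => U e) ⁻¹' f e := by
    ext; simp
  rw [this]
  exact Finset.measurableSet_biInter _ fun e he => measurable_pi_apply e (hf e he)

lemma IsProductUniform.map_mix (hP : IsProductUniform P) (F : Finset (Edge d)) :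
    (P.prod P).map (fun z => mix F z.1 z.2) = P := by
  classical
  have := hP.1
  refine IsProductUniform.unique
    ⟨Measure.isProbabilityMeasure_map (measurable_mix F).aemeasurable, fun s f hf => ?_⟩ hP
  rw [Measure.map_apply (measurable_mix F) (measurableSet_cylinder s f hf)]
  have : (fun z : Config d × Config d => mix F z.1 z.2) ⁻¹' {U | ∀ e ∈ s, U e ∈ f e} =
      {U | ∀ e ∈ s.filter (· ∈ F), U e ∈ f e} ×ˢ {U | ∀ e ∈ s.filter (· ∉ F), U e ∈ f e} := by
    ext ⟨X, Y⟩
    simp only [Set.mem_preimage, Set.mem_ofPred_eq, Set.mem_prod, Finset.mem_filter]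
    constructor
    · intro h
      refine ⟨fun e he => ?_, fun e he => ?_⟩
      · simpa [mix_of_mem he.2] using h e he.1
      · simpa [mix_of_notMem he.2] using h e he.1
    · rintro ⟨h1, h2⟩ e he
      by_cases hF : e ∈ F
      · rw [mix_of_mem hF]; exact h1 e ⟨he, hF⟩
      · rw [mix_of_notMem hF]; exact h2 e ⟨he, hF⟩
  rw [this, Measure.prod_prod, hP.2 _ _ fun e he => hf e (Finset.mem_filter.1 he).1,
    hP.2 _ _ fun e he => hf e (Finset.mem_filter.1 he).1, Finset.prod_filter_mul_prod_filter_not]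

lemma IsProductUniform.map_comp_equiv (hP : IsProductUniform P) (φ : Edge d ≃ Edge d) :
    P.map (fun X => X ∘ φ) = P := by
  classical
  have := hP.1
  have hm : Measurable (fun X : Config d => X ∘ φ) :=
    measurable_pi_lambda _ fun e => measurable_pi_apply (φ e)
  refine IsProductUniform.unique
    ⟨Measure.isProbabilityMeasure_map hm.aemeasurable, fun s f hf => ?_⟩ hP
  rw [Measure.map_apply hm (measurableSet_cylinder s f hf)]
  have : (fun X : Config d => X ∘ φ) ⁻¹' {U | ∀ e ∈ s, U e ∈ f e} =
      {U | ∀ e ∈ s.map φ.toEmbedding, U e ∈ (f ∘ φ.symm) e} := by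
    ext X
    simp only [Set.mem_preimage, Set.mem_ofPred_eq, Finset.mem_map_equiv, Function.comp]
    exact ⟨fun h e he => by simpa using h _ he, fun h e he => by simpa using h (φ e) (by simpa)⟩
  rw [this, hP.2 _ (f ∘ φ.symm) fun e he => hf _ (by simpa [Finset.mem_map_equiv] using he), Finset.prod_map]
  simp

lemma IsProductUniform.measure_eq_prod (hP : IsProductUniform P) (F : Finset (Edge d))
    {A : Set (Config d)} (hA : MeasurableSet A) :
    P A = (P.prod P) {z | mix F z.1 z.2 ∈ A} := by
  conv_lhs => rw [← hP.map_mix F]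
  rw [Measure.map_apply (measurable_mix F) hA]
  rfl

lemma IsProductUniform.measureReal_inter (hP : IsProductUniform P) (F : Finset (Edge d))
    {A B : Set (Config d)} (hA : MeasurableSet A) (hB : MeasurableSet B)
    (hAF : ∀ X Y, mix F X Y ∈ A ↔ X ∈ A) (hBF : ∀ X Y, mix F X Y ∈ B ↔ Y ∈ B) :
    P.real (A ∩ B) = P.real A * P.real B := by
  have := hP.1
  have : P (A ∩ B) = P A * P B := by
    rw [hP.measure_eq_prod F (hA.inter hB), ← Measure.prod_prod]
    congr 1
    ext ⟨X, Y⟩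
    simp [hAF, hBF]
  simp [measureReal_def, this]

lemma IsProductUniform.measure_coord (hP : IsProductUniform P) (e : Edge d) {t : Set ℝ}
    (ht : MeasurableSet t) : P {X | X e ∈ t} = volume (t ∩ Set.Icc 0 1) := by
  have := hP.2 {e} (fun _ => t) (by simpa using ht)
  simpa using this

lemma IsProductUniform.measure_coord_eq (hP : IsProductUniform P) (e : Edge d) (a : ℝ) :
    P {X | X e = a} = 0 := by
  have := hP.measure_coord e (measurableSet_singleton a)
  simp only [Set.mem_singleton_iff] at this
  rw [this]
  exact measure_mono_null Set.inter_subset_left (by simp)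

lemma IsProductUniform.measure_eq_eq (hP : IsProductUniform P) {e f : Edge d} (h : e ≠ f) :
    P {X | X e = X f} = 0 := by
  classical
  have := hP.1
  have hm : MeasurableSet {X : Config d | X e = X f} :=
    measurableSet_eq_fun (measurable_pi_apply e) (measurable_pi_apply f)
  rw [hP.measure_eq_prod {e} hm]
  have hm' : MeasurableSet {z : Config d × Config d | mix {e} z.1 z.2 ∈ {X : Config d | X e = X f}} :=
    measurable_mix _ hm
  rw [Measure.measure_prod_null hm']
  refine Filter.Eventually.of_forall fun X => ?_
  have : Prod.mk X ⁻¹' {z : Config d × Config d | mix {e} z.1 z.2 ∈ {X : Config d | X e = X f}}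
      = {Y | Y f = X e} := by
    ext Y
    simp [mix, h.symm, eq_comm]
  simp only [this, Pi.zero_apply]
  exact hP.measure_coord_eq f _

lemma IsProductUniform.ae_injective (hP : IsProductUniform P) :
    ∀ᵐ X ∂P, Function.Injective X := by
  have : ∀ᵐ X ∂P, ∀ e f : Edge d, e ≠ f → X e ≠ X f := by
    rw [ae_all_iff]; intro e
    rw [ae_all_iff]; intro f
    by_cases h : e = f
    · simp [h]
    · have := hP.measure_eq_eq h
      rw [← compl_mem_ae_iff] at this
      filter_upwards [this] with X hX _ using hX
  filter_upwards [this] with X hX e f hef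
  by_contra hne
  exact hX e f hne hef

lemma IsProductUniform.ae_mem_Icc (hP : IsProductUniform P) :
    ∀ᵐ X ∂P, ∀ e, X e ∈ Set.Icc (0 : ℝ) 1 := by
  have := hP.1
  rw [ae_all_iff]
  intro e
  have h := hP.measure_coord e (measurableSet_Icc (a := (0 : ℝ)) (b := 1)).compl
  simpa [ae_iff] using h

lemma IsProductUniform.measureReal_Ioc (hP : IsProductUniform P) (e : Edge d) {a b : ℝ}
    (ha : 0 ≤ a) (hab : a ≤ b) (hb : b ≤ 1) : P.real {X | X e ∈ Set.Ioc a b} = b - a := by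
  have h := hP.measure_coord e (measurableSet_Ioc (a := a) (b := b))
  have h' : Set.Ioc a b ∩ Set.Icc 0 1 = Set.Ioc a b :=
    Set.inter_eq_left.2 fun x hx => ⟨ha.trans hx.1.le, hx.2.trans hb⟩
  rw [h'] at h
  rw [measureReal_def, h]
  simp [hab]

lemma measurableSet_increasing (fs : List (Edge d)) :
    MeasurableSet {X : Config d | fs.Pairwise (fun a b => X a < X b)} := by
  induction fs with
  | nil => simp
  | cons a l ih =>
    simp only [List.pairwise_cons, Set.ofPred_and]
    refine MeasurableSet.inter ?_ ih
    have : {X : Config d | ∀ b ∈ l, X a < X b} = ⋂ b ∈ l.toFinset, {X : Config d | X a < X b} := by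
      ext; simp
    rw [this]
    exact Finset.measurableSet_biInter _ fun b _ =>
      measurableSet_lt (measurable_pi_apply a) (measurable_pi_apply b)

lemma IsProductUniform.measureReal_increasing_le (hP : IsProductUniform P) (fs : List (Edge d)) :
    P.real {X : Config d | fs.Pairwise (fun a b => X a < X b)} ≤ 1 / (fs.length.factorial : ℝ) := by
  classical
  have := hP.1
  by_cases hnd : fs.Nodup
  swap
  · have : {X : Config d | fs.Pairwise (fun a b => X a < X b)} = ∅ := by
      ext X
      simp only [Set.mem_ofPred_eq, Set.mem_empty_iff_false, iff_false]
      intro h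
      exact hnd (h.imp fun hab hEq => absurd (hEq ▸ hab) (lt_irrefl _))
    rw [this]; simp
  set A : Equiv.Perm (Fin fs.length) → Set (Config d) :=
    fun π => {X | StrictMono (fun i => X (fs.get (π i)))} with hA
  have hset : {X : Config d | fs.Pairwise (fun a b => X a < X b)} = A 1 := by
    ext X
    simp only [hA, Set.mem_ofPred_eq, List.pairwise_iff_get, Equiv.Perm.coe_one, id]
    exact ⟨fun h i j hij => h i j hij, fun h i j hij => h hij⟩
  let ι : Fin fs.length ↪ Edge d := ⟨fs.get, List.nodup_iff_injective_get.1 hnd⟩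
  have hmeas1 : MeasurableSet (A 1) := hset ▸ measurableSet_increasing fs
  have hpre : ∀ π, A π = (fun X : Config d => X ∘ (π.viaEmbedding ι)) ⁻¹' A 1 := by
    intro π
    ext X
    simp only [hA, Set.mem_ofPred_eq, Set.mem_preimage, Function.comp, Equiv.Perm.coe_one, id]
    have : ∀ i, π.viaEmbedding ι (fs.get i) = fs.get (π i) := fun i =>
      Equiv.Perm.viaEmbedding_apply π ι i
    simp only [this]
  have hmφ : ∀ φ : Edge d ≃ Edge d, Measurable (fun X : Config d => X ∘ φ) := fun φ =>
    measurable_pi_lambda _ fun e => measurable_pi_apply (φ e)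
  have hmeas : ∀ π, MeasurableSet (A π) := fun π => hpre π ▸ hmφ _ hmeas1
  have heq : ∀ π, P.real (A π) = P.real (A 1) := by
    intro π
    conv_rhs => rw [← hP.map_comp_equiv (π.viaEmbedding ι)]
    rw [measureReal_def, measureReal_def, Measure.map_apply (hmφ _) hmeas1, ← hpre π]
  have hdisj : Pairwise (Function.onFun Disjoint A) := by
    intro π π' hne
    rw [Function.onFun, Set.disjoint_left]
    intro X h1 h2
    apply hne
    simp only [hA, Set.mem_ofPred_eq] at h1 h2
    have hr : ∀ π : Equiv.Perm (Fin fs.length), Set.range (fun i => X (fs.get (π i))) =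
        Set.range (fun i => X (fs.get i)) := fun π =>
      π.surjective.range_comp (fun i => X (fs.get i))
    have h3 := (h1.range_inj h2).1 ((hr π).trans (hr π').symm)
    have hinj : Function.Injective (fun i => X (fs.get i)) := by
      have := h1.injective
      intro i j hij
      have h4 := @this (π.symm i) (π.symm j) (by simpa using hij)
      simpa using h4
    ext i
    exact congrArg Fin.val (hinj (congrFun h3 i))
  have hsum : ∑ π, P.real (A π) ≤ 1 := by
    rw [← measureReal_iUnion_fintype hdisj hmeas]
    exact measureReal_le_one
  rw [hset]
  simp only [heq, Finset.sum_const, Finset.card_univ, Fintype.card_perm, Fintype.card_fin,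
    nsmul_eq_mul] at hsum
  rw [le_div_iff₀ (by positivity)]
  linarith

end Measure

/-! ### Finite-volume dynamics -/

section Dynamics

variable {d : ℕ}

/-- The degree of `v` in the finite edge set `O`. -/
noncomputable def deg (O : Finset (Edge d)) (v : Vertex d) : ℕ :=
  Set.ncard {f | f ∈ O ∧ v ∈ f}

open Classical in
/-- Attempt to open `e`, subject to the constraint, when the open edges are those of `O`. -/
noncomputable def step (κ : ℕ) (O : Finset (Edge d)) (e : Edge d) : Finset (Edge d) :=
  if ∀ v ∈ e, deg O v < κ then insert e O else O

/-- The edges opened when those of `l` attempt to open one after the other. -/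
noncomputable def run (κ : ℕ) (l : List (Edge d)) : Finset (Edge d) :=
  l.foldl (step κ) ∅

/-- Two edges share an end-vertex. -/
def Touch (e f : Edge d) : Prop := ∃ v, v ∈ e ∧ v ∈ f

lemma Touch.symm {e f : Edge d} (h : Touch e f) : Touch f e :=
  let ⟨v, h1, h2⟩ := h; ⟨v, h2, h1⟩

lemma finite_deg (O : Finset (Edge d)) (v : Vertex d) : {f | f ∈ O ∧ v ∈ f}.Finite :=
  O.finite_toSet.subset fun _ h => h.1

lemma deg_mono {O O' : Finset (Edge d)} (h : O ⊆ O') (v : Vertex d) : deg O v ≤ deg O' v :=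
  Set.ncard_le_ncard (fun _ hf => ⟨h hf.1, hf.2⟩) (finite_deg O' v)

open Classical in
lemma deg_insert_of_mem {O : Finset (Edge d)} {e : Edge d} {v : Vertex d} (he : e ∉ O)
    (hv : v ∈ e) : deg (insert e O) v = deg O v + 1 := by
  have : {f | f ∈ insert e O ∧ v ∈ f} = insert e {f | f ∈ O ∧ v ∈ f} := by
    ext f
    simp only [Finset.mem_insert, Set.mem_ofPred_eq, Set.mem_insert_iff]
    constructor
    · rintro ⟨h1 | h1, h2⟩
      · exact Or.inl h1
      · exact Or.inr ⟨h1, h2⟩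
    · rintro (h1 | h1)
      · exact ⟨Or.inl h1, h1 ▸ hv⟩
      · exact ⟨Or.inr h1.1, h1.2⟩
  rw [deg, this, Set.ncard_insert_of_notMem (fun h => he h.1) (finite_deg O v), deg]

open Classical in
lemma deg_insert_of_notMem {O : Finset (Edge d)} {e : Edge d} {v : Vertex d} (hv : v ∉ e) :
    deg (insert e O) v = deg O v := by
  have : {f | f ∈ insert e O ∧ v ∈ f} = {f | f ∈ O ∧ v ∈ f} := by
    ext f
    simp only [Finset.mem_insert, Set.mem_ofPred_eq]
    constructor
    · rintro ⟨h1 | h1, h2⟩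
      · exact absurd (h1 ▸ h2) hv
      · exact ⟨h1, h2⟩
    · exact fun h => ⟨Or.inr h.1, h.2⟩
  rw [deg, this, deg]

lemma subset_step (κ : ℕ) (O : Finset (Edge d)) (e : Edge d) : O ⊆ step κ O e := by
  classical
  unfold step
  split_ifs
  · exact Finset.subset_insert e O
  · exact subset_rfl

lemma mem_step_of_ne {κ : ℕ} {O : Finset (Edge d)} {e f : Edge d} (h : f ≠ e) :
    f ∈ step κ O e ↔ f ∈ O := by
  classical
  unfold step
  split_ifs <;> simp [h]

lemma mem_step_self {κ : ℕ} {O : Finset (Edge d)} {e : Edge d} (h : e ∉ O) :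
    e ∈ step κ O e ↔ ∀ v ∈ e, deg O v < κ := by
  classical
  unfold step
  split_ifs with h'
  · simpa using h'
  · simp [h, h']

/-- Two consecutive attempts either commute, or are made by edges sharing a vertex and the
first one blocks the second one. -/
lemma step_comm_or {κ : ℕ} {O : Finset (Edge d)} {e f : Edge d} (he : e ∉ O)
    (hf : f ∉ O) :
    step κ (step κ O e) f = step κ (step κ O f) e ∨
      (Touch e f ∧ step κ (step κ O e) f = step κ O e ∧ step κ (step κ O f) e = step κ O f) := by
  classical
  by_cases h1 : ∀ v ∈ e, deg O v < κ
  swap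
  · left
    have h2 : step κ O e = O := if_neg h1
    have h3 : step κ (step κ O f) e = step κ O f :=
      if_neg fun h => h1 fun v hv => (deg_mono (subset_step κ O f) v).trans_lt (h v hv)
    rw [h2, h3]
  by_cases h2 : ∀ v ∈ f, deg O v < κ
  swap
  · left
    have h4 : step κ O f = O := if_neg h2
    have h3 : step κ (step κ O e) f = step κ O e :=
      if_neg fun h => h2 fun v hv => (deg_mono (subset_step κ O e) v).trans_lt (h v hv)
    rw [h4, h3]
  have h3 : step κ O e = insert e O := if_pos h1
  have h4 : step κ O f = insert f O := if_pos h2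
  by_cases h5 : ∀ v, v ∈ e → v ∈ f → deg O v + 1 < κ
  · left
    have h6 : step κ (insert e O) f = insert f (insert e O) := by
      refine if_pos fun v hv => ?_
      by_cases hve : v ∈ e
      · rw [deg_insert_of_mem he hve]; exact h5 v hve hv
      · rw [deg_insert_of_notMem hve]; exact h2 v hv
    have h7 : step κ (insert f O) e = insert e (insert f O) := by
      refine if_pos fun v hv => ?_
      by_cases hvf : v ∈ f
      · rw [deg_insert_of_mem hf hvf]; exact h5 v hv hvf
      · rw [deg_insert_of_notMem hvf]; exact h1 v hv
    rw [h3, h4, h6, h7, Finset.insert_comm]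
  · right
    push Not at h5
    obtain ⟨v, hve, hvf, hv⟩ := h5
    refine ⟨⟨v, hve, hvf⟩, ?_, ?_⟩
    · rw [h3]
      refine if_neg fun h => ?_
      have := h v hvf
      rw [deg_insert_of_mem he hve] at this
      omega
    · rw [h4]
      refine if_neg fun h => ?_
      have := h v hve
      rw [deg_insert_of_mem hf hvf] at this
      omega

open Classical in
/-- The edges of `Λ` sharing a vertex with `e`. -/
noncomputable def nbr (Λ : Finset (Edge d)) (e : Edge d) : Finset (Edge d) :=
  Λ.filter (Touch e)

open Classical in
/-- Trails from `e` of length `m`: sequences of edges of `Λ` along which the influence of `e`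
may be transported, together with the final edge carrying the influence. -/
noncomputable def trails (Λ : Finset (Edge d)) : ℕ → Edge d → Finset (List (Edge d) × Edge d)
  | 0, e => {([], e)}
  | m + 1, e => (nbr Λ e).biUnion fun f =>
      (trails Λ m e ∪ trails Λ m f).image fun t => (f :: t.1, t.2)

lemma trails_length {Λ : Finset (Edge d)} {m : ℕ} {e : Edge d} {t : List (Edge d) × Edge d}
    (ht : t ∈ trails Λ m e) : t.1.length = m := by
  classical
  induction m generalizing e t with
  | zero => simp only [trails, Finset.mem_singleton] at ht; simp [ht]
  | succ m ih =>
    simp only [trails, Finset.mem_biUnion, Finset.mem_image, Finset.mem_union] at ht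
    obtain ⟨f, -, s, hs | hs, rfl⟩ := ht <;> simp [ih hs]

lemma trails_end_mem {Λ : Finset (Edge d)} {m : ℕ} {e : Edge d} {t : List (Edge d) × Edge d}
    (ht : t ∈ trails Λ m e) : t.2 = e ∨ t.2 ∈ t.1 := by
  classical
  induction m generalizing e t with
  | zero => simp only [trails, Finset.mem_singleton] at ht; simp [ht]
  | succ m ih =>
    simp only [trails, Finset.mem_biUnion, Finset.mem_image, Finset.mem_union] at ht
    obtain ⟨f, -, s, hs | hs, rfl⟩ := ht
    · rcases ih hs with h | h <;> simp [h]
    · rcases ih hs with h | h <;> simp [h]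

/-- If adding `e` to the attempts alters `g`, then after deletion of `e` and of the edges of
some trail started at `e`, adding the end of this trail after all the other attempts
alters `g`. -/
lemma exists_trail {β : Type*} (g : Finset (Edge d) → β) (κ : ℕ) (Λ : Finset (Edge d))
    (l : List (Edge d)) : ∀ (O : Finset (Edge d)) (e : Edge d), (e :: l).Nodup →
      (∀ x ∈ e :: l, x ∉ O) → (∀ x ∈ l, x ∈ Λ) →
      g (l.foldl (step κ) (step κ O e)) ≠ g (l.foldl (step κ) O) →
      ∃ fs c r, (fs, c) ∈ trails Λ fs.length e ∧ fs.Sublist l ∧ r.Sublist l ∧ (fs ++ r).Perm l ∧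
        g (step κ (r.foldl (step κ) O) c) ≠ g (r.foldl (step κ) O) := by
  classical
  induction l with
  | nil =>
    intro O e _ _ _ h
    exact ⟨[], e, [], by simp [trails], by simp, by simp, by simp, h⟩
  | cons f r ih =>
    intro O e hnd hO hΛ hg
    have hef : e ≠ f := fun h => by simp [h] at hnd
    have hnd1 : (e :: r).Nodup := hnd.sublist (by simp)
    have hnd2 : (f :: r).Nodup := hnd.of_cons
    have heO : e ∉ O := hO e (by simp)
    have hfO : f ∉ O := hO f (by simp)
    have hΛ' : ∀ x ∈ r, x ∈ Λ := fun x hx => hΛ x (by simp [hx])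
    simp only [List.foldl_cons] at hg
    rcases step_comm_or (κ := κ) heO hfO with h | ⟨ht, h1, h2⟩
    · rw [h] at hg
      have hO' : ∀ x ∈ e :: r, x ∉ step κ O f := by
        intro x hx
        have hxf : x ≠ f := by
          rintro rfl
          rcases List.mem_cons.1 hx with h | h
          · exact hef h.symm
          · exact (List.nodup_cons.1 hnd2).1 h
        rw [mem_step_of_ne hxf]
        exact hO x (by rcases List.mem_cons.1 hx with h | h <;> simp [h])
      obtain ⟨fs, c, r', h3, h4, h5, h6, h7⟩ := ih (step κ O f) e hnd1 hO' hΛ' hg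
      exact ⟨fs, c, f :: r', h3, h4.cons f, h5.cons_cons f,
        List.perm_middle.trans (h6.cons f), h7⟩
    · have hfe : f ∈ nbr Λ e := Finset.mem_filter.2 ⟨hΛ f (by simp), ht⟩
      rw [h1] at hg
      by_cases hC : g (r.foldl (step κ) (step κ O e)) = g (r.foldl (step κ) O)
      · rw [hC] at hg
        obtain ⟨fs, c, r', h3, h4, h5, h6, h7⟩ := ih O f hnd2
          (fun x hx => hO x (by rcases List.mem_cons.1 hx with h | h <;> simp [h])) hΛ' hg.symm
        refine ⟨f :: fs, c, r', ?_, h4.cons_cons f, h5.cons f, h6.cons f, h7⟩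
        simp only [trails, List.length_cons, Finset.mem_biUnion, Finset.mem_image]
        exact ⟨f, hfe, (fs, c), Finset.mem_union_right _ h3, rfl⟩
      · obtain ⟨fs, c, r', h3, h4, h5, h6, h7⟩ := ih O e hnd1
          (fun x hx => hO x (by rcases List.mem_cons.1 hx with h | h <;> simp [h])) hΛ' hC
        refine ⟨f :: fs, c, r', ?_, h4.cons_cons f, h5.cons f, h6.cons f, h7⟩
        simp only [trails, List.length_cons, Finset.mem_biUnion, Finset.mem_image]
        exact ⟨f, hfe, (fs, c), Finset.mem_union_left _ h3, rfl⟩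

lemma sum_biUnion_le_sum {α β : Type*} [DecidableEq β] (s : Finset α) (t : α → Finset β)
    {w : β → ℝ} (hw : ∀ b, 0 ≤ w b) : ∑ b ∈ s.biUnion t, w b ≤ ∑ a ∈ s, ∑ b ∈ t a, w b := by
  classical
  induction s using Finset.induction_on with
  | empty => simp
  | insert a s ha ih =>
    rw [Finset.biUnion_insert, Finset.sum_insert ha]
    have h1 := Finset.sum_union_inter (s₁ := t a) (s₂ := s.biUnion t) (f := w)
    have h2 : 0 ≤ ∑ b ∈ t a ∩ s.biUnion t, w b := Finset.sum_nonneg fun b _ => hw b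
    linarith

lemma sum_trails_le {Λ : Finset (Edge d)} {B : ℕ} (hB : ∀ e ∈ Λ, (nbr Λ e).card ≤ B)
    (w : Edge d → ℝ) (hw : ∀ c, 0 ≤ w c) (m : ℕ) :
    ∑ e ∈ Λ, ∑ t ∈ trails Λ m e, w t.2 ≤ (2 * B : ℝ) ^ m * ∑ c ∈ Λ, w c := by
  classical
  induction m with
  | zero => simp [trails]
  | succ m ih =>
    set T : Edge d → ℝ := fun e => ∑ t ∈ trails Λ m e, w t.2 with hT
    have hT0 : ∀ e, 0 ≤ T e := fun e => Finset.sum_nonneg fun t _ => hw _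
    have h1 : ∀ e ∈ Λ, ∑ t ∈ trails Λ (m + 1) e, w t.2 ≤ ∑ f ∈ nbr Λ e, (T e + T f) := by
      intro e _
      simp only [trails]
      refine (sum_biUnion_le_sum _ _ (w := fun t : List (Edge d) × Edge d => w t.2)
        fun _ => hw _).trans
        (Finset.sum_le_sum fun f _ => ?_)
      rw [Finset.sum_image (by rintro ⟨a, b⟩ _ ⟨a', b'⟩ _ h; simpa using h)]
      have := Finset.sum_union_inter (s₁ := trails Λ m e) (s₂ := trails Λ m f)
        (f := fun t => w t.2)
      have h0 : 0 ≤ ∑ t ∈ trails Λ m e ∩ trails Λ m f, w t.2 :=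
        Finset.sum_nonneg fun t _ => hw _
      simp only [hT]
      linarith
    have h2 : ∑ e ∈ Λ, ∑ f ∈ nbr Λ e, T e ≤ B * ∑ e ∈ Λ, T e := by
      rw [Finset.mul_sum]
      refine Finset.sum_le_sum fun e he => ?_
      rw [Finset.sum_const, nsmul_eq_mul]
      exact mul_le_mul_of_nonneg_right (by exact_mod_cast hB e he) (hT0 e)
    have h3 : ∑ e ∈ Λ, ∑ f ∈ nbr Λ e, T f = ∑ e ∈ Λ, ∑ f ∈ nbr Λ e, T e := by
      simp only [nbr, Finset.sum_filter]
      rw [Finset.sum_comm]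
      refine Finset.sum_congr rfl fun e _ => Finset.sum_congr rfl fun f _ => ?_
      simp only [show Touch f e ↔ Touch e f from ⟨Touch.symm, Touch.symm⟩]
    calc ∑ e ∈ Λ, ∑ t ∈ trails Λ (m + 1) e, w t.2
        ≤ ∑ e ∈ Λ, ∑ f ∈ nbr Λ e, (T e + T f) := Finset.sum_le_sum h1
      _ = ∑ e ∈ Λ, ∑ f ∈ nbr Λ e, T e + ∑ e ∈ Λ, ∑ f ∈ nbr Λ e, T f := by
          simp only [Finset.sum_add_distrib]
      _ ≤ 2 * B * ∑ e ∈ Λ, T e := by rw [h3]; linarith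
      _ ≤ 2 * B * ((2 * B : ℝ) ^ m * ∑ c ∈ Λ, w c) :=
          mul_le_mul_of_nonneg_left ih (by positivity)
      _ = _ := by ring

end Dynamics

/-! ### The OSSS inequality -/

section OSSS

variable {d : ℕ} {P : Measure (Config d)}

lemma measurable_measureReal_section [IsProbabilityMeasure P]
    {A : Set (Config d × Config d)} (hA : MeasurableSet A) :
    Measurable fun X => P.real {Y | (X, Y) ∈ A} :=
  (measurable_measure_prodMk_left hA).ennreal_toReal

lemma integrable_measureReal_section [IsProbabilityMeasure P]
    {A : Set (Config d × Config d)} (hA : MeasurableSet A) :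
    Integrable (fun X => P.real {Y | (X, Y) ∈ A}) P :=
  Integrable.of_bound (measurable_measureReal_section hA).aestronglyMeasurable 1
    (Filter.Eventually.of_forall fun X => by
      rw [Real.norm_eq_abs, abs_of_nonneg measureReal_nonneg]; exact measureReal_le_one)

lemma integral_measureReal_section [IsProbabilityMeasure P]
    {A : Set (Config d × Config d)} (hA : MeasurableSet A) :
    ∫ X, P.real {Y | (X, Y) ∈ A} ∂P = (P.prod P).real A := by
  rw [measureReal_def, Measure.prod_apply hA, ← integral_toReal
    (measurable_measure_prodMk_left hA).aemeasurable
    (Filter.Eventually.of_forall fun X => measure_lt_top P _)]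
  rfl

lemma IsProductUniform.integral_mix (hP : IsProductUniform P) (F : Finset (Edge d))
    {A : Set (Config d)} (hA : MeasurableSet A) :
    ∫ X, P.real {Y | mix F X Y ∈ A} ∂P = P.real A := by
  have := hP.1
  have h := integral_measureReal_section (P := P) (measurable_mix F hA)
  rw [measureReal_def P, hP.measure_eq_prod F hA]
  exact h

lemma mix_mix_insert [DecidableEq (Edge d)] {S : Finset (Edge d)} {e : Edge d} (he : e ∉ S)
    (X Z Y : Config d) : mix S X (mix {e} Z Y) = mix (insert e S) (mix {e} Z X) Y := by
  funext j
  by_cases hj : j ∈ S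
  · have : j ≠ e := fun h => he (h ▸ hj)
    simp [mix, hj, this]
  · by_cases hje : j = e
    · simp [mix, hje, he]
    · simp [mix, hj, hje]

/-- The influence of the label of `e` on the event `A`. -/
noncomputable def influence (P : Measure (Config d)) (A : Set (Config d)) (e : Edge d) : ℝ :=
  (P.prod P).real {z | ¬ (z.2 ∈ A ↔ mix {e} z.1 z.2 ∈ A)}

lemma measurableSet_iff {α : Type*} [MeasurableSpace α] {A B : Set α} (hA : MeasurableSet A)
    (hB : MeasurableSet B) : MeasurableSet {x | ¬ (x ∈ A ↔ x ∈ B)} := by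
  have : {x | ¬ (x ∈ A ↔ x ∈ B)} = (A \ B) ∪ (B \ A) := by
    ext x; simp only [Set.mem_ofPred_eq, Set.mem_union, Set.mem_sdiff]; tauto
  rw [this]
  exact (hA.diff hB).union (hB.diff hA)

lemma measurableSet_influence {A : Set (Config d)} (hA : MeasurableSet A) (e : Edge d) :
    MeasurableSet {z : Config d × Config d | ¬ (z.2 ∈ A ↔ mix {e} z.1 z.2 ∈ A)} :=
  measurableSet_iff (measurable_snd hA) (measurable_mix {e} hA)

lemma influence_nonneg {A : Set (Config d)} {e : Edge d} : 0 ≤ influence P A e :=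
  measureReal_nonneg

lemma osss_aux (hP : IsProductUniform P) {Λ : Finset (Edge d)} {R : Edge d → Set (Config d)}
    (hR : ∀ j, MeasurableSet (R j)) {A : Set (Config d)} (hA : MeasurableSet A)
    (hexp : ∀ S ⊆ Λ, ∀ X : Config d,
      (∃ e ∈ Λ, e ∉ S ∧ ∀ Z : Config d, (∀ j ∈ S, Z j = X j) → Z ∈ R e) ∨
      ∀ Z : Config d, (∀ j ∈ S, Z j = X j) → (Z ∈ A ↔ X ∈ A)) [DecidableEq (Edge d)] (n : ℕ) :
    ∀ S ⊆ Λ, (Λ \ S).card = n → ∀ X : Config d,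
      P.real ({Y | mix S X Y ∈ A} ∩ A) - P.real {Y | mix S X Y ∈ A} * P.real A ≤
        ∑ j ∈ Λ \ S, P.real {Y | mix S X Y ∈ R j} * influence P A j := by
  have := hP.1
  induction n with
  | zero =>
    intro S hS hn X
    rcases hexp S hS X with ⟨e, he, heS, -⟩ | h
    · have := Finset.card_eq_zero.1 hn ▸ Finset.mem_sdiff.2 ⟨he, heS⟩
      simp at this
    · have hAX : ∀ Y, mix S X Y ∈ A ↔ X ∈ A := fun Y => h _ fun j hj => mix_of_mem hj
      simp only [hAX, Finset.card_eq_zero.1 hn, Finset.sum_empty]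
      by_cases hX : X ∈ A <;> simp [hX]
  | succ n ih =>
    intro S hS hn X
    rcases hexp S hS X with ⟨e, he, heS, hRe⟩ | h
    swap
    · have hAX : ∀ Y, mix S X Y ∈ A ↔ X ∈ A := fun Y => h _ fun j hj => mix_of_mem hj
      simp only [hAX]
      have h0 : 0 ≤ ∑ j ∈ Λ \ S, P.real {Y | mix S X Y ∈ R j} * influence P A j :=
        Finset.sum_nonneg fun j _ => mul_nonneg measureReal_nonneg influence_nonneg
      by_cases hX : X ∈ A <;> simpa [hX] using h0
    have heΛ : e ∈ Λ \ S := Finset.mem_sdiff.2 ⟨he, heS⟩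
    have hsd : Λ \ insert e S = (Λ \ S).erase e := by
      ext j; simp only [Finset.mem_sdiff, Finset.mem_insert, Finset.mem_erase]; tauto
    have hcard : (Λ \ insert e S).card = n := by
      rw [hsd, Finset.card_erase_of_mem heΛ, hn]; rfl
    have hsub : insert e S ⊆ Λ := Finset.insert_subset he hS
    set X' : Config d → Config d := fun Z => mix {e} Z X with hX'
    have hmS : Measurable (mix S X) := measurable_mix_right S X
    -- resampling the label of `e`
    have hres : ∀ {B : Set (Config d)}, MeasurableSet B →
        P.real {Y | mix S X Y ∈ B} = ∫ Z, P.real {Y | mix (insert e S) (X' Z) Y ∈ B} ∂P := by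
      intro B hB
      refine (hP.integral_mix {e} (hmS hB)).symm.trans ?_
      simp only [Set.mem_preimage, mix_mix_insert heS, hX']
    have hres2 : P.real ({Y | mix S X Y ∈ A} ∩ A) =
        ∫ Z, P.real ({Y | mix (insert e S) (X' Z) Y ∈ A} ∩ {Y | mix {e} Z Y ∈ A}) ∂P := by
      refine (hP.integral_mix {e} ((hmS hA).inter hA)).symm.trans ?_
      simp only [Set.mem_inter_iff, Set.mem_preimage, mix_mix_insert heS, hX']
      rfl
    have hpair : Measurable fun z : Config d × Config d => mix (insert e S) (X' z.1) z.2 :=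
      (measurable_mix _).comp
        (((measurable_mix_left {e} X).comp measurable_fst).prodMk measurable_snd)
    have hint : ∀ {B : Set (Config d)}, MeasurableSet B →
        Integrable (fun Z => P.real {Y | mix (insert e S) (X' Z) Y ∈ B}) P := fun hB =>
      integrable_measureReal_section (hpair hB)
    have hint2 : Integrable (fun Z =>
        P.real ({Y | mix (insert e S) (X' Z) Y ∈ A} ∩ {Y | mix {e} Z Y ∈ A})) P :=
      integrable_measureReal_section ((hpair hA).inter (measurable_mix {e} hA))
    have hpt : ∀ Z, P.real ({Y | mix (insert e S) (X' Z) Y ∈ A} ∩ {Y | mix {e} Z Y ∈ A}) ≤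
        P.real {Y | mix (insert e S) (X' Z) Y ∈ A} * P.real A +
        ∑ j ∈ Λ \ insert e S, P.real {Y | mix (insert e S) (X' Z) Y ∈ R j} * influence P A j +
        P.real {Y | ¬ (Y ∈ A ↔ mix {e} Z Y ∈ A)} := by
      intro Z
      have h1 := ih (insert e S) hsub hcard (X' Z)
      have h2 : P.real ({Y | mix (insert e S) (X' Z) Y ∈ A} ∩ {Y | mix {e} Z Y ∈ A}) ≤
          P.real ({Y | mix (insert e S) (X' Z) Y ∈ A} ∩ A) +
          P.real {Y | ¬ (Y ∈ A ↔ mix {e} Z Y ∈ A)} := by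
        refine (measureReal_mono ?_).trans (measureReal_union_le _ _)
        rintro Y ⟨hY1, hY2⟩
        by_cases hY : Y ∈ A
        · exact Or.inl ⟨hY1, hY⟩
        · exact Or.inr fun h => hY (h.2 hY2)
      linarith
    have hI : P.real ({Y | mix S X Y ∈ A} ∩ A) ≤
        P.real {Y | mix S X Y ∈ A} * P.real A +
        ∑ j ∈ Λ \ insert e S, P.real {Y | mix S X Y ∈ R j} * influence P A j +
        influence P A e := by
      rw [hres2, hres hA]
      simp only [hres (hR _)]
      have hi1 : Integrable (fun Z =>
          P.real {Y | mix (insert e S) (X' Z) Y ∈ A} * P.real A) P := (hint hA).mul_const _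
      have hi2 : Integrable (fun Z => ∑ j ∈ Λ \ insert e S,
          P.real {Y | mix (insert e S) (X' Z) Y ∈ R j} * influence P A j) P :=
        integrable_finsetSum _ fun j _ => (hint (hR j)).mul_const _
      have hi3 : Integrable (fun Z => P.real {Y | ¬ (Y ∈ A ↔ mix {e} Z Y ∈ A)}) P :=
        integrable_measureReal_section (measurableSet_influence hA e)
      have := integral_mono hint2 ((hi1.add hi2).add hi3) hpt
      simp only [Pi.add_apply] at this
      rw [integral_add (by exact hi1.add hi2) hi3, integral_add hi1 hi2, integral_mul_const,
        integral_finsetSum _ fun j _ => (hint (hR j)).mul_const _] at this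
      simp only [integral_mul_const] at this
      have hi : ∫ Z, P.real {Y | ¬ (Y ∈ A ↔ mix {e} Z Y ∈ A)} ∂P = influence P A e :=
        integral_measureReal_section (measurableSet_influence hA e)
      rwa [hi] at this
    have hone : P.real {Y | mix S X Y ∈ R e} = 1 := by
      have : {Y | mix S X Y ∈ R e} = Set.univ :=
        Set.eq_univ_of_forall fun Y => hRe _ fun j hj => mix_of_mem hj
      rw [this]; simp
    rw [← Finset.add_sum_erase _ _ heΛ, ← hsd, hone]
    linarith

/-- The OSSS inequality: `R j` contains the event that the exploration reveals `j`. -/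
lemma osss (hP : IsProductUniform P) {Λ : Finset (Edge d)} {R : Edge d → Set (Config d)}
    (hR : ∀ j, MeasurableSet (R j)) {A : Set (Config d)} (hA : MeasurableSet A)
    (hexp : ∀ S ⊆ Λ, ∀ X : Config d,
      (∃ e ∈ Λ, e ∉ S ∧ ∀ Z : Config d, (∀ j ∈ S, Z j = X j) → Z ∈ R e) ∨
      ∀ Z : Config d, (∀ j ∈ S, Z j = X j) → (Z ∈ A ↔ X ∈ A)) :
    P.real A * (1 - P.real A) ≤ ∑ j ∈ Λ, P.real (R j) * influence P A j := by
  classical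
  have h := osss_aux hP hR hA hexp _ ∅ (Finset.empty_subset _) rfl 0
  have h0 : ∀ Y : Config d, mix ∅ 0 Y = Y := fun Y => by funext j; simp [mix]
  simp only [h0, Set.ofPred_mem_eq, Set.inter_self, Finset.sdiff_empty] at h
  linarith

open Classical in
lemma influence_le (hP : IsProductUniform P) {A : Set (Config d)} (hA : MeasurableSet A)
    (e : Edge d) (a : ℝ) :
    influence P A e ≤ 2 * P.real {X | ¬ (X ∈ A ↔ mix {e} (fun _ => a) X ∈ A)} := by
  have := hP.1
  set D : Set (Config d) := {X | ¬ (X ∈ A ↔ mix {e} (fun _ => a) X ∈ A)} with hD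
  have hDm : MeasurableSet D := measurableSet_iff hA (measurable_mix_right {e} _ hA)
  have hmm : ∀ X Y : Config d, mix {e} (fun _ => a) (mix {e} X Y) = mix {e} (fun _ => a) Y := by
    intro X Y
    funext j
    by_cases hj : j = e <;> simp [mix, hj]
  have h1 : {z : Config d × Config d | ¬ (z.2 ∈ A ↔ mix {e} z.1 z.2 ∈ A)} ⊆
      (Set.univ ×ˢ D) ∪ {z | mix {e} z.1 z.2 ∈ D} := by
    rintro ⟨X, Y⟩ hz
    simp only [Set.mem_union, Set.mem_prod, Set.mem_univ, true_and, Set.mem_ofPred_eq, hD, hmm]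
      at hz ⊢
    tauto
  have h2 : (P.prod P).real {z | mix {e} z.1 z.2 ∈ D} = P.real D := by
    rw [measureReal_def, ← hP.measure_eq_prod {e} hDm, measureReal_def]
  have h3 : (P.prod P).real (Set.univ ×ˢ D) = P.real D := by
    rw [measureReal_def, Measure.prod_prod]; simp [measureReal_def]
  calc influence P A e ≤ _ := measureReal_mono h1
    _ ≤ _ := measureReal_union_le _ _
    _ = 2 * P.real D := by rw [h2, h3]; ring

end OSSS

/-! ### Consistent labellings in finite volume -/

section Consistency

variable {d : ℕ}

/-- Along a well-founded precedence relation, the dynamics can be solved. -/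
lemma exists_labelling (κ : ℕ) {r : Edge d → Edge d → Prop} (hr : WellFounded r) :
    ∃ σ : Edge d → Prop, ∀ e, σ e ↔ ∀ v ∈ e, Set.ncard {f | v ∈ f ∧ r f e ∧ σ f} < κ := by
  let F : (e : Edge d) → ((f : Edge d) → r f e → Prop) → Prop :=
    fun e rec => ∀ v ∈ e, Set.ncard {f | v ∈ f ∧ ∃ h : r f e, rec f h} < κ
  refine ⟨hr.fix F, fun e => ?_⟩
  conv_lhs => rw [hr.fix_eq F e]
  simp only [F, exists_prop]

/-- Locality: two labellings agree on a finite set of edges stable under predecessors if they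
are driven by the same precedence relation there. -/
lemma labelling_eqOn {κ : ℕ} {σ₁ σ₂ : Edge d → Prop} {r₁ r₂ : Edge d → Edge d → Prop}
    {D : Set (Edge d)} (hD : D.Finite) (X : Config d)
    (h₁ : ∀ e ∈ D, (σ₁ e ↔ ∀ v ∈ e, Set.ncard {f | v ∈ f ∧ r₁ f e ∧ σ₁ f} < κ))
    (h₂ : ∀ e ∈ D, (σ₂ e ↔ ∀ v ∈ e, Set.ncard {f | v ∈ f ∧ r₂ f e ∧ σ₂ f} < κ))
    (hr : ∀ e ∈ D, ∀ f, Touch e f → (r₁ f e ↔ r₂ f e))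
    (hmem : ∀ e ∈ D, ∀ f, Touch e f → r₁ f e → f ∈ D)
    (hlt : ∀ e ∈ D, ∀ f, Touch e f → r₁ f e → X f < X e) :
    ∀ e ∈ D, (σ₁ e ↔ σ₂ e) := by
  suffices h : ∀ n, ∀ e ∈ D, Set.ncard {f | f ∈ D ∧ X f < X e} = n → (σ₁ e ↔ σ₂ e) from
    fun e he => h _ e he rfl
  intro n
  induction n using Nat.strong_induction_on with
  | _ n ih =>
    intro e he hn
    have key : ∀ v ∈ e, {f | v ∈ f ∧ r₁ f e ∧ σ₁ f} = {f | v ∈ f ∧ r₂ f e ∧ σ₂ f} := by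
      intro v hv
      ext f
      simp only [Set.mem_ofPred_eq]
      refine and_congr_right fun hvf => ?_
      have ht : Touch e f := ⟨v, hv, hvf⟩
      rw [← hr e he f ht]
      refine and_congr_right fun hrf => ?_
      have hfD := hmem e he f ht hrf
      have hXf := hlt e he f ht hrf
      refine ih _ ?_ f hfD rfl
      rw [← hn]
      refine Set.ncard_lt_ncard ?_ (hD.subset fun _ h => h.1)
      refine ⟨fun g hg => ⟨hg.1, hg.2.trans hXf⟩, fun h => ?_⟩
      exact lt_irrefl _ (h ⟨hfD, hXf⟩ : f ∈ {g | g ∈ D ∧ X g < X f}).2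
    rw [h₁ e he, h₂ e he]
    exact forall₂_congr fun v hv => by rw [key v hv]

/-- `O` is the set of `p`-open edges of the process restricted to `Λ`. -/
def IsOpenSet (κ : ℕ) (Λ : Finset (Edge d)) (p : ℝ) (X : Config d) (O : Finset (Edge d)) : Prop :=
  ∀ e, e ∈ O ↔ e ∈ Λ ∧ X e ≤ p ∧ ∀ v ∈ e, Set.ncard {f | v ∈ f ∧ X f < X e ∧ f ∈ O} < κ

lemma exists_isOpenSet (κ : ℕ) (Λ : Finset (Edge d)) (p : ℝ) (X : Config d) :
    ∃ O, IsOpenSet κ Λ p X O := by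
  classical
  have hwf : WellFounded fun f e : Edge d => f ∈ Λ ∧ X f < X e := by
    refine Subrelation.wf (r := InvImage (· < ·) fun e => (Λ.filter fun g => X g < X e).card)
      (fun {f e} h => Finset.card_lt_card ?_) (InvImage.wf _ wellFounded_lt)
    rw [Finset.ssubset_iff_of_subset]
    · exact ⟨f, by simp [h.1, h.2], by simp⟩
    · intro g
      simp only [Finset.mem_filter]
      exact fun hg => ⟨hg.1, hg.2.trans h.2⟩
  obtain ⟨σ, hσ⟩ := exists_labelling κ hwf
  refine ⟨Λ.filter fun e => X e ≤ p ∧ σ e, fun e => ?_⟩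
  rw [Finset.mem_filter]
  refine and_congr_right fun _ => and_congr_right fun hp => ?_
  rw [hσ e]
  refine forall₂_congr fun v _ => ?_
  have : {f | v ∈ f ∧ (f ∈ Λ ∧ X f < X e) ∧ σ f} =
      {f | v ∈ f ∧ X f < X e ∧ f ∈ Λ.filter fun e => X e ≤ p ∧ σ e} := by
    ext f
    simp only [Set.mem_ofPred_eq, Finset.mem_filter]
    constructor
    · rintro ⟨h1, ⟨h2, h3⟩, h4⟩
      exact ⟨h1, h3, h2, h3.le.trans hp, h4⟩
    · rintro ⟨h1, h3, h2, -, h4⟩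
      exact ⟨h1, ⟨h2, h3⟩, h4⟩
  rw [this]

/-- The set of `p`-open edges of the process restricted to `Λ`. -/
noncomputable def openSet (κ : ℕ) (Λ : Finset (Edge d)) (p : ℝ) (X : Config d) :
    Finset (Edge d) := (exists_isOpenSet κ Λ p X).choose

lemma isOpenSet_openSet (κ : ℕ) (Λ : Finset (Edge d)) (p : ℝ) (X : Config d) :
    IsOpenSet κ Λ p X (openSet κ Λ p X) := (exists_isOpenSet κ Λ p X).choose_spec

variable {κ : ℕ} {Λ : Finset (Edge d)} {p : ℝ} {X Y : Config d}

/-- The dynamics inside an open set, in the form used for locality. -/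
lemma IsOpenSet.mem_iff {O : Finset (Edge d)} (h : IsOpenSet κ Λ p X O) {e : Edge d} (he : e ∈ Λ)
    (hp : X e ≤ p) :
    e ∈ O ↔ ∀ v ∈ e, Set.ncard {f | v ∈ f ∧ (f ∈ Λ ∧ X f < X e) ∧ f ∈ O} < κ := by
  rw [h e]
  have : ∀ v, {f | v ∈ f ∧ (f ∈ Λ ∧ X f < X e) ∧ f ∈ O} = {f | v ∈ f ∧ X f < X e ∧ f ∈ O} := by
    intro v
    ext f
    simp only [Set.mem_ofPred_eq]
    exact ⟨fun ⟨h1, ⟨_, h3⟩, h4⟩ => ⟨h1, h3, h4⟩,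
      fun ⟨h1, h3, h4⟩ => ⟨h1, ⟨((h f).1 h4).1, h3⟩, h4⟩⟩
  simp only [this, he, hp, true_and]

/-- The same edges of `Λ` have labels at most `p` in `X` and `Y`, and these labels are ordered
in the same way. -/
def SamePattern (Λ : Finset (Edge d)) (p : ℝ) (X Y : Config d) : Prop :=
  (∀ e ∈ Λ, ∀ f ∈ Λ, X e ≤ p → X f ≤ p → (X e < X f ↔ Y e < Y f)) ∧
    ∀ e ∈ Λ, (X e ≤ p ↔ Y e ≤ p)

lemma IsOpenSet.eq_of_samePattern {O O' : Finset (Edge d)} (hXY : SamePattern Λ p X Y)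
    (h : IsOpenSet κ Λ p X O) (h' : IsOpenSet κ Λ p Y O') : O = O' := by
  have key := labelling_eqOn (κ := κ) (σ₁ := (· ∈ O)) (σ₂ := (· ∈ O'))
    (r₁ := fun f e => f ∈ Λ ∧ X f < X e) (r₂ := fun f e => f ∈ Λ ∧ Y f < Y e)
    (D := {e | e ∈ Λ ∧ X e ≤ p}) (Λ.finite_toSet.subset fun _ h => h.1) X
    (fun e he => h.mem_iff he.1 he.2) (fun e he => h'.mem_iff he.1 ((hXY.2 e he.1).1 he.2))
    (fun e he f _ => and_congr_right fun hf =>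
      ⟨fun h1 => (hXY.1 f hf e he.1 (h1.le.trans he.2) he.2).1 h1, fun h1 =>
        (hXY.1 f hf e he.1 ((hXY.2 f hf).2 (h1.le.trans ((hXY.2 e he.1).1 he.2))) he.2).2 h1⟩)
    (fun e he f _ hr => ⟨hr.1, hr.2.le.trans he.2⟩) (fun e _ f _ hr => hr.2)
  ext e
  by_cases he : e ∈ Λ ∧ X e ≤ p
  · exact key e he
  · refine iff_of_false (fun h1 => he ⟨((h e).1 h1).1, ((h e).1 h1).2.1⟩) fun h1 => he ?_
    have := (h' e).1 h1
    exact ⟨this.1, (hXY.2 e this.1).2 this.2.1⟩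

lemma openSet_eq_of_samePattern (h : SamePattern Λ p X Y) : openSet κ Λ p X = openSet κ Λ p Y :=
  (isOpenSet_openSet κ Λ p X).eq_of_samePattern h (isOpenSet_openSet κ Λ p Y)

lemma IsOpenSet.eq_openSet {O : Finset (Edge d)} (h : IsOpenSet κ Λ p X O) :
    O = openSet κ Λ p X :=
  h.eq_of_samePattern ⟨fun _ _ _ _ _ _ => Iff.rfl, fun _ _ => Iff.rfl⟩ (isOpenSet_openSet κ Λ p X)

lemma openSet_subset {e : Edge d} (h : e ∈ openSet κ Λ p X) : e ∈ Λ ∧ X e ≤ p :=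
  let h' := (isOpenSet_openSet κ Λ p X e).1 h; ⟨h'.1, h'.2.1⟩

lemma measurableSet_of_samePattern (Λ : Finset (Edge d)) (p : ℝ) {A : Set (Config d)}
    (hA : ∀ X Y, SamePattern Λ p X Y → X ∈ A → Y ∈ A) : MeasurableSet A := by
  let φ : Config d → ((Λ × Λ) → Prop) × (Λ → Prop) := fun X =>
    (fun z => X z.1 < X z.2, fun e => X e ≤ p)
  have hφ : Measurable φ := by
    refine Measurable.prodMk (measurable_pi_lambda _ fun z => ?_) (measurable_pi_lambda _ fun e => ?_)
    · exact measurableSet_setOfPred.1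
        (measurableSet_lt (measurable_pi_apply (z.1 : Edge d)) (measurable_pi_apply (z.2 : Edge d)))
    · exact measurableSet_setOfPred.1 (measurableSet_le (measurable_pi_apply (e : Edge d)) measurable_const)
  have : A = φ ⁻¹' (φ '' A) := by
    refine subset_antisymm (Set.subset_preimage_image φ A) ?_
    rintro Y ⟨X, hX, hXY⟩
    refine hA X Y ⟨fun e he f hf _ _ => ?_, fun e he => ?_⟩ hX
    · exact iff_of_eq (congrFun (congrArg Prod.fst hXY) (⟨e, he⟩, ⟨f, hf⟩))
    · exact iff_of_eq (congrFun (congrArg Prod.snd hXY) ⟨e, he⟩)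
  rw [this]
  exact hφ (Set.toFinite _).measurableSet

/-- `l` lists the edges of `Λ` with label at most `p` in increasing order of labels. -/
def IsAct (Λ : Finset (Edge d)) (p : ℝ) (X : Config d) (l : List (Edge d)) : Prop :=
  l.Pairwise (fun a b => X a < X b) ∧ ∀ e, e ∈ l ↔ e ∈ Λ ∧ X e ≤ p

lemma IsAct.nodup {l : List (Edge d)} (h : IsAct Λ p X l) : l.Nodup :=
  h.1.imp fun hab hEq => absurd (hEq ▸ hab) (lt_irrefl _)

lemma exists_isAct (hX : Set.InjOn X Λ) : ∃ l, IsAct Λ p X l := by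
  classical
  let s := Λ.filter fun e => X e ≤ p
  let l := s.toList.mergeSort fun a b => decide (X a ≤ X b)
  have hmem : ∀ e, e ∈ l ↔ e ∈ Λ ∧ X e ≤ p := by simp [l, s]
  have h1 : l.Pairwise fun a b => decide (X a ≤ X b) :=
    List.pairwise_mergeSort (fun a b c => by simpa using le_trans)
      (fun a b => by simpa using le_total _ _) _
  have h2 : l.Nodup := (List.mergeSort_perm _ _).nodup_iff.2 s.nodup_toList
  refine ⟨l, ?_, hmem⟩
  refine (List.Pairwise.and h1 h2).imp_of_mem fun {a b} ha hb h => ?_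
  refine lt_of_le_of_ne (by simpa using h.1) fun hEq => h.2 ?_
  exact hX ((hmem a).1 ha).1 ((hmem b).1 hb).1 hEq

lemma subset_foldl_step (κ : ℕ) (l : List (Edge d)) (O : Finset (Edge d)) :
    O ⊆ l.foldl (step κ) O := by
  induction l generalizing O with
  | nil => simp
  | cons a l ih => exact (subset_step κ O a).trans (ih _)

lemma mem_foldl_step {l : List (Edge d)} {O : Finset (Edge d)} {e : Edge d} (he : e ∉ l) :
    e ∈ l.foldl (step κ) O ↔ e ∈ O := by
  induction l generalizing O with
  | nil => simp
  | cons a l ih =>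
    rw [List.mem_cons, not_or] at he
    rw [List.foldl_cons, ih he.2, mem_step_of_ne he.1]

lemma mem_of_mem_run {l : List (Edge d)} {e : Edge d} (h : e ∈ run κ l) : e ∈ l := by
  by_contra he
  rw [run, mem_foldl_step he] at h
  simp at h

lemma IsAct.isOpenSet_run {l : List (Edge d)} (h : IsAct Λ p X l) :
    IsOpenSet κ Λ p X (run κ l) := by
  intro e
  by_cases he : e ∈ Λ ∧ X e ≤ p
  swap
  · exact iff_of_false (fun h1 => he ((h.2 e).1 (mem_of_mem_run h1))) fun h1 => he ⟨h1.1, h1.2.1⟩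
  obtain ⟨l₁, l₂, rfl⟩ := List.append_of_mem ((h.2 e).2 he)
  have hnd := h.nodup
  rw [List.nodup_append] at hnd
  have he1 : e ∉ l₁ := fun h1 => hnd.2.2 e h1 e (by simp) rfl
  have he2 : e ∉ l₂ := (List.nodup_cons.1 hnd.2.1).1
  have hpw := List.pairwise_append.1 h.1
  have hrun : run κ (l₁ ++ e :: l₂) = l₂.foldl (step κ) (step κ (run κ l₁) e) := by
    simp [run]
  have hset : ∀ v, {f | v ∈ f ∧ X f < X e ∧ f ∈ run κ (l₁ ++ e :: l₂)} =
      {f | f ∈ run κ l₁ ∧ v ∈ f} := by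
    intro v
    ext f
    simp only [Set.mem_ofPred_eq]
    constructor
    · rintro ⟨hv, hlt, hf⟩
      refine ⟨?_, hv⟩
      have hfe : f ≠ e := fun h => lt_irrefl _ (h ▸ hlt)
      have hf2 : f ∉ l₂ := fun h2 =>
        lt_asymm hlt ((List.pairwise_cons.1 hpw.2.1).1 f h2)
      rwa [hrun, mem_foldl_step hf2, mem_step_of_ne hfe] at hf
    · rintro ⟨hf, hv⟩
      refine ⟨hv, hpw.2.2 f (mem_of_mem_run hf) e (by simp), ?_⟩
      rw [hrun]
      exact subset_foldl_step κ _ _ (subset_step κ _ _ hf)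
  simp only [hset, he, true_and]
  rw [hrun, mem_foldl_step he2, mem_step_self fun h => he1 (mem_of_mem_run h)]
  rfl

lemma IsAct.run_eq {l : List (Edge d)} (h : IsAct Λ p X l) : run κ l = openSet κ Λ p X :=
  h.isOpenSet_run.eq_openSet

end Consistency

/-! ### Influences and the increase of probabilities -/

section Influence

variable {d : ℕ} {P : Measure (Config d)} {κ : ℕ} {Λ : Finset (Edge d)} {p : ℝ} {X Y : Config d}
  {g : Finset (Edge d) → Prop}

/-- The event `g` occurs for the process in `Λ` at time `p`. -/
def evt (κ : ℕ) (Λ : Finset (Edge d)) (g : Finset (Edge d) → Prop) (p : ℝ) : Set (Config d) :=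
  {X | g (openSet κ Λ p X)}

/-- An attempt of `c` to open right after time `p` would alter `g`. -/
def pivotal (κ : ℕ) (Λ : Finset (Edge d)) (g : Finset (Edge d) → Prop) (p : ℝ) (c : Edge d) :
    Set (Config d) :=
  {X | ¬ (g (step κ (openSet κ Λ p X) c) ↔ g (openSet κ Λ p X))}

/-- The configuration in which the edges of `F` are removed. -/
noncomputable def remove (F : Finset (Edge d)) (X : Config d) : Config d := mix F (fun _ => 2) X

lemma remove_of_mem {F : Finset (Edge d)} {e : Edge d} (h : e ∈ F) : remove F X e = 2 :=
  mix_of_mem h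

lemma remove_of_notMem {F : Finset (Edge d)} {e : Edge d} (h : e ∉ F) : remove F X e = X e :=
  mix_of_notMem h

lemma measurable_remove (F : Finset (Edge d)) : Measurable (remove (d := d) F) :=
  measurable_mix_right F _

lemma remove_mix (F : Finset (Edge d)) : remove F (mix F X Y) = remove F Y := by
  funext j
  by_cases hj : j ∈ F <;> simp [remove, mix, hj]

lemma measurableSet_evt : MeasurableSet (evt κ Λ g p) :=
  measurableSet_of_samePattern Λ p fun X Y h hX => by
    simpa only [evt, Set.mem_ofPred_eq, openSet_eq_of_samePattern h] using hX

lemma measurableSet_pivotal {c : Edge d} : MeasurableSet (pivotal κ Λ g p c) :=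
  measurableSet_of_samePattern Λ p fun X Y h hX => by
    simpa only [pivotal, Set.mem_ofPred_eq, openSet_eq_of_samePattern h] using hX

lemma openSet_remove {F : Finset (Edge d)} (hp : p < 2) (hF : ∀ e ∈ F, e ∈ Λ → p < X e) :
    openSet κ Λ p (remove F X) = openSet κ Λ p X := by
  refine openSet_eq_of_samePattern ⟨fun e he f hf h1 h2 => ?_, fun e he => ?_⟩
  · have he' : e ∉ F := fun h => by rw [remove_of_mem h] at h1; linarith
    have hf' : f ∉ F := fun h => by rw [remove_of_mem h] at h2; linarith
    rw [remove_of_notMem he', remove_of_notMem hf']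
  · by_cases h : e ∈ F
    · rw [remove_of_mem h]
      exact iff_of_false (by linarith) (not_le.2 (hF e h he))
    · rw [remove_of_notMem h]

open Classical in
/-- If the removal of `e` alters `g`, the influence of `e` is carried by some trail. -/
lemma exists_trail_of_remove (hp : p < 2) (hX : Set.InjOn X Λ) {e : Edge d}
    (h : ¬ (X ∈ evt κ Λ g p ↔ remove {e} X ∈ evt κ Λ g p)) :
    ∃ m < Λ.card + 1, ∃ t ∈ trails Λ m e, t.1.Pairwise (fun a b => X a < X b) ∧
      remove (insert e t.1.toFinset) X ∈ pivotal κ Λ g p t.2 := by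
  obtain ⟨l, hl⟩ := exists_isAct (p := p) hX
  have hnd := hl.nodup
  by_cases hel : e ∈ l
  swap
  · exfalso
    apply h
    simp only [evt, Set.mem_ofPred_eq]
    rw [openSet_remove hp]
    intro e' he' he'Λ
    rw [Finset.mem_singleton.1 he'] at he'Λ ⊢
    by_contra hlt
    exact hel ((hl.2 e).2 ⟨he'Λ, not_lt.1 hlt⟩)
  obtain ⟨l₁, l₂, rfl⟩ := List.append_of_mem hel
  have hdel : ∀ fs r : List (Edge d), (fs ++ r).Perm l₂ → r.Sublist l₂ →
      IsAct Λ p (remove (insert e fs.toFinset) X) (l₁ ++ r) := by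
    intro fs r hperm hr
    have hperm2 : (l₁ ++ e :: l₂).Perm ((e :: fs) ++ (l₁ ++ r)) := by
      refine List.perm_middle.trans (List.Perm.cons e ?_)
      refine (List.Perm.append_left l₁ hperm.symm).trans ?_
      change (l₁ ++ (fs ++ r)).Perm (fs ++ (l₁ ++ r))
      rw [← List.append_assoc, ← List.append_assoc]
      exact List.Perm.append_right r List.perm_append_comm
    have hnd2 := List.nodup_append.1 (hperm2.nodup_iff.1 hnd)
    have hnot : ∀ x ∈ l₁ ++ r, x ∉ insert e fs.toFinset := by
      intro x hx hx'
      refine hnd2.2.2 x ?_ x hx rfl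
      simpa using hx'
    constructor
    · have hsub : (l₁ ++ r).Sublist (l₁ ++ e :: l₂) := (hr.cons e).append_left l₁
      refine (hl.1.sublist hsub).imp_of_mem fun {a b} ha hb hab => ?_
      rwa [remove_of_notMem (hnot a ha), remove_of_notMem (hnot b hb)]
    · intro x
      by_cases hx : x ∈ insert e fs.toFinset
      · refine iff_of_false (fun h1 => hnot x h1 hx) fun h1 => ?_
        rw [remove_of_mem hx] at h1
        linarith [h1.2]
      · rw [remove_of_notMem hx, ← hl.2 x, hperm2.mem_iff, List.mem_append (s := e :: fs)]
        have : x ∉ e :: fs := by simpa using hx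
        simp only [this, false_or]
  have h0 : IsAct Λ p (remove {e} X) (l₁ ++ l₂) := by
    simpa using hdel [] l₂ (by simp) (List.Sublist.refl _)
  simp only [evt, Set.mem_ofPred_eq, ← hl.run_eq, ← h0.run_eq] at h
  have hd := List.nodup_append.1 hnd
  obtain ⟨fs, c, r, ht, hfs, hr, hperm, hgc⟩ := exists_trail g κ Λ l₂ (run κ l₁) e hd.2.1
    (fun x hx hx' => hd.2.2 x (mem_of_mem_run hx') x hx rfl)
    (fun x hx => ((hl.2 x).1 (by simp [hx])).1)
    (fun hEq => h (by simpa [run] using iff_of_eq hEq))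
  refine ⟨fs.length, ?_, (fs, c), ht, ?_, ?_⟩
  · have h1 : fs.Nodup := (hd.2.1.of_cons).sublist hfs
    rw [← List.toFinset_card_of_nodup h1]
    refine Nat.lt_succ_of_le (Finset.card_le_card fun x hx => ?_)
    exact ((hl.2 x).1 (by simp [hfs.subset (List.mem_toFinset.1 hx)])).1
  · refine (hl.1.sublist (hfs.trans ?_))
    exact (List.sublist_cons_self e l₂).trans (List.sublist_append_right l₁ _)
  · have h1 := hdel fs r hperm hr
    simp only [pivotal, Set.mem_ofPred_eq, ← h1.run_eq]
    intro hiff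
    apply hgc
    simpa [run] using hiff

open Classical in
lemma measureReal_trail_le (hP : IsProductUniform P) (hp0 : 0 ≤ p) (hp1 : p < 1) {m : ℕ}
    {e : Edge d} {t : List (Edge d) × Edge d} (ht : t ∈ trails Λ m e) :
    P.real ({X | t.1.Pairwise (fun a b => X a < X b)} ∩
        {X | remove (insert e t.1.toFinset) X ∈ pivotal κ Λ g p t.2}) ≤
      1 / (m.factorial : ℝ) * (1 - p)⁻¹ ^ (m + 1) *
        P.real (pivotal κ Λ g p t.2 ∩ {X | p < X t.2}) := by
  have := hP.1
  set F : Finset (Edge d) := insert e t.1.toFinset with hF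
  set Q : Set (Config d) := {X | remove F X ∈ pivotal κ Λ g p t.2} with hQ
  have hQm : MeasurableSet Q := measurable_remove F measurableSet_pivotal
  have hcard : F.card ≤ m + 1 := by
    refine (Finset.card_insert_le _ _).trans (Nat.succ_le_succ ?_)
    exact (List.toFinset_card_le _).trans (trails_length ht).le
  have hcF : t.2 ∈ F := by
    rcases trails_end_mem ht with h | h <;> simp [hF, h]
  have hQF : ∀ X Y, mix F X Y ∈ Q ↔ Y ∈ Q := fun X Y => by
    simp only [hQ, Set.mem_ofPred_eq, remove_mix]
  have h1 : P.real ({X | t.1.Pairwise (fun a b => X a < X b)} ∩ Q) =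
      P.real {X : Config d | t.1.Pairwise (fun a b => X a < X b)} * P.real Q := by
    refine hP.measureReal_inter F (measurableSet_increasing _) hQm (fun X Y => ?_) hQF
    have hin : ∀ a ∈ t.1, mix F X Y a = X a := fun a ha => mix_of_mem (by simp [hF, ha])
    simp only [Set.mem_ofPred_eq]
    exact ⟨fun h => h.imp_of_mem fun {a b} ha hb h => by rwa [hin a ha, hin b hb] at h,
      fun h => h.imp_of_mem fun {a b} ha hb h => by rwa [hin a ha, hin b hb]⟩
  set L : Set (Config d) := {X | ∀ f ∈ F, X f ∈ Set.Ioc p 1} with hL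
  have hLm : MeasurableSet L := measurableSet_cylinder F (fun _ => Set.Ioc p 1)
    fun _ _ => measurableSet_Ioc
  have hLP : P.real L = (1 - p) ^ F.card := by
    have h := hP.2 F (fun _ => Set.Ioc p 1) fun _ _ => measurableSet_Ioc
    have h' : Set.Ioc p 1 ∩ Set.Icc 0 1 = Set.Ioc p 1 :=
      Set.inter_eq_left.2 fun x hx => ⟨hp0.trans hx.1.le, hx.2⟩
    rw [h'] at h
    rw [measureReal_def, hL, h]
    simp [hp1.le]
  have h2 : P.real (L ∩ Q) = P.real L * P.real Q := by
    refine hP.measureReal_inter F hLm hQm (fun X Y => ?_) hQF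
    exact forall₂_congr fun f hf => by rw [mix_of_mem hf]
  have h3 : L ∩ Q ⊆ pivotal κ Λ g p t.2 ∩ {X | p < X t.2} := by
    rintro X ⟨hXL, hXQ⟩
    refine ⟨?_, (hXL _ hcF).1⟩
    have := openSet_remove (κ := κ) (Λ := Λ) (F := F) (X := X) (by linarith : p < 2)
      fun f hf _ => (hXL f hf).1
    simpa only [hQ, pivotal, Set.mem_ofPred_eq, this] using hXQ
  have h4 : (1 - p) ^ (m + 1) * P.real Q ≤ P.real (pivotal κ Λ g p t.2 ∩ {X | p < X t.2}) := by
    refine le_trans ?_ (measureReal_mono h3)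
    rw [h2, hLP]
    refine mul_le_mul_of_nonneg_right ?_ measureReal_nonneg
    exact pow_le_pow_of_le_one (by linarith) (by linarith) hcard
  have h5 := hP.measureReal_increasing_le t.1
  rw [trails_length ht] at h5
  rw [h1, mul_assoc]
  refine mul_le_mul h5 ?_ measureReal_nonneg (by positivity)
  have hpos : 0 < (1 - p) ^ (m + 1) := pow_pos (by linarith) _
  rw [inv_pow, ← div_eq_inv_mul, le_div_iff₀ hpos]
  linarith

/-- The sum of the influences is controlled by the sum of the pivotality probabilities. -/
lemma sum_measureReal_remove_le (hP : IsProductUniform P) (hp0 : 0 ≤ p) (hp1 : p < 1) {B : ℕ}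
    (hB : ∀ e ∈ Λ, (nbr Λ e).card ≤ B) :
    ∑ e ∈ Λ, P.real {X | ¬ (X ∈ evt κ Λ g p ↔ remove {e} X ∈ evt κ Λ g p)} ≤
      (1 - p)⁻¹ * Real.exp (2 * B * (1 - p)⁻¹) *
        ∑ c ∈ Λ, P.real (pivotal κ Λ g p c ∩ {X | p < X c}) := by
  classical
  have := hP.1
  set w : Edge d → ℝ := fun c => P.real (pivotal κ Λ g p c ∩ {X | p < X c}) with hw
  have hw0 : ∀ c, 0 ≤ w c := fun c => measureReal_nonneg
  have h1p : 0 < (1 - p)⁻¹ := inv_pos.2 (by linarith)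
  have hterm : ∀ e ∈ Λ, P.real {X | ¬ (X ∈ evt κ Λ g p ↔ remove {e} X ∈ evt κ Λ g p)} ≤
      ∑ m ∈ Finset.range (Λ.card + 1), ∑ t ∈ trails Λ m e,
        1 / (m.factorial : ℝ) * (1 - p)⁻¹ ^ (m + 1) * w t.2 := by
    intro e _
    have hsub : P.real {X | ¬ (X ∈ evt κ Λ g p ↔ remove {e} X ∈ evt κ Λ g p)} ≤
        P.real (⋃ m ∈ Finset.range (Λ.card + 1), ⋃ t ∈ trails Λ m e,
          ({X | t.1.Pairwise (fun a b => X a < X b)} ∩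
            {X | remove (insert e t.1.toFinset) X ∈ pivotal κ Λ g p t.2})) := by
      refine ENNReal.toReal_mono (measure_ne_top _ _) (measure_mono_ae ?_)
      filter_upwards [hP.ae_injective] with X hX hXA
      obtain ⟨m, hm, t, ht, h1, h2⟩ :=
        exists_trail_of_remove (by linarith) hX.injOn hXA
      exact Set.mem_biUnion (Finset.mem_coe.2 (Finset.mem_range.2 hm))
        (Set.mem_biUnion (Finset.mem_coe.2 ht) ⟨h1, h2⟩)
    refine hsub.trans ((measureReal_biUnion_finset_le _ _).trans ?_)
    refine Finset.sum_le_sum fun m _ => (measureReal_biUnion_finset_le _ _).trans ?_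
    exact Finset.sum_le_sum fun t ht => measureReal_trail_le hP hp0 hp1 ht
  refine (Finset.sum_le_sum hterm).trans ?_
  rw [Finset.sum_comm]
  have hm : ∀ m ∈ Finset.range (Λ.card + 1),
      ∑ e ∈ Λ, ∑ t ∈ trails Λ m e, 1 / (m.factorial : ℝ) * (1 - p)⁻¹ ^ (m + 1) * w t.2 ≤
      (2 * B * (1 - p)⁻¹) ^ m / m.factorial * ((1 - p)⁻¹ * ∑ c ∈ Λ, w c) := by
    intro m _
    simp only [← Finset.mul_sum]
    refine (mul_le_mul_of_nonneg_left (sum_trails_le hB w hw0 m) (by positivity)).trans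
      (le_of_eq ?_)
    rw [mul_pow _ ((1 - p)⁻¹)]
    ring
  refine (Finset.sum_le_sum hm).trans ?_
  rw [← Finset.sum_mul]
  have hexp := Real.sum_le_exp_of_nonneg (x := 2 * B * (1 - p)⁻¹) (by positivity) (Λ.card + 1)
  have hS : 0 ≤ ∑ c ∈ Λ, w c := Finset.sum_nonneg fun c _ => hw0 c
  calc _ ≤ Real.exp (2 * B * (1 - p)⁻¹) * ((1 - p)⁻¹ * ∑ c ∈ Λ, w c) :=
        mul_le_mul_of_nonneg_right hexp (by positivity)
    _ = _ := by ring

lemma openSet_mono {q : ℝ} (hpq : p ≤ q) : openSet κ Λ p X ⊆ openSet κ Λ q X := by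
  have h1 := isOpenSet_openSet κ Λ p X
  have h2 := isOpenSet_openSet κ Λ q X
  have key := labelling_eqOn (κ := κ) (σ₁ := (· ∈ openSet κ Λ p X)) (σ₂ := (· ∈ openSet κ Λ q X))
    (r₁ := fun f e => f ∈ Λ ∧ X f < X e) (r₂ := fun f e => f ∈ Λ ∧ X f < X e)
    (D := {e | e ∈ Λ ∧ X e ≤ p}) (Λ.finite_toSet.subset fun _ h => h.1) X
    (fun e he => h1.mem_iff he.1 he.2) (fun e he => h2.mem_iff he.1 (he.2.trans hpq))
    (fun _ _ _ _ => Iff.rfl)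
    (fun e he f _ hr => ⟨hr.1, hr.2.le.trans he.2⟩) (fun e _ f _ hr => hr.2)
  exact fun e he => (key e (openSet_subset he)).1 he

/-- When `c` is the only edge with label in `(p, q]`, it attempts to open last. -/
lemma openSet_eq_step {q : ℝ} {c : Edge d} (hX : Set.InjOn X Λ) (hc : c ∈ Λ)
    (hpc : p < X c) (hcq : X c ≤ q) (h : ∀ f ∈ Λ, f ≠ c → ¬ (p < X f ∧ X f ≤ q)) :
    openSet κ Λ q X = step κ (openSet κ Λ p X) c := by
  obtain ⟨l, hl⟩ := exists_isAct (p := p) hX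
  have hl' : IsAct Λ q X (l ++ [c]) := by
    refine ⟨List.pairwise_append.2 ⟨hl.1, by simp, fun a ha b hb => ?_⟩, fun e => ?_⟩
    · rw [List.mem_singleton.1 hb]
      exact ((hl.2 a).1 ha).2.trans_lt hpc
    · rw [List.mem_append, hl.2 e, List.mem_singleton]
      constructor
      · rintro (h1 | rfl)
        · exact ⟨h1.1, h1.2.trans (hpc.le.trans hcq)⟩
        · exact ⟨hc, hcq⟩
      · rintro ⟨h1, h2⟩
        by_cases hec : e = c
        · exact Or.inr hec
        · exact Or.inl ⟨h1, not_lt.1 fun h3 => h e h1 hec ⟨h3, h2⟩⟩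
  rw [← hl'.run_eq, ← hl.run_eq]
  simp [run]

/-- A discrete form of Russo's formula. -/
lemma evt_increment (hP : IsProductUniform P) (hg : ∀ O O', O ⊆ O' → g O → g O') (hp0 : 0 ≤ p)
    {h : ℝ} (hh : 0 ≤ h) (hph : p + h ≤ 1) :
    h * ∑ c ∈ Λ, P.real (pivotal κ Λ g p c ∩ {X | p < X c}) - Λ.card ^ 2 * h ^ 2 ≤
      P.real (evt κ Λ g (p + h)) - P.real (evt κ Λ g p) := by
  classical
  have := hP.1
  set I : Set ℝ := Set.Ioc p (p + h) with hI
  have hcoord : ∀ c : Edge d, P.real {X | X c ∈ I} = h := fun c => by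
    rw [hP.measureReal_Ioc c hp0 (by linarith) hph]; ring
  have hcm : ∀ c : Edge d, MeasurableSet {X : Config d | X c ∈ I} := fun c =>
    measurable_pi_apply c measurableSet_Ioc
  set N : Edge d → Set (Config d) := fun c => {X | ∃ f ∈ Λ, f ≠ c ∧ X f ∈ I} with hN
  have hNm : ∀ c, MeasurableSet (N c) := fun c => by
    have : N c = ⋃ f ∈ Λ.erase c, {X : Config d | X f ∈ I} := by
      ext X; simp only [hN, Set.mem_ofPred_eq, Set.mem_iUnion, Finset.mem_erase]; tauto
    rw [this]
    exact Finset.measurableSet_biUnion _ fun f _ => hcm f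
  set G : Edge d → Set (Config d) := fun c => pivotal κ Λ g p c ∩ {X | X c ∈ I} with hG
  have hGm : ∀ c, MeasurableSet (G c) := fun c => measurableSet_pivotal.inter (hcm c)
  have hGc : ∀ c, h * P.real (pivotal κ Λ g p c ∩ {X | p < X c}) ≤ P.real (G c) := by
    intro c
    set Q : Set (Config d) := {X | remove {c} X ∈ pivotal κ Λ g p c} with hQ
    have hQm : MeasurableSet Q := measurable_remove {c} measurableSet_pivotal
    have hmem : ∀ X : Config d, p < X c → (X ∈ Q ↔ X ∈ pivotal κ Λ g p c) := by
      intro X hX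
      have := openSet_remove (κ := κ) (Λ := Λ) (F := {c}) (X := X) (by linarith : p < 2)
        fun f hf _ => by rwa [Finset.mem_singleton.1 hf]
      simp only [hQ, pivotal, Set.mem_ofPred_eq, this]
    have h1 : G c = {X | X c ∈ I} ∩ Q := by
      ext X
      exact ⟨fun hX => ⟨hX.2, (hmem X hX.2.1).2 hX.1⟩, fun hX => ⟨(hmem X hX.1.1).1 hX.2, hX.1⟩⟩
    have h2 : P.real ({X | X c ∈ I} ∩ Q) = P.real {X : Config d | X c ∈ I} * P.real Q :=
      hP.measureReal_inter {c} (hcm c) hQm (fun X Y => by simp [mix])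
        fun X Y => by simp only [hQ, Set.mem_ofPred_eq, remove_mix]
    rw [h1, h2, hcoord c]
    exact mul_le_mul_of_nonneg_left
      (measureReal_mono fun X hX => (hmem X hX.2).2 hX.1) hh
  have hGN : ∀ c ∈ Λ, P.real (G c ∩ N c) ≤ Λ.card * h ^ 2 := by
    intro c _
    have hsub : G c ∩ N c ⊆ ⋃ f ∈ Λ.erase c, ({X : Config d | X c ∈ I} ∩ {X | X f ∈ I}) := by
      rintro X ⟨⟨-, hXc⟩, f, hf, hfc, hXf⟩
      exact Set.mem_biUnion (Finset.mem_coe.2 (Finset.mem_erase.2 ⟨hfc, hf⟩)) ⟨hXc, hXf⟩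
    refine (measureReal_mono hsub (measure_ne_top _ _)).trans
      ((measureReal_biUnion_finset_le _ _).trans ?_)
    have hpair : ∀ f ∈ Λ.erase c,
        P.real ({X : Config d | X c ∈ I} ∩ {X | X f ∈ I}) = h ^ 2 := by
      intro f hf
      have hfc := (Finset.mem_erase.1 hf).1
      rw [hP.measureReal_inter {c} (hcm c) (hcm f) (fun X Y => by simp [mix])
        (fun X Y => by simp [mix, hfc]), hcoord, hcoord, sq]
    rw [Finset.sum_congr rfl hpair, Finset.sum_const, nsmul_eq_mul]
    exact mul_le_mul_of_nonneg_right
      (by exact_mod_cast Finset.card_le_card (Finset.erase_subset c Λ)) (sq_nonneg h)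
  have hdiff : ∀ c ∈ Λ, h * P.real (pivotal κ Λ g p c ∩ {X | p < X c}) - Λ.card * h ^ 2 ≤
      P.real (G c \ N c) := by
    intro c hc
    have := measureReal_inter_add_sdiff (μ := P) (s := G c) (hNm c)
    linarith [hGc c, hGN c hc]
  have hdisj : (Λ : Set (Edge d)).PairwiseDisjoint fun c => G c \ N c := by
    intro c _ c' hc' hcc'
    rw [Function.onFun, Set.disjoint_left]
    rintro X ⟨-, hXN⟩ ⟨⟨-, hXc'⟩, -⟩
    exact hXN ⟨c', hc', fun h => hcc' h.symm, hXc'⟩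
  have hunion : P.real (⋃ c ∈ Λ, G c \ N c) = ∑ c ∈ Λ, P.real (G c \ N c) :=
    measureReal_biUnion_finset hdisj fun c _ => (hGm c).diff (hNm c)
  have hincl : P.real (⋃ c ∈ Λ, G c \ N c) ≤ P.real (evt κ Λ g (p + h) \ evt κ Λ g p) := by
    refine ENNReal.toReal_mono (measure_ne_top _ _) (measure_mono_ae ?_)
    filter_upwards [hP.ae_injective] with X hX hXU
    obtain ⟨c, hc, ⟨⟨hpiv, hXc⟩, hXN⟩⟩ : ∃ c ∈ Λ, X ∈ G c \ N c := by
      have hXU' : X ∈ ⋃ c ∈ Λ, G c \ N c := hXU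
      simpa only [Set.mem_iUnion, exists_prop] using hXU'
    have hst := openSet_eq_step (κ := κ) hX.injOn hc hXc.1 hXc.2
      fun f hf hfc hfI => hXN ⟨f, hf, hfc, hfI⟩
    have hno : ¬ g (openSet κ Λ p X) := fun h1 =>
      hpiv (iff_of_true (hg _ _ (subset_step κ _ c) h1) h1)
    have hyes : g (openSet κ Λ (p + h) X) := by
      rw [hst]
      by_contra h2
      exact hpiv (iff_of_false h2 hno)
    exact ⟨hyes, hno⟩
  have hmono : evt κ Λ g p ⊆ evt κ Λ g (p + h) := fun X hX =>
    hg _ _ (openSet_mono (by linarith)) hX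
  have hfin := measureReal_sdiff (μ := P) hmono measurableSet_evt
  rw [← hfin]
  refine le_trans ?_ (hunion ▸ hincl)
  refine le_trans (le_of_eq ?_) (Finset.sum_le_sum hdiff)
  rw [Finset.sum_sub_distrib, Finset.sum_const, nsmul_eq_mul, Finset.mul_sum]
  ring

end Influence

/-! ### Clusters and their exploration -/

section Exploration

variable {d : ℕ}

/-- Connection by a path of edges of `S`. -/
def Conn (S : Set (Edge d)) (a b : Vertex d) : Prop :=
  Relation.ReflTransGen (fun x y => s(x, y) ∈ S) a b

lemma Conn.symm {S : Set (Edge d)} {a b : Vertex d} (h : Conn S a b) : Conn S b a := by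
  induction h with
  | refl => exact .refl
  | @tail c b _ hcb ih =>
    refine Relation.ReflTransGen.head ?_ ih
    rwa [Sym2.eq_swap]

lemma Conn.mono {S T : Set (Edge d)} (hST : S ⊆ T) {a b : Vertex d} (h : Conn S a b) :
    Conn T a b := by
  induction h with
  | refl => exact .refl
  | tail _ hcb ih => exact ih.tail (hST hcb)

/-- Edges whose end-vertices have norm at most `n`. -/
def box (d n : ℕ) : Set (Edge d) := {e | ∀ v ∈ e, norm1 v ≤ n}

/-- `0` is connected to the sphere of radius `n` in `O`, inside the ball of radius `n`. -/
def arm (n : ℕ) (O : Finset (Edge d)) : Prop :=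
  ∃ b : Vertex d, norm1 b = n ∧ Conn (↑O ∩ box d n) 0 b

lemma arm_mono {n : ℕ} {O O' : Finset (Edge d)} (h : O ⊆ O') : arm n O → arm n O' :=
  fun ⟨b, hb, hc⟩ => ⟨b, hb, hc.mono (Set.inter_subset_inter_left _ (by exact_mod_cast h))⟩

lemma abs_norm1_sub_le {x y : Vertex d} (h : adj x y) : |norm1 x - norm1 y| ≤ 1 := by
  unfold adj at h
  rw [← h, norm1, norm1, ← Finset.sum_sub_distrib]
  refine (Finset.abs_sum_le_sum_abs _ _).trans (Finset.sum_le_sum fun i _ => ?_)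
  exact abs_abs_sub_abs_le_abs_sub _ _

lemma adj.symm {x y : Vertex d} (h : adj x y) : adj y x := by
  unfold adj at h ⊢
  simpa only [abs_sub_comm] using h

lemma adj_of_isNNEdge {x y : Vertex d} (h : IsNNEdge s(x, y)) : adj x y := by
  obtain ⟨a, b, hab, hEq⟩ := h
  rcases Sym2.eq_iff.1 hEq with ⟨rfl, rfl⟩ | ⟨rfl, rfl⟩
  · exact hab
  · exact hab.symm

lemma Conn.exists_norm1_eq {S : Set (Edge d)} (hS : ∀ e ∈ S, IsNNEdge e) {a b : Vertex d} {k : ℤ}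
    (h : Conn S a b) (ha : norm1 a ≤ k) (hb : k ≤ norm1 b) :
    ∃ w, norm1 w = k ∧ Conn S a w ∧ Conn S w b := by
  induction h with
  | refl => exact ⟨a, le_antisymm ha hb, .refl, .refl⟩
  | @tail c b hac hcb ih =>
    by_cases hc : k ≤ norm1 c
    · obtain ⟨w, hw, h1, h2⟩ := ih hc
      exact ⟨w, hw, h1, h2.tail hcb⟩
    · have h1 := abs_le.1 (abs_norm1_sub_le (adj_of_isNNEdge (hS _ hcb)))
      exact ⟨b, by omega, hac.tail hcb, .refl⟩

/-- The vertices connected to the sphere of radius `k` inside the ball of radius `n`. -/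
def clus (κ : ℕ) (Λ : Finset (Edge d)) (n : ℕ) (p : ℝ) (k : ℕ) (X : Config d) :
    Set (Vertex d) :=
  {v | ∃ b : Vertex d, norm1 b = k ∧ Conn (↑(openSet κ Λ p X) ∩ box d n) b v}

variable {κ : ℕ} {Λ : Finset (Edge d)} {n : ℕ} {p : ℝ} {k : ℕ}

/-- The edges whose status is queried in the exploration of `clus`: those touching the
cluster and their predecessors, among the edges with label at most `p`. -/
inductive Explored (κ : ℕ) (Λ : Finset (Edge d)) (n : ℕ) (p : ℝ) (k : ℕ) (X : Config d) :
    Edge d → Prop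
  | base {e : Edge d} {v : Vertex d} (he : e ∈ Λ) (hp : X e ≤ p) (hv : v ∈ e)
      (hc : v ∈ clus κ Λ n p k X) : Explored κ Λ n p k X e
  | pred {e f : Edge d} (hf : Explored κ Λ n p k X f) (ht : Touch f e) (he : e ∈ Λ)
      (hlt : X e < X f) : Explored κ Λ n p k X e

lemma Explored.mem {X : Config d} {e : Edge d} (h : Explored κ Λ n p k X e) : e ∈ Λ := by
  cases h <;> assumption

lemma Explored.le {X : Config d} {e : Edge d} (h : Explored κ Λ n p k X e) : X e ≤ p := by
  induction h with
  | base _ hp => exact hp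
  | pred _ _ _ hlt ih => exact hlt.le.trans ih

/-- The event that the label of `e` is revealed by the exploration of `clus`. -/
def revealed (κ : ℕ) (Λ : Finset (Edge d)) (n : ℕ) (p : ℝ) (k : ℕ) (e : Edge d) :
    Set (Config d) :=
  {X | e ∈ Λ ∧ ((∃ v ∈ e, v ∈ clus κ Λ n p k X) ∨ ∃ f, Explored κ Λ n p k X f ∧ Touch f e)}

lemma clus_eq_of_samePattern {X Y : Config d} (h : SamePattern Λ p X Y) :
    clus κ Λ n p k X = clus κ Λ n p k Y := by
  simp only [clus, openSet_eq_of_samePattern h]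

lemma Explored.of_samePattern {X Y : Config d} (h : SamePattern Λ p X Y) {e : Edge d}
    (he : Explored κ Λ n p k X e) : Explored κ Λ n p k Y e := by
  induction he with
  | base he hp hv hc => exact .base he ((h.2 _ he).1 hp) hv (clus_eq_of_samePattern h ▸ hc)
  | pred hf ht he hlt ih =>
    exact .pred ih ht he ((h.1 _ he _ hf.mem (hlt.le.trans hf.le) hf.le).1 hlt)

lemma measurableSet_revealed (e : Edge d) : MeasurableSet (revealed κ Λ n p k e) := by
  refine measurableSet_of_samePattern Λ p fun X Y h hX => ⟨hX.1, ?_⟩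
  rcases hX.2 with ⟨v, hv, hc⟩ | ⟨f, hf, ht⟩
  · exact Or.inl ⟨v, hv, clus_eq_of_samePattern h ▸ hc⟩
  · exact Or.inr ⟨f, hf.of_samePattern h, ht⟩

lemma mem_clus_of_edge {X : Config d} {v w : Vertex d} (hv : v ∈ clus κ Λ n p k X)
    (he : s(v, w) ∈ (↑(openSet κ Λ p X) ∩ box d n : Set (Edge d))) : w ∈ clus κ Λ n p k X :=
  let ⟨b, hb, hc⟩ := hv
  ⟨b, hb, hc.tail he⟩

/-- If all the labels revealed for certain are those of `S`, the status of an edge touching the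
cluster is determined by `S`. -/
lemma mem_openSet_of_explored {S : Finset (Edge d)} {X : Config d}
    (H : ∀ e ∈ Λ, (∀ Z : Config d, (∀ j ∈ S, Z j = X j) → Z ∈ revealed κ Λ n p k e) → e ∈ S)
    {X₁ : Config d} (hX₁ : ∀ j ∈ S, X₁ j = X j) {v : Vertex d}
    (hv : ∀ Z : Config d, (∀ j ∈ S, Z j = X j) → v ∈ clus κ Λ n p k Z) {e : Edge d} (hve : v ∈ e)
    (he : e ∈ openSet κ Λ p X₁) {Z : Config d} (hZ : ∀ j ∈ S, Z j = X j) :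
    e ∈ openSet κ Λ p Z := by
  set D : Set (Edge d) :=
    {f | Relation.ReflTransGen (fun a b => Touch a b ∧ b ∈ Λ ∧ X₁ b < X₁ a) e f} with hD
  have hDS : ∀ f ∈ D, f ∈ Λ ∧ X₁ f ≤ p ∧ f ∈ S ∧
      ∀ Z : Config d, (∀ j ∈ S, Z j = X j) → Explored κ Λ n p k Z f := by
    intro f hf
    induction hf with
    | refl =>
      have h1 := openSet_subset he
      have h2 : e ∈ S := H e h1.1 fun Z hZ => ⟨h1.1, Or.inl ⟨v, hve, hv Z hZ⟩⟩
      refine ⟨h1.1, h1.2, h2, fun Z hZ => .base h1.1 ?_ hve (hv Z hZ)⟩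
      rw [hZ e h2, ← hX₁ e h2]
      exact h1.2
    | @tail a b _ hab ih =>
      obtain ⟨ht, hb, hlt⟩ := hab
      have h2 : b ∈ S := H b hb fun Z hZ => ⟨hb, Or.inr ⟨a, ih.2.2.2 Z hZ, ht⟩⟩
      refine ⟨hb, hlt.le.trans ih.2.1, h2, fun Z hZ => .pred (ih.2.2.2 Z hZ) ht hb ?_⟩
      rwa [hZ b h2, hZ a ih.2.2.1, ← hX₁ b h2, ← hX₁ a ih.2.2.1]
  have hXZ : ∀ f ∈ S, X₁ f = Z f := fun f hf => (hX₁ f hf).trans (hZ f hf).symm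
  have h1 := isOpenSet_openSet κ Λ p X₁
  have h2 := isOpenSet_openSet κ Λ p Z
  refine (labelling_eqOn (κ := κ) (σ₁ := (· ∈ openSet κ Λ p X₁)) (σ₂ := (· ∈ openSet κ Λ p Z))
    (r₁ := fun f e => f ∈ Λ ∧ X₁ f < X₁ e) (r₂ := fun f e => f ∈ Λ ∧ Z f < Z e)
    (D := D) (Λ.finite_toSet.subset fun f hf => (hDS f hf).1) X₁
    (fun f hf => h1.mem_iff (hDS f hf).1 (hDS f hf).2.1)
    (fun f hf => h2.mem_iff (hDS f hf).1 (hXZ f (hDS f hf).2.2.1 ▸ (hDS f hf).2.1))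
    (fun f hf f' ht => and_congr_right fun hf' => ?_)
    (fun f hf f' ht hr => hf.tail ⟨ht, hr.1, hr.2⟩) (fun f _ f' _ hr => hr.2) e .refl).1 he
  have h3 : f' ∈ S := H f' hf' fun Z hZ => ⟨hf', Or.inr ⟨f, (hDS f hf).2.2.2 Z hZ, ht⟩⟩
  rw [hXZ f' h3, hXZ f (hDS f hf).2.2.1]

lemma exploration (hΛ : ∀ e ∈ Λ, IsNNEdge e) (hkn : k ≤ n) (S : Finset (Edge d))
    (X : Config d) :
    (∃ e ∈ Λ, e ∉ S ∧ ∀ Z : Config d, (∀ j ∈ S, Z j = X j) → Z ∈ revealed κ Λ n p k e) ∨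
      ∀ Z : Config d, (∀ j ∈ S, Z j = X j) → (Z ∈ evt κ Λ (arm n) p ↔ X ∈ evt κ Λ (arm n) p) := by
  by_cases H : ∃ e ∈ Λ, e ∉ S ∧
      ∀ Z : Config d, (∀ j ∈ S, Z j = X j) → Z ∈ revealed κ Λ n p k e
  · exact Or.inl H
  right
  replace H : ∀ e ∈ Λ, (∀ Z : Config d, (∀ j ∈ S, Z j = X j) → Z ∈ revealed κ Λ n p k e) →
      e ∈ S := fun e he h => by_contra fun heS => H ⟨e, he, heS, h⟩
  suffices key : ∀ X₁ : Config d, (∀ j ∈ S, X₁ j = X j) → X₁ ∈ evt κ Λ (arm n) p →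
      ∀ Z : Config d, (∀ j ∈ S, Z j = X j) → Z ∈ evt κ Λ (arm n) p from
    fun Z hZ => ⟨fun h => key Z hZ h X fun _ _ => rfl, fun h => key X (fun _ _ => rfl) h Z hZ⟩
  rintro X₁ hX₁ ⟨b, hb, hc⟩ Z hZ
  obtain ⟨w, hw, h0w, hwb⟩ := hc.exists_norm1_eq (k := k)
    (fun e he => hΛ e (openSet_subset he.1).1) (by simp [norm1])
    (by rw [hb]; exact_mod_cast hkn)
  have hwalk : ∀ u, Conn (↑(openSet κ Λ p X₁) ∩ box d n) w u →
      (∀ Z : Config d, (∀ j ∈ S, Z j = X j) → u ∈ clus κ Λ n p k Z) ∧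
      Conn (↑(openSet κ Λ p Z) ∩ box d n) w u := by
    intro u hu
    induction hu with
    | refl => exact ⟨fun Z _ => ⟨w, hw, .refl⟩, .refl⟩
    | @tail a c _ hac ih =>
      have hop : ∀ Z : Config d, (∀ j ∈ S, Z j = X j) →
          s(a, c) ∈ (↑(openSet κ Λ p Z) ∩ box d n : Set (Edge d)) := fun Z hZ =>
        ⟨mem_openSet_of_explored H hX₁ ih.1 (Sym2.mem_mk_left a c) hac.1 hZ, hac.2⟩
      exact ⟨fun Z hZ => mem_clus_of_edge (ih.1 Z hZ) (hop Z hZ), ih.2.tail (hop Z hZ)⟩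
  exact ⟨b, hb, ((hwalk 0 h0w.symm).2.symm).trans (hwalk b hwb).2⟩

open Classical in
/-- Sequences of `m` edges of `Λ`, each sharing a vertex with its predecessor, the first one
with `e`; the last edge is recorded. -/
noncomputable def walks (Λ : Finset (Edge d)) : ℕ → Edge d → Finset (List (Edge d) × Edge d)
  | 0, e => {([], e)}
  | m + 1, e => (nbr Λ e).biUnion fun f => (walks Λ m f).image fun t => (f :: t.1, t.2)

lemma walks_length {m : ℕ} {e : Edge d} {t : List (Edge d) × Edge d}
    (ht : t ∈ walks Λ m e) : t.1.length = m := by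
  classical
  induction m generalizing e t with
  | zero => simp only [walks, Finset.mem_singleton] at ht; simp [ht]
  | succ m ih =>
    simp only [walks, Finset.mem_biUnion, Finset.mem_image] at ht
    obtain ⟨f, -, s, hs, rfl⟩ := ht
    simp [ih hs]

lemma walks_subset {m : ℕ} {e : Edge d} {t : List (Edge d) × Edge d}
    (ht : t ∈ walks Λ m e) : ∀ f ∈ t.1, f ∈ Λ := by
  classical
  induction m generalizing e t with
  | zero => simp only [walks, Finset.mem_singleton] at ht; simp [ht]
  | succ m ih =>
    simp only [walks, Finset.mem_biUnion, Finset.mem_image] at ht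
    obtain ⟨f, hf, s, hs, rfl⟩ := ht
    intro g hg
    rcases List.mem_cons.1 hg with rfl | hg
    · exact (Finset.mem_filter.1 hf).1
    · exact ih hs g hg

lemma card_walks_le {B : ℕ} (hB : ∀ e ∈ Λ, (nbr Λ e).card ≤ B) (m : ℕ) {e : Edge d}
    (he : e ∈ Λ) : (walks Λ m e).card ≤ B ^ m := by
  classical
  induction m generalizing e with
  | zero => simp [walks]
  | succ m ih =>
    simp only [walks]
    refine (Finset.card_biUnion_le_card_mul _ _ (B ^ m) fun f hf => ?_).trans ?_
    · exact Finset.card_image_le.trans (ih (Finset.mem_filter.1 hf).1)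
    · rw [pow_succ']
      exact Nat.mul_le_mul_right _ (hB e he)

lemma Explored.exists_walk {X : Config d} {e : Edge d} (h : Explored κ Λ n p k X e) :
    ∃ m, ∃ t ∈ walks Λ m e, (e :: t.1).Pairwise (fun a b => X a < X b) ∧
      ∃ v ∈ t.2, v ∈ clus κ Λ n p k X := by
  classical
  induction h with
  | @base e v _ _ hv hc => exact ⟨0, ([], e), by simp [walks], by simp, v, hv, hc⟩
  | @pred e f hf ht he hlt ih =>
    obtain ⟨m, t, htw, hpw, hv⟩ := ih
    refine ⟨m + 1, (f :: t.1, t.2), ?_, ?_, hv⟩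
    · simp only [walks, Finset.mem_biUnion, Finset.mem_image]
      exact ⟨f, Finset.mem_filter.2 ⟨hf.mem, ht.symm⟩, t, htw, rfl⟩
    · refine List.pairwise_cons.2 ⟨fun a ha => ?_, hpw⟩
      rcases List.mem_cons.1 ha with rfl | ha
      · exact hlt
      · exact hlt.trans ((List.pairwise_cons.1 hpw).1 a ha)

lemma exists_walk_of_revealed {X : Config d} {e : Edge d} (h : X ∈ revealed κ Λ n p k e) :
    ∃ m < Λ.card + 1, ∃ t ∈ walks Λ m e, t.1.Pairwise (fun a b => X a < X b) ∧
      ∃ v ∈ t.2, v ∈ clus κ Λ n p k X := by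
  classical
  have hex : ∃ m, ∃ t ∈ walks Λ m e, t.1.Pairwise (fun a b => X a < X b) ∧
      ∃ v ∈ t.2, v ∈ clus κ Λ n p k X := by
    rcases h.2 with ⟨v, hv, hc⟩ | ⟨f, hf, ht⟩
    · exact ⟨0, ([], e), by simp [walks], by simp, v, hv, hc⟩
    · obtain ⟨m, t, htw, hpw, hv⟩ := hf.exists_walk
      refine ⟨m + 1, (f :: t.1, t.2), ?_, hpw, hv⟩
      simp only [walks, Finset.mem_biUnion, Finset.mem_image]
      exact ⟨f, Finset.mem_filter.2 ⟨hf.mem, ht.symm⟩, t, htw, rfl⟩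
  obtain ⟨m, t, ht, hpw, hv⟩ := hex
  refine ⟨m, Nat.lt_succ_of_le ?_, t, ht, hpw, hv⟩
  have hnd : t.1.Nodup := hpw.imp fun hab hEq => absurd (hEq ▸ hab) (lt_irrefl _)
  rw [← walks_length ht, ← List.toFinset_card_of_nodup hnd]
  exact Finset.card_le_card fun x hx => walks_subset ht x (List.mem_toFinset.1 hx)

end Exploration

section Revealment

variable {d : ℕ} {P : Measure (Config d)} {κ : ℕ} {Λ : Finset (Edge d)} {n : ℕ} {p : ℝ}

lemma measureReal_inter_le_sqrt [IsProbabilityMeasure P] (A B : Set (Config d)) :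
    P.real (A ∩ B) ≤ √(P.real A) * √(P.real B) := by
  rw [← Real.sqrt_mul measureReal_nonneg]
  refine Real.le_sqrt_of_sq_le ?_
  rw [sq]
  exact mul_le_mul (measureReal_mono Set.inter_subset_left)
    (measureReal_mono Set.inter_subset_right) measureReal_nonneg measureReal_nonneg

lemma sum_sqrt_factorial_le (B : ℝ) (M : ℕ) :
    ∑ m ∈ Finset.range M, B ^ m * √(1 / (m.factorial : ℝ)) ≤ 2 * Real.exp (2 * B ^ 2) := by
  have hterm : ∀ m ∈ Finset.range M,
      B ^ m * √(1 / (m.factorial : ℝ)) ≤ Real.exp (2 * B ^ 2) * (1 / 2) ^ m := by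
    intro m _
    have h1 := Real.pow_div_factorial_le_exp (4 * B ^ 2) (by positivity) m
    have h2 : B ^ m * √(1 / (m.factorial : ℝ)) * 2 ^ m ≤ Real.exp (2 * B ^ 2) := by
      refine abs_le_of_sq_le_sq' ?_ (Real.exp_pos _).le |>.2
      rw [← Real.exp_nat_mul, mul_pow, mul_pow, Real.sq_sqrt (by positivity)]
      refine le_trans (le_of_eq ?_) (h1.trans (le_of_eq ?_))
      · rw [mul_pow, ← pow_mul, ← pow_mul, ← pow_mul, mul_comm m 2, pow_mul 2 2 m]
        norm_num
        ring
      · congr 1; push_cast; ring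
    rwa [one_div_pow, ← div_eq_mul_one_div, le_div_iff₀ (by positivity)]
  refine (Finset.sum_le_sum hterm).trans ?_
  rw [← Finset.mul_sum, mul_comm]
  refine mul_le_mul_of_nonneg_right ?_ (Real.exp_pos _).le
  have := sum_geometric_two_le M
  simpa using this

open Classical in
lemma sum_revealed_le (hP : IsProductUniform P) {B : ℕ} (hB : ∀ e ∈ Λ, (nbr Λ e).card ≤ B)
    {K : ℝ} (hK : ∀ v : Vertex d,
      ∑ k ∈ Finset.Icc 1 n, √(P.real {X | v ∈ clus κ Λ n p k X}) ≤ K) {e : Edge d} (he : e ∈ Λ) :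
    ∑ k ∈ Finset.Icc 1 n, P.real (revealed κ Λ n p k e) ≤ 4 * Real.exp (2 * (B : ℝ) ^ 2) * K := by
  have := hP.1
  have hK0 : 0 ≤ K := (Finset.sum_nonneg fun k _ => Real.sqrt_nonneg _).trans (hK 0)
  set u : ℕ → Vertex d → ℝ := fun k v => √(P.real {X | v ∈ clus κ Λ n p k X}) with hu
  have hone : ∀ k m, ∀ t ∈ walks Λ m e,
      P.real {X | t.1.Pairwise (fun a b => X a < X b) ∧ ∃ v ∈ t.2, v ∈ clus κ Λ n p k X} ≤
      √(1 / (m.factorial : ℝ)) * ∑ v ∈ t.2.toFinset, u k v := by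
    intro k m t ht
    have hsub : {X | t.1.Pairwise (fun a b => X a < X b) ∧ ∃ v ∈ t.2, v ∈ clus κ Λ n p k X} ⊆
        ⋃ v ∈ t.2.toFinset, ({X | t.1.Pairwise (fun a b => X a < X b)} ∩
          {X | v ∈ clus κ Λ n p k X}) := by
      rintro X ⟨h1, v, hv, h2⟩
      exact Set.mem_biUnion (Finset.mem_coe.2 (Sym2.mem_toFinset.2 hv)) ⟨h1, h2⟩
    refine (measureReal_mono hsub (measure_ne_top _ _)).trans
      ((measureReal_biUnion_finset_le _ _).trans ?_)
    rw [Finset.mul_sum]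
    refine Finset.sum_le_sum fun v _ => (measureReal_inter_le_sqrt _ _).trans ?_
    refine mul_le_mul_of_nonneg_right (Real.sqrt_le_sqrt ?_) (Real.sqrt_nonneg _)
    have := hP.measureReal_increasing_le t.1
    rwa [walks_length ht] at this
  have hk : ∀ k ∈ Finset.Icc 1 n, P.real (revealed κ Λ n p k e) ≤
      ∑ m ∈ Finset.range (Λ.card + 1), ∑ t ∈ walks Λ m e,
        √(1 / (m.factorial : ℝ)) * ∑ v ∈ t.2.toFinset, u k v := by
    intro k _
    have hsub : revealed κ Λ n p k e ⊆ ⋃ m ∈ Finset.range (Λ.card + 1), ⋃ t ∈ walks Λ m e,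
        {X | t.1.Pairwise (fun a b => X a < X b) ∧ ∃ v ∈ t.2, v ∈ clus κ Λ n p k X} := by
      intro X hX
      obtain ⟨m, hm, t, ht, h1⟩ := exists_walk_of_revealed hX
      exact Set.mem_biUnion (Finset.mem_coe.2 (Finset.mem_range.2 hm))
        (Set.mem_biUnion (Finset.mem_coe.2 ht) h1)
    refine (measureReal_mono hsub (measure_ne_top _ _)).trans
      ((measureReal_biUnion_finset_le _ _).trans ?_)
    refine Finset.sum_le_sum fun m _ => (measureReal_biUnion_finset_le _ _).trans ?_
    exact Finset.sum_le_sum fun t ht => hone k m t ht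
  refine (Finset.sum_le_sum hk).trans ?_
  rw [Finset.sum_comm]
  have hm : ∀ m ∈ Finset.range (Λ.card + 1),
      ∑ k ∈ Finset.Icc 1 n, ∑ t ∈ walks Λ m e,
        √(1 / (m.factorial : ℝ)) * ∑ v ∈ t.2.toFinset, u k v ≤
      (B : ℝ) ^ m * √(1 / (m.factorial : ℝ)) * (2 * K) := by
    intro m _
    rw [Finset.sum_comm]
    have ht : ∀ t ∈ walks Λ m e, ∑ k ∈ Finset.Icc 1 n,
        √(1 / (m.factorial : ℝ)) * ∑ v ∈ t.2.toFinset, u k v ≤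
        √(1 / (m.factorial : ℝ)) * (2 * K) := by
      intro t _
      rw [← Finset.mul_sum, Finset.sum_comm]
      refine mul_le_mul_of_nonneg_left ?_ (Real.sqrt_nonneg _)
      refine (Finset.sum_le_sum fun v _ => hK v).trans ?_
      rw [Finset.sum_const, nsmul_eq_mul]
      refine mul_le_mul_of_nonneg_right ?_ hK0
      have hc : ∀ z : Edge d, z.toFinset.card ≤ 2 := Sym2.ind fun a b => by
        rw [Sym2.toFinset_mk_eq]
        exact Finset.card_le_two
      exact_mod_cast hc t.2
    refine (Finset.sum_le_sum ht).trans ?_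
    rw [Finset.sum_const, nsmul_eq_mul, ← mul_assoc]
    refine mul_le_mul_of_nonneg_right (mul_le_mul_of_nonneg_right ?_ (Real.sqrt_nonneg _))
      (by positivity)
    exact_mod_cast card_walks_le hB m he
  refine (Finset.sum_le_sum hm).trans ?_
  rw [← Finset.sum_mul]
  have := mul_le_mul_of_nonneg_right (sum_sqrt_factorial_le (B : ℝ) (Λ.card + 1))
    (by positivity : 0 ≤ 2 * K)
  linarith

/-- The differential inequality, in finite volume and integrated over a small time step. -/
lemma arm_increment (hP : IsProductUniform P) (hΛ : ∀ e ∈ Λ, IsNNEdge e) {B : ℕ}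
    (hB : ∀ e ∈ Λ, (nbr Λ e).card ≤ B) (hp0 : 0 ≤ p) {h b : ℝ} (hh : 0 ≤ h) (hpb : p + h ≤ b)
    (hb : b < 1) {K : ℝ} (hK : ∀ v : Vertex d,
      ∑ k ∈ Finset.Icc 1 n, √(P.real {X | v ∈ clus κ Λ n p k X}) ≤ K) :
    h * n * (P.real (evt κ Λ (arm n) p) * (1 - P.real (evt κ Λ (arm n) p))) ≤
      8 * Real.exp (2 * (B : ℝ) ^ 2) * ((1 - b)⁻¹ * Real.exp (2 * B * (1 - b)⁻¹)) * K *
        (P.real (evt κ Λ (arm n) (p + h)) - P.real (evt κ Λ (arm n) p) + Λ.card ^ 2 * h ^ 2) := by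
  have := hP.1
  have hK0 : 0 ≤ K := (Finset.sum_nonneg fun k _ => Real.sqrt_nonneg _).trans (hK 0)
  set θ := P.real (evt κ Λ (arm n) p) with hθ
  set Q := ∑ c ∈ Λ, P.real (pivotal κ Λ (arm n) p c ∩ {X | p < X c}) with hQ
  have hQ0 : 0 ≤ Q := Finset.sum_nonneg fun c _ => measureReal_nonneg
  have hosss : ∀ k ∈ Finset.Icc 1 n, θ * (1 - θ) ≤
      ∑ j ∈ Λ, P.real (revealed κ Λ n p k j) * influence P (evt κ Λ (arm n) p) j := by
    intro k hk
    exact osss hP (fun j => measurableSet_revealed j) measurableSet_evt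
      fun S _ X => exploration hΛ (Finset.mem_Icc.1 hk).2 S X
  have h1 := Finset.sum_le_sum hosss
  rw [Finset.sum_const, Nat.card_Icc, nsmul_eq_mul, Finset.sum_comm] at h1
  simp only [← Finset.sum_mul, Nat.add_sub_cancel] at h1
  set E := 4 * Real.exp (2 * (B : ℝ) ^ 2) * K with hE
  have hE0 : 0 ≤ E := by positivity
  have h2 : ∑ j ∈ Λ, (∑ k ∈ Finset.Icc 1 n, P.real (revealed κ Λ n p k j)) *
      influence P (evt κ Λ (arm n) p) j ≤ ∑ j ∈ Λ, E * (2 * P.real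
        {X | ¬ (X ∈ evt κ Λ (arm n) p ↔ remove {j} X ∈ evt κ Λ (arm n) p)}) := by
    refine Finset.sum_le_sum fun j hj => ?_
    refine mul_le_mul (sum_revealed_le hP hB hK hj) ?_ influence_nonneg hE0
    exact influence_le hP measurableSet_evt j 2
  rw [← Finset.mul_sum, ← Finset.mul_sum] at h2
  have h3 := sum_measureReal_remove_le (κ := κ) (g := arm n) hP hp0 (by linarith : p < 1) hB
  have h1p : (1 - p)⁻¹ ≤ (1 - b)⁻¹ := inv_anti₀ (by linarith) (by linarith)
  have h1b : 0 < (1 - b)⁻¹ := inv_pos.2 (by linarith)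
  have h4 : (1 - p)⁻¹ * Real.exp (2 * B * (1 - p)⁻¹) * Q ≤
      (1 - b)⁻¹ * Real.exp (2 * B * (1 - b)⁻¹) * Q := by
    gcongr
  have h5 := evt_increment (κ := κ) (Λ := Λ) (g := arm n) hP (fun O O' => arm_mono) hp0 hh
    (by linarith)
  set G := (1 - b)⁻¹ * Real.exp (2 * B * (1 - b)⁻¹) with hG
  have hG0 : 0 ≤ G := by positivity
  have h6 : n * (θ * (1 - θ)) ≤ E * (2 * (G * Q)) :=
    (h1.trans h2).trans (mul_le_mul_of_nonneg_left (by linarith) hE0)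
  calc h * n * (θ * (1 - θ)) = h * (n * (θ * (1 - θ))) := by ring
    _ ≤ h * (E * (2 * (G * Q))) := mul_le_mul_of_nonneg_left h6 hh
    _ = E * 2 * G * (h * Q) := by ring
    _ ≤ E * 2 * G * (P.real (evt κ Λ (arm n) (p + h)) - θ + Λ.card ^ 2 * h ^ 2) :=
        mul_le_mul_of_nonneg_left (by linarith) (by positivity)
    _ = _ := by rw [hE]; ring

end Revealment

/-! ### Finite boxes -/

section Lattice

variable {d : ℕ}

lemma norm1_nonneg (x : Vertex d) : 0 ≤ norm1 x := Finset.sum_nonneg fun _ _ => abs_nonneg _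

lemma abs_apply_le_norm1 (x : Vertex d) (i : Fin d) : |x i| ≤ norm1 x :=
  Finset.single_le_sum (f := fun i => |x i|) (fun _ _ => abs_nonneg _) (Finset.mem_univ i)

/-- The closed ball of radius `n` for `norm1`. -/
noncomputable def ball (d n : ℕ) : Finset (Vertex d) :=
  (Fintype.piFinset fun _ => Finset.Icc (-(n : ℤ)) n).filter fun x => norm1 x ≤ n

lemma mem_ball {n : ℕ} {x : Vertex d} : x ∈ ball d n ↔ norm1 x ≤ n := by
  simp only [ball, Finset.mem_filter, Fintype.mem_piFinset, Finset.mem_Icc, and_iff_right_iff_imp]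
  exact fun h i => abs_le.1 ((abs_apply_le_norm1 x i).trans h)

lemma card_ball_le (d n : ℕ) : (ball d n).card ≤ (2 * n + 1) ^ d := by
  refine (Finset.card_filter_le _ _).trans ?_
  simp only [Fintype.card_piFinset, Int.card_Icc, Finset.prod_const, Finset.card_univ,
    Fintype.card_fin]
  refine le_of_eq ?_
  congr 1
  omega

open Classical in
/-- The edges at a vertex. -/
noncomputable def edgesAt (v : Vertex d) : Finset (Edge d) :=
  ((ball d 1).filter fun u => norm1 u = 1).image fun u => s(v, v + u)

lemma mem_edgesAt {v : Vertex d} {e : Edge d} : e ∈ edgesAt v ↔ IsNNEdge e ∧ v ∈ e := by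
  simp only [edgesAt, Finset.mem_image, Finset.mem_filter, mem_ball]
  constructor
  · rintro ⟨u, ⟨-, hu⟩, rfl⟩
    refine ⟨⟨v, v + u, ?_, rfl⟩, Sym2.mem_mk_left _ _⟩
    simpa [adj, norm1] using hu
  · rintro ⟨he, hv⟩
    obtain ⟨w, rfl⟩ := hv
    have h := (adj_of_isNNEdge he).symm
    have h1 : norm1 (w - v) = 1 := by simpa [adj, norm1] using h
    exact ⟨w - v, ⟨by simp [h1], h1⟩, by simp⟩

lemma card_edgesAt_le (v : Vertex d) : (edgesAt v).card ≤ (ball d 1).card :=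
  Finset.card_image_le.trans (Finset.card_filter_le _ _)

open Classical in
/-- The edges of the ball of radius `n`. -/
noncomputable def boxEdges (d n : ℕ) : Finset (Edge d) :=
  ((ball d n).biUnion edgesAt).filter (· ∈ box d n)

lemma mem_boxEdges {n : ℕ} {e : Edge d} : e ∈ boxEdges d n ↔ IsNNEdge e ∧ e ∈ box d n := by
  simp only [boxEdges, Finset.mem_filter, Finset.mem_biUnion, mem_ball, mem_edgesAt]
  constructor
  · rintro ⟨⟨v, -, h, -⟩, h2⟩
    exact ⟨h, h2⟩
  · rintro ⟨h1, h2⟩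
    obtain ⟨x, y, -, rfl⟩ := id h1
    exact ⟨⟨x, h2 x (Sym2.mem_mk_left _ _), h1, Sym2.mem_mk_left _ _⟩, h2⟩

lemma boxEdges_mono {m n : ℕ} (h : m ≤ n) : boxEdges d m ⊆ boxEdges d n := fun _ he =>
  mem_boxEdges.2 ⟨(mem_boxEdges.1 he).1, fun v hv =>
    ((mem_boxEdges.1 he).2 v hv).trans (by exact_mod_cast h)⟩

lemma mem_boxEdges_of_touch {n : ℕ} {e f : Edge d} (he : e ∈ boxEdges d n) (h : Touch e f)
    (hf : IsNNEdge f) : f ∈ boxEdges d (n + 1) := by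
  obtain ⟨v, hve, w, rfl⟩ := h
  refine mem_boxEdges.2 ⟨hf, fun u hu => ?_⟩
  have h1 := (mem_boxEdges.1 he).2 v hve
  have h2 := abs_le.1 (abs_norm1_sub_le (adj_of_isNNEdge hf))
  rcases Sym2.mem_iff.1 hu with rfl | rfl <;> push_cast <;> omega

lemma exists_mem_boxEdges {e : Edge d} (he : IsNNEdge e) : ∃ n, e ∈ boxEdges d n := by
  obtain ⟨x, y, hxy, rfl⟩ := id he
  refine ⟨(norm1 x).toNat + (norm1 y).toNat, mem_boxEdges.2 ⟨he, fun v hv => ?_⟩⟩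
  have h1 := norm1_nonneg x
  have h2 := norm1_nonneg y
  rcases Sym2.mem_iff.1 hv with rfl | rfl <;> push_cast <;> omega

lemma card_nbr_le {Λ : Finset (Edge d)} (hΛ : ∀ e ∈ Λ, IsNNEdge e) (e : Edge d) :
    (nbr Λ e).card ≤ 2 * (ball d 1).card := by
  classical
  induction e using Sym2.ind with
  | _ x y =>
  have hsub : nbr Λ s(x, y) ⊆ edgesAt x ∪ edgesAt y := by
    intro f hf
    obtain ⟨hfΛ, v, hv, hvf⟩ := Finset.mem_filter.1 hf
    rcases Sym2.mem_iff.1 hv with rfl | rfl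
    · exact Finset.mem_union_left _ (mem_edgesAt.2 ⟨hΛ f hfΛ, hvf⟩)
    · exact Finset.mem_union_right _ (mem_edgesAt.2 ⟨hΛ f hfΛ, hvf⟩)
  refine (Finset.card_le_card hsub).trans ((Finset.card_union_le _ _).trans ?_)
  have := card_edgesAt_le x
  have := card_edgesAt_le y
  omega

end Lattice

/-! ### Monotone chains -/

section Chains

variable {d : ℕ}

/-- There is a chain of `N` successive touching edges issued from `e` along which the labels are
monotone for `R`. -/
def HasChain (R : ℝ → ℝ → Prop) (X : Config d) : ℕ → Edge d → Prop
  | 0, _ => True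
  | N + 1, e => ∃ f, IsNNEdge f ∧ Touch e f ∧ R (X e) (X f) ∧ HasChain R X N f

variable {R : ℝ → ℝ → Prop} {X : Config d}

lemma hasChain_of_seq {f : ℕ → Edge d} (hf : ∀ i, IsNNEdge (f i))
    (ht : ∀ i, Touch (f i) (f (i + 1))) (hR : ∀ i, R (X (f i)) (X (f (i + 1)))) (N i : ℕ) :
    HasChain R X N (f i) := by
  induction N generalizing i with
  | zero => trivial
  | succ N ih => exact ⟨f (i + 1), hf _, ht i, hR i, ih (i + 1)⟩

lemma HasChain.of_succ {N : ℕ} {e : Edge d} (h : HasChain R X (N + 1) e) : HasChain R X N e := by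
  induction N generalizing e with
  | zero => trivial
  | succ N ih =>
    obtain ⟨f, h1, h2, h3, h4⟩ := h
    exact ⟨f, h1, h2, h3, ih h4⟩

lemma HasChain.anti {N M : ℕ} (hNM : N ≤ M) {e : Edge d} (h : HasChain R X M e) :
    HasChain R X N e := by
  induction hNM with
  | refl => exact h
  | step _ ih => exact ih h.of_succ

lemma HasChain.exists_walk [IsTrans ℝ R] {N n : ℕ} {e : Edge d} (he : e ∈ boxEdges d n)
    (h : HasChain R X N e) :
    ∃ t ∈ walks (boxEdges d (n + N)) N e, (e :: t.1).Pairwise fun a b => R (X a) (X b) := by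
  classical
  induction N generalizing e n with
  | zero => exact ⟨([], e), by simp [walks], by simp⟩
  | succ N ih =>
    obtain ⟨f, h1, h2, h3, h4⟩ := h
    have hf := mem_boxEdges_of_touch he h2 h1
    obtain ⟨t, ht, hp⟩ := ih hf h4
    rw [Nat.add_assoc, Nat.add_comm 1 N] at ht
    refine ⟨(f :: t.1, t.2), ?_, List.pairwise_cons.2 ⟨fun a ha => ?_, hp⟩⟩
    · simp only [walks, Finset.mem_biUnion, Finset.mem_image]
      exact ⟨f, Finset.mem_filter.2 ⟨boxEdges_mono (by omega) hf, h2⟩, t, ht, rfl⟩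
    · rcases List.mem_cons.1 ha with rfl | ha
      · exact h3
      · exact _root_.trans h3 ((List.pairwise_cons.1 hp).1 a ha)

/-- Some edge of the ball of radius `n` starts a monotone chain of length `N`. -/
def longChain (R : ℝ → ℝ → Prop) (n N : ℕ) : Set (Config d) :=
  {X | ∃ e ∈ boxEdges d n, HasChain R X N e}

variable {P : Measure (Config d)}

/-- An upper bound on the probability of `longChain`. -/
noncomputable def chainErr (d n N : ℕ) : ℝ :=
  (boxEdges d n).card * ((2 * (ball d 1).card : ℕ) ^ N / (N.factorial : ℝ))

lemma chainErr_nonneg (d n N : ℕ) : 0 ≤ chainErr d n N := by unfold chainErr; positivity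

lemma tendsto_chainErr (d n : ℕ) :
    Filter.Tendsto (chainErr d n) Filter.atTop (nhds 0) := by
  have := (FloorSemiring.tendsto_pow_div_factorial_atTop
    ((2 * (ball d 1).card : ℕ) : ℝ)).const_mul ((boxEdges d n).card : ℝ)
  rwa [mul_zero] at this

lemma measureReal_longChain_le_of (hP : IsProductUniform P) [IsTrans ℝ R]
    (hR : ∀ l : List (Edge d), P.real {X | l.Pairwise fun a b => R (X a) (X b)} ≤
      1 / (l.length.factorial : ℝ)) (n N : ℕ) :
    P.real (longChain R n N) ≤ chainErr d n N := by
  classical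
  have := hP.1
  have hsub : (longChain R n N : Set (Config d)) ⊆ ⋃ e ∈ boxEdges d n,
      ⋃ t ∈ walks (boxEdges d (n + N)) N e, {X | t.1.Pairwise fun a b => R (X a) (X b)} := by
    rintro X ⟨e, he, h⟩
    obtain ⟨t, ht, hp⟩ := h.exists_walk he
    exact Set.mem_biUnion (Finset.mem_coe.2 he)
      (Set.mem_biUnion (Finset.mem_coe.2 ht) (List.pairwise_cons.1 hp).2)
  refine (measureReal_mono hsub (measure_ne_top _ _)).trans
    ((measureReal_biUnion_finset_le _ _).trans ?_)
  rw [chainErr, ← nsmul_eq_mul, ← Finset.sum_const]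
  refine Finset.sum_le_sum fun e he => (measureReal_biUnion_finset_le _ _).trans ?_
  refine (Finset.sum_le_sum (g := fun _ => 1 / (N.factorial : ℝ)) fun t ht => ?_).trans ?_
  · have := hR t.1
    rwa [walks_length ht] at this
  · rw [Finset.sum_const, nsmul_eq_mul, mul_one_div]
    refine div_le_div_of_nonneg_right ?_ (by positivity)
    have h1 : ∀ f ∈ boxEdges d (n + N), (nbr (boxEdges d (n + N)) f).card ≤
        2 * (ball d 1).card := fun f _ => card_nbr_le (fun g hg => (mem_boxEdges.1 hg).1) f
    exact_mod_cast card_walks_le h1 N (boxEdges_mono (by omega) he)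

lemma measureReal_longChain_gt_le (hP : IsProductUniform P) (n N : ℕ) :
    P.real (longChain (· > ·) n N) ≤ chainErr d n N := by
  refine measureReal_longChain_le_of hP (fun l => ?_) n N
  have := hP.measureReal_increasing_le l.reverse
  simpa [List.pairwise_reverse] using this

lemma measureReal_longChain_lt_le (hP : IsProductUniform P) (n N : ℕ) :
    P.real (longChain (· < ·) n N) ≤ chainErr d n N :=
  measureReal_longChain_le_of hP (fun l => hP.measureReal_increasing_le l) n N

lemma ae_exists_not_hasChain_of (hP : IsProductUniform P)
    (hR : ∀ n N, P.real (longChain R n N) ≤ chainErr d n N) :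
    ∀ᵐ X ∂P, ∀ n, ∃ N, X ∉ longChain R n N := by
  have := hP.1
  rw [ae_all_iff]
  intro n
  rw [ae_iff, ← nonpos_iff_eq_zero]
  have h0 : P.real {X | ¬∃ N, X ∉ longChain R n N} ≤ 0 := by
    refine ge_of_tendsto' (tendsto_chainErr d n) fun N => le_trans (measureReal_mono ?_) (hR n N)
    intro X hX
    by_contra h
    exact hX ⟨N, h⟩
  have h1 := le_antisymm h0 measureReal_nonneg
  rw [measureReal_eq_zero_iff] at h1
  exact h1.le

/-- The almost sure properties of the labels used below. -/
structure Regular (X : Config d) : Prop where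
  injective : Function.Injective X
  mem_Icc : ∀ e, X e ∈ Set.Icc (0 : ℝ) 1
  gt_chain : ∀ n, ∃ N, X ∉ longChain (· > ·) n N
  lt_chain : ∀ n, ∃ N, X ∉ longChain (· < ·) n N

lemma IsProductUniform.ae_regular (hP : IsProductUniform P) : ∀ᵐ X ∂P, Regular X := by
  filter_upwards [hP.ae_injective, hP.ae_mem_Icc,
    ae_exists_not_hasChain_of hP (measureReal_longChain_gt_le hP),
    ae_exists_not_hasChain_of hP (measureReal_longChain_lt_le hP)] with X h1 h2 h3 h4
  exact ⟨h1, h2, h3, h4⟩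

lemma Regular.mem_goodConfigs (h : Regular X) : X ∈ goodConfigs d := by
  refine ⟨fun e _ => h.mem_Icc e, fun e f _ _ hEq => h.injective hEq, ?_⟩
  rintro ⟨w, hw, hmono⟩
  have hnn : ∀ i, IsNNEdge s(w i, w (i + 1)) := fun i => ⟨_, _, hw i, rfl⟩
  have ht : ∀ i, Touch s(w i, w (i + 1)) s(w (i + 1), w (i + 1 + 1)) := fun i =>
    ⟨w (i + 1), Sym2.mem_mk_right _ _, Sym2.mem_mk_left _ _⟩
  obtain ⟨n, hn⟩ := exists_mem_boxEdges (hnn 0)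
  rcases hmono with hm | hm
  · obtain ⟨N, hN⟩ := h.lt_chain n
    exact hN ⟨_, hn, hasChain_of_seq (f := fun i => s(w i, w (i + 1))) hnn ht
      (fun i => hm (Nat.lt_succ_self i)) N 0⟩
  · obtain ⟨N, hN⟩ := h.gt_chain n
    exact hN ⟨_, hn, hasChain_of_seq (f := fun i => s(w i, w (i + 1))) hnn ht
      (fun i => @hm i (i + 1) i.lt_succ_self) N 0⟩

/-- The relation `f` precedes `e` of the dynamics. -/
def Pred (X : Config d) (f e : Edge d) : Prop := IsNNEdge f ∧ Touch e f ∧ X f < X e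

lemma acc_pred_of_not_hasChain {N : ℕ} {e : Edge d} (h : ¬ HasChain (· > ·) X N e) :
    Acc (Pred X) e := by
  induction N generalizing e with
  | zero => exact absurd trivial h
  | succ N ih => exact Acc.intro _ fun f hf => ih fun hc => h ⟨f, hf.1, hf.2.1, hf.2.2, hc⟩

lemma Regular.wellFounded_pred (h : Regular X) : WellFounded (Pred X) := by
  refine ⟨fun e => Acc.intro _ fun f hf => ?_⟩
  obtain ⟨n, hn⟩ := exists_mem_boxEdges hf.1
  obtain ⟨N, hN⟩ := h.gt_chain n
  exact acc_pred_of_not_hasChain fun hc => hN ⟨f, hn, hc⟩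

variable {κ : ℕ}

lemma consistent_set_eq (X : Config d) (σ : Edge d → Prop) {e : Edge d} {v : Vertex d}
    (hv : v ∈ e) : {f : Edge d | IsNNEdge f ∧ v ∈ f ∧ f ≠ e ∧ X f < X e ∧ σ f} =
      {f | v ∈ f ∧ Pred X f e ∧ σ f} := by
  ext f
  constructor
  · rintro ⟨h1, h2, -, h3, h4⟩
    exact ⟨h2, ⟨h1, ⟨v, hv, h2⟩, h3⟩, h4⟩
  · rintro ⟨h2, ⟨h1, -, h3⟩, h4⟩
    exact ⟨h1, h2, fun h => (h ▸ h3).false, h3, h4⟩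

lemma consistent_iff {σ : Edge d → Prop} : Consistent κ X σ ↔ ∀ e, IsNNEdge e →
    (σ e ↔ ∀ v ∈ e, Set.ncard {f | v ∈ f ∧ Pred X f e ∧ σ f} < κ) := by
  refine forall₂_congr fun e he => iff_congr Iff.rfl (forall₂_congr fun v hv => ?_)
  rw [consistent_set_eq X σ hv]

lemma Regular.exists_consistent (h : Regular X) (κ : ℕ) : ∃ σ, Consistent κ X σ := by
  obtain ⟨σ, hσ⟩ := exists_labelling κ h.wellFounded_pred
  exact ⟨σ, consistent_iff.2 fun e _ => hσ e⟩

lemma exists_hasChain_of_reflTransGen {n : ℕ} {e f : Edge d} (he : e ∈ boxEdges d n)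
    (h : Relation.ReflTransGen (fun a b => Pred X b a) e f) :
    X f ≤ X e ∧ ∃ j, f ∈ boxEdges d (n + j) ∧
      ∀ M, HasChain (· > ·) X M f → HasChain (· > ·) X (M + j) e := by
  induction h with
  | refl => exact ⟨le_rfl, 0, he, fun M h => h⟩
  | @tail a b _ hab ih =>
    obtain ⟨h1, j, hj, hM⟩ := ih
    refine ⟨hab.2.2.le.trans h1, j + 1, mem_boxEdges_of_touch hj hab.2.1 hab.1, fun M h => ?_⟩
    have := hM (M + 1) ⟨b, hab.1, hab.2.1, hab.2.2, h⟩
    rwa [Nat.add_assoc, Nat.add_comm 1 j] at this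

lemma Consistent.iff_mem_openSet {σ : Edge d → Prop} (hσ : Consistent κ X σ) {n N : ℕ} {p : ℝ}
    {e : Edge d} (he : e ∈ boxEdges d n) (hp : X e ≤ p) (hN : ¬ HasChain (· > ·) X N e) :
    σ e ↔ e ∈ openSet κ (boxEdges d (n + N)) p X := by
  set D : Set (Edge d) := {f | Relation.ReflTransGen (fun a b => Pred X b a) e f} with hD
  have hDm : ∀ f ∈ D, X f ≤ p ∧ ∃ j < N, f ∈ boxEdges d (n + j) := by
    intro f hf
    obtain ⟨h1, j, hj, hM⟩ := exists_hasChain_of_reflTransGen he hf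
    refine ⟨h1.trans hp, j, ?_, hj⟩
    by_contra hjN
    exact hN ((hM 0 trivial).anti (by omega))
  have hDΛ : ∀ f ∈ D, f ∈ boxEdges d (n + N) := fun f hf =>
    let ⟨_, j, hj, hf'⟩ := hDm f hf; boxEdges_mono (by omega) hf'
  have h2 := isOpenSet_openSet κ (boxEdges d (n + N)) p X
  refine labelling_eqOn (κ := κ) (r₁ := Pred X)
    (r₂ := fun f e => f ∈ boxEdges d (n + N) ∧ X f < X e) (D := D)
    ((boxEdges d (n + N)).finite_toSet.subset hDΛ) X
    (fun f hf => consistent_iff.1 hσ f (mem_boxEdges.1 (hDΛ f hf)).1)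
    (fun f hf => h2.mem_iff (hDΛ f hf) (hDm f hf).1) (fun f hf g ht => ?_)
    (fun f hf g _ hr => Relation.ReflTransGen.tail hf hr) (fun f _ g _ hr => hr.2.2) e .refl
  obtain ⟨-, j, hj, hf'⟩ := hDm f hf
  constructor
  · exact fun h => ⟨boxEdges_mono (by omega) (mem_boxEdges_of_touch hf' ht h.1), h.2.2⟩
  · exact fun h => ⟨(mem_boxEdges.1 h.1).1, ht, h.2⟩

lemma Regular.openEdge_iff (h : Regular X) {n N : ℕ} {p : ℝ} {e : Edge d}
    (he : e ∈ boxEdges d n) (hN : ¬ HasChain (· > ·) X N e) :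
    openEdge κ X p e ↔ e ∈ openSet κ (boxEdges d (n + N)) p X := by
  constructor
  · rintro ⟨-, hp, σ, hσ, h'⟩
    exact (hσ.iff_mem_openSet he hp hN).1 h'
  · intro h'
    obtain ⟨σ, hσ⟩ := h.exists_consistent κ
    have hp := (openSet_subset h').2
    exact ⟨(mem_boxEdges.1 he).1, hp, σ, hσ, (hσ.iff_mem_openSet he hp hN).2 h'⟩

end Chains

/-! ### Infinite volume -/

section InfiniteVolume

variable {d : ℕ} {κ : ℕ} {p : ℝ} {X : Config d}

/-- The set of `p`-open edges. -/
def openEdges (κ : ℕ) (X : Config d) (p : ℝ) : Set (Edge d) := {e | openEdge κ X p e}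

lemma openEdges_mono {q : ℝ} (hpq : p ≤ q) : openEdges κ X p ⊆ openEdges κ X q :=
  fun _ h => ⟨h.1, h.2.1.trans hpq, h.2.2⟩

lemma openConn_iff {a b : Vertex d} : openConn κ X p a b ↔ Conn (openEdges κ X p) a b := by
  constructor
  · rintro ⟨k, x, -, rfl, rfl, hx⟩
    have : ∀ i ≤ k, Conn (openEdges κ X p) (x 0) (x i) := by
      intro i hi
      induction i with
      | zero => exact .refl
      | succ i ih => exact (ih (by omega)).tail (hx i (by omega))
    exact this k le_rfl
  · intro h
    let G : SimpleGraph (Vertex d) :=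
      { Adj := fun x y => openEdge κ X p s(x, y)
        symm := ⟨fun x y h => by rwa [Sym2.eq_swap]⟩
        loopless := ⟨fun x h => by simpa [adj] using adj_of_isNNEdge h.1⟩ }
    obtain ⟨w⟩ : G.Reachable a b := (SimpleGraph.reachable_iff_reflTransGen a b).2 h
    classical
    have hw := w.toPath.2
    set u := w.toPath.1
    have hadj : ∀ i < u.length, G.Adj (u.getVert i) (u.getVert (i + 1)) := fun i hi =>
      u.adj_getVert_succ hi
    exact ⟨u.length, u.getVert, ⟨fun i hi => adj_of_isNNEdge (hadj i hi).1,
      fun i hi j hj h => hw.getVert_injOn hi hj h⟩, u.getVert_zero, u.getVert_length, hadj⟩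

lemma Conn.exists_conn_inter_box {S : Set (Edge d)} (hS : ∀ e ∈ S, IsNNEdge e) {n : ℕ}
    {a b : Vertex d} (ha : norm1 a ≤ n) (hb : norm1 b = n) (h : Conn S a b) :
    ∃ b', norm1 b' = n ∧ Conn (S ∩ box d n) a b' := by
  have key : (∃ b', norm1 b' = n ∧ Conn (S ∩ box d n) a b') ∨
      (norm1 b < n ∧ Conn (S ∩ box d n) a b) := by
    clear hb
    induction h with
    | refl =>
      rcases ha.lt_or_eq with h | h
      · exact Or.inr ⟨h, .refl⟩
      · exact Or.inl ⟨a, h, .refl⟩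
    | @tail c b _ hcb ih =>
      rcases ih with h | ⟨hc, hac⟩
      · exact Or.inl h
      have h1 := abs_le.1 (abs_norm1_sub_le (adj_of_isNNEdge (hS _ hcb)))
      have h2 : Conn (S ∩ box d n) a b := hac.tail ⟨hcb, fun v hv => by
        rcases Sym2.mem_iff.1 hv with rfl | rfl <;> omega⟩
      rcases (show norm1 b ≤ n by omega).lt_or_eq with h | h
      · exact Or.inr ⟨h, h2⟩
      · exact Or.inl ⟨b, h, h2⟩
  exact key.resolve_right fun h => h.1.ne hb

/-- The event that `0` is connected to the sphere of radius `n`. -/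
def oneArm (κ : ℕ) (n : ℕ) (p : ℝ) : Set (Config d) :=
  {X | ∃ b, norm1 b = n ∧ Conn (openEdges κ X p) 0 b}

lemma oneArm_mono {n : ℕ} {q : ℝ} (hpq : p ≤ q) : oneArm (d := d) κ n p ⊆ oneArm κ n q :=
  fun _ ⟨b, hb, h⟩ => ⟨b, hb, h.mono (openEdges_mono hpq)⟩

lemma oneArm_anti {m n : ℕ} (hmn : m ≤ n) : oneArm (d := d) κ n p ⊆ oneArm κ m p := by
  rintro X ⟨b, hb, h⟩
  obtain ⟨w, hw, h1, -⟩ := h.exists_norm1_eq (fun e he => he.1) (k := m) (by simp [norm1])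
    (by rw [hb]; exact_mod_cast hmn)
  exact ⟨w, hw, h1⟩

lemma Regular.openEdges_inter_box (h : Regular X) {n N : ℕ}
    (hN : X ∉ longChain (· > ·) n N) :
    (↑(openSet κ (boxEdges d (n + N)) p X) ∩ box d n : Set (Edge d)) =
      openEdges κ X p ∩ box d n := by
  ext e
  constructor
  · rintro ⟨h1, h2⟩
    have he := mem_boxEdges.2 ⟨(mem_boxEdges.1 (openSet_subset h1).1).1, h2⟩
    exact ⟨(h.openEdge_iff he fun hc => hN ⟨e, he, hc⟩).2 h1, h2⟩
  · rintro ⟨h1, h2⟩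
    have he := mem_boxEdges.2 ⟨h1.1, h2⟩
    exact ⟨(h.openEdge_iff he fun hc => hN ⟨e, he, hc⟩).1 h1, h2⟩

lemma Regular.mem_oneArm_iff (h : Regular X) {n N : ℕ} (hN : X ∉ longChain (· > ·) n N) :
    X ∈ oneArm κ n p ↔ X ∈ evt κ (boxEdges d (n + N)) (arm n) p := by
  change _ ↔ ∃ b : Vertex d, norm1 b = n ∧ Conn _ 0 b
  rw [h.openEdges_inter_box hN]
  constructor
  · rintro ⟨b, hb, hc⟩
    exact hc.exists_conn_inter_box (fun e he => he.1) (by simp [norm1]) hb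
  · rintro ⟨b, hb, hc⟩
    exact ⟨b, hb, hc.mono Set.inter_subset_left⟩

variable {P : Measure (Config d)}

lemma measure_goodConfigs_and (hP : IsProductUniform P) (p : Config d → Prop) :
    P {X | X ∈ goodConfigs d ∧ p X} = P {X | p X} := by
  refine measure_congr ?_
  filter_upwards [hP.ae_regular] with X hX
  exact propext ⟨fun h => h.2, fun h => ⟨hX.mem_goodConfigs, h⟩⟩

lemma theta_eq (hP : IsProductUniform P) (n : ℕ) : theta κ P n p = P.real (oneArm κ n p) := by
  rw [theta, measure_goodConfigs_and hP]
  simp only [openConn_iff]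
  rfl

lemma measureReal_le_add_longChain (hP : IsProductUniform P) {A B : Set (Config d)} (n N : ℕ)
    (h : ∀ X, Regular X → X ∉ longChain (· > ·) n N → X ∈ A → X ∈ B) :
    P.real A ≤ P.real B + chainErr d n N := by
  have := hP.1
  have h1 : P A ≤ P (B ∪ longChain (· > ·) n N) := by
    refine measure_mono_ae ?_
    filter_upwards [hP.ae_regular] with X hX hA
    by_cases hc : X ∈ longChain (· > ·) n N
    · exact Or.inr hc
    · exact Or.inl (h X hX hc hA)
  have h2 : P.real A ≤ P.real (B ∪ longChain (· > ·) n N) :=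
    ENNReal.toReal_mono (measure_ne_top _ _) h1
  exact h2.trans ((measureReal_union_le _ _).trans
    (add_le_add_right (measureReal_longChain_gt_le hP n N) _))

lemma abs_theta_sub_le (hP : IsProductUniform P) (n N : ℕ) :
    |theta κ P n p - P.real (evt κ (boxEdges d (n + N)) (arm n) p)| ≤ chainErr d n N := by
  rw [theta_eq hP, abs_le]
  have h1 := measureReal_le_add_longChain hP (A := oneArm κ n p)
    (B := evt κ (boxEdges d (n + N)) (arm n) p) n N fun X hX hN h => (hX.mem_oneArm_iff hN).1 h
  have h2 := measureReal_le_add_longChain hP (B := oneArm κ n p)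
    (A := evt κ (boxEdges d (n + N)) (arm n) p) n N fun X hX hN h => (hX.mem_oneArm_iff hN).2 h
  constructor <;> linarith

lemma tendsto_evt (hP : IsProductUniform P) (n : ℕ) (p : ℝ) :
    Filter.Tendsto (fun N => P.real (evt κ (boxEdges d (n + N)) (arm n) p)) Filter.atTop
      (nhds (theta κ P n p)) := by
  refine tendsto_iff_norm_sub_tendsto_zero.2 (squeeze_zero (fun _ => norm_nonneg _) (fun N => ?_)
    (tendsto_chainErr d n))
  rw [Real.norm_eq_abs, abs_sub_comm]
  exact abs_theta_sub_le hP n N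

lemma theta_le_one (hP : IsProductUniform P) (n : ℕ) : theta κ P n p ≤ 1 := by
  have := hP.1
  rw [theta_eq hP]
  exact measureReal_le_one

lemma theta_zero (hP : IsProductUniform P) : theta κ P 0 p = 1 := by
  have := hP.1
  rw [theta_eq hP]
  have : oneArm (d := d) κ 0 p = Set.univ :=
    Set.eq_univ_of_forall fun X => ⟨0, by simp [norm1], .refl⟩
  rw [this, probReal_univ]

lemma theta_mono (hP : IsProductUniform P) (n : ℕ) {q : ℝ} (hpq : p ≤ q) :
    theta κ P n p ≤ theta κ P n q := by
  have := hP.1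
  rw [theta_eq hP, theta_eq hP]
  exact measureReal_mono (oneArm_mono hpq)

lemma theta_anti (hP : IsProductUniform P) {m n : ℕ} (hmn : m ≤ n) :
    theta κ P n p ≤ theta κ P m p := by
  have := hP.1
  rw [theta_eq hP, theta_eq hP]
  exact measureReal_mono (oneArm_anti hmn)

/-! ### Translations -/

/-- The translation by `v` of the edges. -/
def shift (v : Vertex d) : Edge d ≃ Edge d where
  toFun := Sym2.map (· + v)
  invFun := Sym2.map (· - v)
  left_inv := Sym2.ind fun x y => by simp
  right_inv := Sym2.ind fun x y => by simp

lemma shift_mk (v x y : Vertex d) : shift v s(x, y) = s(x + v, y + v) := rfl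

lemma isNNEdge_shift (v : Vertex d) {e : Edge d} : IsNNEdge (shift v e) ↔ IsNNEdge e := by
  induction e using Sym2.ind with
  | _ x y =>
  rw [shift_mk]
  have h : ∀ a b : Vertex d, adj a b → IsNNEdge s(a, b) := fun a b hab => ⟨a, b, hab, rfl⟩
  constructor
  · intro he
    refine h _ _ ?_
    simpa [adj] using adj_of_isNNEdge he
  · intro he
    refine h _ _ ?_
    simpa [adj] using adj_of_isNNEdge he

lemma mem_shift {v u : Vertex d} {e : Edge d} : u + v ∈ shift v e ↔ u ∈ e := by
  induction e using Sym2.ind with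
  | _ x y => simp [shift_mk, Sym2.mem_iff]

lemma Consistent.shift {σ : Edge d → Prop} (h : Consistent κ X σ) (v : Vertex d) :
    Consistent κ (X ∘ shift v) (σ ∘ shift v) := by
  intro e he
  rw [Function.comp_apply, h _ ((isNNEdge_shift v).2 he)]
  have key : ∀ u, {f : Edge d | IsNNEdge f ∧ u + v ∈ f ∧ f ≠ CDP.shift v e ∧
      X f < X (CDP.shift v e) ∧ σ f}.ncard = {f : Edge d | IsNNEdge f ∧ u ∈ f ∧ f ≠ e ∧
      (X ∘ CDP.shift v) f < (X ∘ CDP.shift v) e ∧ (σ ∘ CDP.shift v) f}.ncard := by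
    intro u
    refine Eq.trans ?_ (Set.ncard_image_of_injective _ (CDP.shift v).injective)
    congr 1
    ext f
    obtain ⟨g, rfl⟩ := (CDP.shift v).surjective f
    rw [(CDP.shift v).injective.mem_set_image]
    simp only [Set.mem_ofPred_eq, isNNEdge_shift, mem_shift, Function.comp_apply, ne_eq,
      EmbeddingLike.apply_eq_iff_eq]
  constructor
  · intro H u hu
    rw [← key]
    exact H _ (mem_shift.2 hu)
  · intro H u hu
    obtain ⟨u, rfl⟩ : ∃ u', u = u' + v := ⟨u - v, by simp⟩
    rw [key]
    exact H _ (mem_shift.1 hu)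

lemma openEdge.shift {e : Edge d} (v : Vertex d) (h : openEdge κ X p (CDP.shift v e)) :
    openEdge κ (X ∘ CDP.shift v) p e :=
  let ⟨h1, h2, σ, h3, h4⟩ := h
  ⟨(isNNEdge_shift v).1 h1, h2, σ ∘ CDP.shift v, h3.shift v, h4⟩

lemma Conn.shift {v a b : Vertex d} (h : Conn (openEdges κ X p) (a + v) b) :
    Conn (openEdges κ (X ∘ CDP.shift v) p) a (b - v) := by
  induction h with
  | refl => rw [add_sub_cancel_right]; exact .refl
  | @tail c b _ hcb ih =>
    refine ih.tail (openEdge.shift v ?_)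
    rw [shift_mk, sub_add_cancel, sub_add_cancel]
    exact hcb

lemma norm1_sub_ge (x y : Vertex d) : |norm1 x - norm1 y| ≤ norm1 (x - y) := by
  rw [norm1, norm1, ← Finset.sum_sub_distrib]
  exact (Finset.abs_sum_le_sum_abs _ _).trans
    (Finset.sum_le_sum fun i _ => abs_abs_sub_abs_le_abs_sub _ _)

lemma measureReal_clus_le (hP : IsProductUniform P) (n N k : ℕ) (v : Vertex d) :
    P.real {X | v ∈ clus κ (boxEdges d (n + N)) n p k X} ≤
      theta κ P (|(k : ℤ) - norm1 v|).toNat p + chainErr d n N := by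
  have := hP.1
  set j := (|(k : ℤ) - norm1 v|).toNat with hj
  have h1 : P.real ((fun X => X ∘ shift v) ⁻¹' oneArm κ j p) ≤ theta κ P j p := by
    have hm : Measurable fun X : Config d => X ∘ shift v :=
      measurable_pi_lambda _ fun e => measurable_pi_apply (shift v e)
    rw [theta_eq hP]
    refine ENNReal.toReal_mono (measure_ne_top _ _) ?_
    have := Measure.le_map_apply hm.aemeasurable (μ := P) (oneArm κ j p)
    rwa [hP.map_comp_equiv] at this
  refine (measureReal_le_add_longChain hP n N fun X hX hN h => ?_).trans (add_le_add_left h1 _)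
  obtain ⟨b, hb, hc⟩ := h
  rw [hX.openEdges_inter_box hN] at hc
  have hc' : Conn (openEdges κ X p) (0 + v) b := by
    rw [zero_add]
    exact (hc.mono Set.inter_subset_left).symm
  have h2 := norm1_sub_ge b v
  rw [hb] at h2
  obtain ⟨w, hw, hw', -⟩ := hc'.shift.exists_norm1_eq (fun e he => he.1) (k := j) (by simp [norm1])
    (by rw [hj, Int.toNat_of_nonneg (abs_nonneg _)]; exact h2)
  exact ⟨w, hw, hw'⟩

lemma norm1_le_of_mem_clus {Λ : Finset (Edge d)} {n k : ℕ} (hk : k ≤ n) {v : Vertex d}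
    (h : v ∈ clus κ Λ n p k X) : norm1 v ≤ n := by
  obtain ⟨b, hb, hc⟩ := h
  induction hc with
  | refl => rw [hb]; exact_mod_cast hk
  | tail _ h _ => exact h.2 _ (Sym2.mem_mk_right _ _)

lemma sum_sqrt_clus_le (hP : IsProductUniform P) (n N : ℕ) (v : Vertex d) :
    ∑ k ∈ Finset.Icc 1 n, √(P.real {X | v ∈ clus κ (boxEdges d (n + N)) n p k X}) ≤
      2 * ∑ j ∈ Finset.range (n + 1), √(theta κ P j p + chainErr d n N) := by
  have := hP.1
  by_cases hv : norm1 v ≤ n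
  · obtain ⟨m, hm⟩ := Int.eq_ofNat_of_zero_le (norm1_nonneg v)
    have hmn : m ≤ n := by omega
    set g : ℕ → ℝ := fun j => √(theta κ P j p + chainErr d n N) with hg
    have hg0 : ∀ j, 0 ≤ g j := fun j => Real.sqrt_nonneg _
    have h1 : ∀ k ∈ Finset.Icc 1 n,
        √(P.real {X | v ∈ clus κ (boxEdges d (n + N)) n p k X}) ≤
          if m ≤ k then g (k - m) else g (m - k) := by
      intro k _
      refine (Real.sqrt_le_sqrt (measureReal_clus_le hP n N k v)).trans (le_of_eq ?_)
      rw [hm]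
      split_ifs with h
      · have : (|(k : ℤ) - m|).toNat = k - m := by
          rw [abs_of_nonneg (by omega)]; omega
        rw [this]
      · have : (|(k : ℤ) - m|).toNat = m - k := by
          rw [abs_of_nonpos (by omega)]; omega
        rw [this]
    have hsum : ∀ (s : Finset ℕ) (φ : ℕ → ℕ), Set.InjOn φ s → (∀ k ∈ s, φ k ≤ n) →
        ∑ k ∈ s, g (φ k) ≤ ∑ j ∈ Finset.range (n + 1), g j := by
      intro s φ hφ hs
      rw [← Finset.sum_image hφ]
      refine Finset.sum_le_sum_of_subset_of_nonneg (fun j hj => ?_) fun j _ _ => hg0 j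
      obtain ⟨k, hk, rfl⟩ := Finset.mem_image.1 hj
      exact Finset.mem_range.2 (Nat.lt_succ_of_le (hs k hk))
    refine (Finset.sum_le_sum h1).trans ?_
    rw [Finset.sum_ite, two_mul]
    refine add_le_add (hsum _ _ (fun k hk l hl h => ?_) fun k hk => ?_)
      (hsum _ _ (fun k hk l hl h => ?_) fun k hk => ?_) <;>
    simp only [Finset.mem_coe, Finset.mem_filter, Finset.mem_Icc] at * <;> omega
  · have h0 : ∀ k ∈ Finset.Icc 1 n,
        √(P.real {X | v ∈ clus κ (boxEdges d (n + N)) n p k X}) = 0 := by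
      intro k hk
      have : {X : Config d | v ∈ clus κ (boxEdges d (n + N)) n p k X} = ∅ :=
        Set.eq_empty_of_forall_notMem fun X hX =>
          hv (norm1_le_of_mem_clus (Finset.mem_Icc.1 hk).2 hX)
      rw [this, measureReal_empty, Real.sqrt_zero]
    rw [Finset.sum_eq_zero h0]
    exact mul_nonneg zero_le_two (Finset.sum_nonneg fun j _ => Real.sqrt_nonneg _)

end InfiniteVolume

/-! ### The integrated differential inequality -/

lemma mul_exp_le_of_increment {f : ℝ → ℝ} {p q a L : ℝ} (hpq : p ≤ q) (ha : 0 ≤ a) (hL : 0 ≤ L)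
    (hf : ∀ s h, p ≤ s → 0 ≤ h → s + h ≤ q → h * a * f s ≤ f (s + h) - f s + L * h ^ 2) :
    f p * Real.exp (a * (q - p)) ≤ f q := by
  have hM : ∀ M : ℕ, 0 < M →
      f p ≤ f q / (1 + a * (q - p) / M) ^ M + L * (q - p) ^ 2 / M := by
    intro M hM
    have hM' : (0 : ℝ) < M := by exact_mod_cast hM
    set h := (q - p) / M with hh
    have hh0 : 0 ≤ h := div_nonneg (by linarith) hM'.le
    have hMh : M * h = q - p := by rw [hh]; field_simp
    have hr : 1 ≤ 1 + h * a := by have := mul_nonneg hh0 ha; linarith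
    have key : ∀ i ≤ M, f p ≤ f (p + i * h) / (1 + h * a) ^ i + i * (L * h ^ 2) := by
      intro i hi
      induction i with
      | zero => simp
      | succ i ih =>
        have hi' : ((i : ℝ) + 1) * h ≤ q - p := by
          rw [← hMh]
          exact mul_le_mul_of_nonneg_right (by exact_mod_cast hi) hh0
        have h1 := hf (p + i * h) h (by have := mul_nonneg i.cast_nonneg (α := ℝ) hh0; linarith)
          hh0 (by linarith)
        have h2 : f (p + i * h) ≤ f (p + i * h + h) / (1 + h * a) + L * h ^ 2 := by
          have h3 : f (p + i * h) ≤ (f (p + i * h + h) + L * h ^ 2) / (1 + h * a) := by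
            rw [le_div_iff₀ (by linarith)]
            linarith
          rw [add_div] at h3
          have := div_le_self (by positivity : 0 ≤ L * h ^ 2) hr
          linarith
        have hpow : 0 < (1 + h * a) ^ i := by positivity
        have h4 := div_le_div_of_nonneg_right h2 hpow.le
        rw [add_div, div_div, ← pow_succ'] at h4
        have h5 := div_le_self (by positivity : 0 ≤ L * h ^ 2) (one_le_pow₀ hr : 1 ≤ (1 + h * a) ^ i)
        have h6 := ih (by omega)
        have h7 : p + ((i + 1 : ℕ) : ℝ) * h = p + i * h + h := by push_cast; ring
        rw [h7]
        push_cast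
        linarith
    have h1 := key M le_rfl
    rw [hMh] at h1
    have h2 : p + (q - p) = q := by ring
    have h3 : 1 + h * a = 1 + a * (q - p) / M := by rw [hh]; ring
    have h4 : M * (L * h ^ 2) = L * (q - p) ^ 2 / M := by rw [hh]; field_simp
    rwa [h2, h3, h4] at h1
  have hlim : Filter.Tendsto (fun M : ℕ => f q / (1 + a * (q - p) / M) ^ M +
      L * (q - p) ^ 2 / M) Filter.atTop (nhds (f q / Real.exp (a * (q - p)) + 0)) :=
    (tendsto_const_nhds.div (Real.tendsto_one_add_div_pow_exp _) (Real.exp_pos _).ne').add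
      (tendsto_const_div_atTop_nhds_zero_nat _)
  have h1 : f p ≤ f q / Real.exp (a * (q - p)) + 0 :=
    ge_of_tendsto hlim (Filter.eventually_atTop.2 ⟨1, fun M h => hM M h⟩)
  rwa [add_zero, le_div_iff₀ (Real.exp_pos _)] at h1

section

variable {d κ : ℕ} {P : Measure (Config d)} {b : ℝ}

lemma measureReal_arm_le (hP : IsProductUniform P) (hb0 : 0 ≤ b) (hb : b < 1)
    {Λ : Finset (Edge d)} (hΛ : ∀ e ∈ Λ, IsNNEdge e) {n : ℕ} (hn : 1 ≤ n) {s : ℝ} (hs : s ≤ b) :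
    P.real (evt κ Λ (arm n) s) ≤ 1 - (1 - b) ^ (edgesAt (0 : Vertex d)).card := by
  have := hP.1
  have h1 : P.real {X : Config d | ∀ e ∈ edgesAt (0 : Vertex d), X e ∈ Set.Ioi b} =
      (1 - b) ^ (edgesAt (0 : Vertex d)).card := by
    rw [measureReal_def, hP.2 _ (fun _ => Set.Ioi b) fun _ _ => measurableSet_Ioi]
    have h2 : Set.Ioi b ∩ Set.Icc 0 1 = Set.Ioc b 1 := by
      ext x
      exact ⟨fun h => ⟨h.1, h.2.2⟩, fun h => ⟨h.1, hb0.trans h.1.le, h.2⟩⟩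
    rw [h2, Real.volume_Ioc, Finset.prod_const, ENNReal.toReal_pow,
      ENNReal.toReal_ofReal (by linarith)]
  have h2 : evt κ Λ (arm n) s ⊆
      {X : Config d | ∀ e ∈ edgesAt (0 : Vertex d), X e ∈ Set.Ioi b}ᶜ := by
    rintro X ⟨c, hc, h⟩ hX
    rcases h.cases_head with h | ⟨y, hy, -⟩
    · rw [← h] at hc
      have : (0 : ℤ) = n := by simpa [norm1] using hc
      omega
    · have h3 := openSet_subset hy.1
      exact absurd (hX _ (mem_edgesAt.2 ⟨hΛ _ h3.1, Sym2.mem_mk_left _ _⟩))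
        (not_lt.2 (h3.2.trans hs))
  have hmeas : MeasurableSet {X : Config d | ∀ e ∈ edgesAt (0 : Vertex d), X e ∈ Set.Ioi b} := by
    have : {X : Config d | ∀ e ∈ edgesAt (0 : Vertex d), X e ∈ Set.Ioi b} =
        ⋂ e ∈ edgesAt (0 : Vertex d), (fun X : Config d => X e) ⁻¹' Set.Ioi b := by
      ext X; simp
    rw [this]
    exact Finset.measurableSet_biInter _ fun e _ => measurable_pi_apply e measurableSet_Ioi
  refine (measureReal_mono h2).trans (le_of_eq ?_)
  rw [probReal_compl_eq_one_sub hmeas, h1]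

/-- Sharp threshold inequality: `θ_n` decays exponentially, at a rate governed by the sum of the
`√θ_j`. -/
lemma exists_theta_mul_exp_le (hP : IsProductUniform P) (hb0 : 0 ≤ b) (hb : b < 1) :
    ∃ c > 0, ∀ n, 1 ≤ n → ∀ p q, 0 ≤ p → p ≤ q → q ≤ b →
      theta κ P n p * Real.exp (c * n / (∑ j ∈ Finset.range (n + 1), √(theta κ P j q)) * (q - p)) ≤
        theta κ P n q := by
  have := hP.1
  set B : ℕ := 2 * (ball d 1).card with hB
  set G : ℝ := 8 * Real.exp (2 * (B : ℝ) ^ 2) *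
    ((1 - b)⁻¹ * Real.exp (2 * B * (1 - b)⁻¹)) with hG
  set δ : ℝ := (1 - b) ^ (edgesAt (0 : Vertex d)).card with hδ
  have h1b : 0 < 1 - b := by linarith
  have hG0 : 0 < G := by positivity
  have hδ0 : 0 < δ := by positivity
  refine ⟨δ / (2 * G), by positivity, fun n hn p q hp hpq hqb => ?_⟩
  set S : ℕ → ℝ := fun N => ∑ j ∈ Finset.range (n + 1), √(theta κ P j q + chainErr d n N) with hS
  have hS1 : ∀ N, 1 ≤ S N := by
    intro N
    refine le_trans ?_ (Finset.single_le_sum (f := fun j => √(theta κ P j q + chainErr d n N))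
      (fun j _ => Real.sqrt_nonneg _) (Finset.mem_range.2 n.succ_pos))
    rw [theta_zero hP]
    exact Real.one_le_sqrt.2 (by have := chainErr_nonneg d n N; linarith)
  have hfin : ∀ N, P.real (evt κ (boxEdges d (n + N)) (arm n) p) *
      Real.exp (δ / (2 * G) * n / S N * (q - p)) ≤
        P.real (evt κ (boxEdges d (n + N)) (arm n) q) := by
    intro N
    have hS0 : 0 < S N := by linarith [hS1 N]
    have hΛ : ∀ e ∈ boxEdges d (n + N), IsNNEdge e := fun e he => (mem_boxEdges.1 he).1
    refine mul_exp_le_of_increment (f := fun s => P.real (evt κ (boxEdges d (n + N)) (arm n) s))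
      (L := (boxEdges d (n + N)).card ^ 2) hpq (by positivity) (by positivity)
      fun s h hps hh hsh => ?_
    have hK : ∀ v : Vertex d,
        ∑ k ∈ Finset.Icc 1 n, √(P.real {X | v ∈ clus κ (boxEdges d (n + N)) n s k X}) ≤
          2 * S N := by
      refine fun v => (sum_sqrt_clus_le hP n N v).trans ?_
      refine mul_le_mul_of_nonneg_left (Finset.sum_le_sum fun j _ => Real.sqrt_le_sqrt ?_)
        zero_le_two
      exact add_le_add_left (theta_mono hP j (by linarith)) _
    have h1 := arm_increment hP hΛ (fun e _ => card_nbr_le hΛ e) (hp.trans hps) hh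
      (hsh.trans hqb) hb hK
    have h2 := measureReal_arm_le (κ := κ) hP hb0 hb hΛ hn (s := s) (by linarith)
    set F := P.real (evt κ (boxEdges d (n + N)) (arm n) s)
    set F' := P.real (evt κ (boxEdges d (n + N)) (arm n) (s + h))
    have hF0 : 0 ≤ F := measureReal_nonneg
    have h3 : h * n * (F * δ) ≤ G * (2 * S N) *
        (F' - F + (boxEdges d (n + N)).card ^ 2 * h ^ 2) := by
      refine le_trans ?_ h1
      gcongr
      linarith
    have h4 : h * (δ / (2 * G) * n / S N) * F = h * n * (F * δ) / (G * (2 * S N)) := by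
      field_simp
    change h * (δ / (2 * G) * n / S N) * F ≤ _
    rw [h4, div_le_iff₀ (by positivity)]
    linarith
  have hlimS : Filter.Tendsto S Filter.atTop
      (nhds (∑ j ∈ Finset.range (n + 1), √(theta κ P j q))) := by
    refine tendsto_finsetSum _ fun j _ => ?_
    have h1 := (tendsto_chainErr d n).const_add (theta κ P j q)
    rw [add_zero] at h1
    exact h1.sqrt
  have hSpos : 0 < ∑ j ∈ Finset.range (n + 1), √(theta κ P j q) :=
    lt_of_lt_of_le one_pos (ge_of_tendsto' hlimS hS1)
  refine le_of_tendsto_of_tendsto' ?_ (tendsto_evt hP n q) hfin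
  refine (tendsto_evt hP n p).mul ?_
  refine (Real.continuous_exp.tendsto _).comp ?_
  exact (tendsto_const_nhds.div hlimS hSpos.ne').mul_const _

end

/-! ### From vanishing to stretched exponential decay -/

section Bootstrap

variable {θ : ℕ → ℝ → ℝ} {b c p : ℝ}

lemma exists_le_div (h1 : ∀ n q, θ n q ≤ 1)
    (hmono : ∀ n q q', q ≤ q' → θ n q ≤ θ n q') (hanti : ∀ m n q, m ≤ n → θ n q ≤ θ m q)
    (hc : 0 < c) (hb : Filter.Tendsto (fun n => θ n b) Filter.atTop (nhds 0))
    (hθ : ∀ n, 1 ≤ n → ∀ q q', 0 ≤ q → q ≤ q' → q' ≤ b →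
      θ n q * Real.exp (c * n / (∑ j ∈ Finset.range (n + 1), √(θ j q')) * (q' - q)) ≤ θ n q')
    (hS : ∀ n q, 0 < ∑ j ∈ Finset.range (n + 1), √(θ j q))
    (hp : 0 ≤ p) (hpb : p < b) :
    ∃ n₀ : ℕ, 1 ≤ n₀ ∧ ∃ q, p < q ∧ q ≤ b ∧ ∀ n, 1 ≤ n → θ n q ≤ n₀ / n := by
  obtain ⟨r, hr1, hr⟩ : ∃ r : ℕ, 1 ≤ r ∧ 24 / c * (1 / 2) ^ r < b - p := by
    have h1 : Filter.Tendsto (fun r : ℕ => 24 / c * (1 / 2 : ℝ) ^ r) Filter.atTop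
        (nhds (24 / c * 0)) :=
      (tendsto_pow_atTop_nhds_zero_of_lt_one (by norm_num) (by norm_num)).const_mul _
    rw [mul_zero] at h1
    obtain ⟨r, h2, h3⟩ := ((h1.eventually (gt_mem_nhds (sub_pos.2 hpb))).and
      (Filter.eventually_ge_atTop 1)).exists
    exact ⟨r, h3, h2⟩
  set a : ℕ → ℕ := fun i => 2 ^ (r * 2 ^ i) with ha
  have ha_succ : ∀ i, a (i + 1) = a i ^ 2 := fun i => by
    simp only [ha]; rw [← pow_mul, pow_succ, mul_assoc]
  have ha_ge : ∀ i, 2 ^ (r + i) ≤ a i := fun i => by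
    refine Nat.pow_le_pow_right (by norm_num) ?_
    have : i + 1 ≤ 2 ^ i := Nat.lt_two_pow_self
    nlinarith
  have ha_two : ∀ i, 2 ≤ a i := fun i =>
    le_trans (by simpa using Nat.pow_le_pow_right two_pos (show 1 ≤ r + i by omega)) (ha_ge i)
  obtain ⟨n₀, hn₀, hn₀'⟩ : ∃ n₀ : ℕ, 1 ≤ n₀ ∧ θ n₀ b ≤ ((a 0 : ℝ) ^ 4)⁻¹ := by
    have hpos : 0 < ((a 0 : ℝ) ^ 4)⁻¹ := by have := ha_two 0; positivity
    obtain ⟨n₀, h2, h3⟩ := ((hb.eventually (gt_mem_nhds hpos)).and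
      (Filter.eventually_ge_atTop 1)).exists
    exact ⟨n₀, h3, h2.le⟩
  set N : ℕ → ℕ := fun i => Nat.rec n₀ (fun i m => m * a i ^ 2) i with hN
  have hN0 : N 0 = n₀ := rfl
  have hN_succ : ∀ i, N (i + 1) = N i * a i ^ 2 := fun _ => rfl
  have hN_gt : ∀ i, i + 1 ≤ N i := by
    intro i
    induction i with
    | zero => simpa [hN0] using hn₀
    | succ i ih =>
      rw [hN_succ]
      have h4 : 2 ≤ a i ^ 2 := by nlinarith [ha_two i]
      exact (show i + 1 + 1 ≤ (i + 1) * 2 by omega).trans (Nat.mul_le_mul ih h4)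
  have hN_le : ∀ i, N i ≤ n₀ * a i ^ 2 := by
    intro i
    induction i with
    | zero => rw [hN0]; exact Nat.le_mul_of_pos_right _ (by have := ha_two 0; positivity)
    | succ i ih =>
      rw [hN_succ, ha_succ]
      calc N i * a i ^ 2 ≤ n₀ * a i ^ 2 * a i ^ 2 := Nat.mul_le_mul_right _ ih
        _ = n₀ * (a i ^ 2) ^ 2 := by ring
  set u : ℝ := 24 / c * (1 / 2) ^ r with hu
  have hu0 : 0 < u := by positivity
  set s : ℕ → ℝ := fun i => b - u * (1 - (1 / 2) ^ i) with hs
  have hs_le : ∀ i, s i ≤ b := fun i => by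
    have : (1 / 2 : ℝ) ^ i ≤ 1 := pow_le_one₀ (by norm_num) (by norm_num)
    have := mul_nonneg hu0.le (sub_nonneg.2 this)
    simp only [hs]; linarith
  have hs_ge : ∀ i, b - u ≤ s i := fun i => by
    have : 0 ≤ u * (1 / 2 : ℝ) ^ i := by positivity
    simp only [hs]; linarith
  have hs_succ : ∀ i, s i - s (i + 1) = u * (1 / 2) ^ (i + 1) := fun i => by
    simp only [hs]; ring
  have key : ∀ i, θ (N i) (s i) ≤ ((a i : ℝ) ^ 4)⁻¹ := by
    intro i
    induction i with
    | zero => simpa [hN0, hs] using hn₀'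
    | succ i ih =>
      have hai : (2 : ℝ) ≤ a i := by exact_mod_cast ha_two i
      have hai0 : (0 : ℝ) < a i := by linarith
      set n := N (i + 1) with hn
      have hn1 : 1 ≤ n := by have := hN_gt (i + 1); omega
      have hn1' : (1 : ℝ) ≤ n := by exact_mod_cast hn1
      have hnN : (N i : ℝ) = n / (a i : ℝ) ^ 2 := by
        rw [hn, hN_succ]; push_cast; field_simp
      set S := ∑ j ∈ Finset.range (n + 1), √(θ j (s i)) with hSdef
      have hS0 : 0 < S := hS n (s i)
      have hSle : S ≤ 3 * n / (a i : ℝ) ^ 2 := by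
        have hterm : ∀ j ∈ Finset.range (n + 1),
            √(θ j (s i)) ≤ (if j < N i then 1 else 0) + ((a i : ℝ) ^ 2)⁻¹ := by
          intro j _
          split_ifs with hj
          · have := Real.sqrt_le_one.2 (h1 j (s i))
            have : 0 ≤ ((a i : ℝ) ^ 2)⁻¹ := by positivity
            linarith
          · rw [zero_add]
            refine Real.sqrt_le_iff.2 ⟨by positivity, ?_⟩
            refine (hanti _ _ _ (not_lt.1 hj)).trans (ih.trans (le_of_eq ?_))
            rw [inv_pow, ← pow_mul]
        refine (Finset.sum_le_sum hterm).trans ?_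
        rw [Finset.sum_add_distrib, Finset.sum_const, ← Finset.sum_filter, Finset.sum_const,
          Finset.card_range]
        have hcard : ((Finset.range (n + 1)).filter fun j => j < N i).card ≤ N i := by
          refine (Finset.card_le_card (t := Finset.range (N i)) fun j hj => ?_).trans
            (Finset.card_range _).le
          exact Finset.mem_range.2 (Finset.mem_filter.1 hj).2
        have hcard' : (((Finset.range (n + 1)).filter fun j => j < N i).card : ℝ) ≤
            n / (a i : ℝ) ^ 2 := by
          rw [← hnN]; exact_mod_cast hcard
        rw [nsmul_eq_mul, nsmul_eq_mul, mul_one]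
        push_cast
        have : ((n : ℝ) + 1) * ((a i : ℝ) ^ 2)⁻¹ ≤ 2 * n * ((a i : ℝ) ^ 2)⁻¹ :=
          mul_le_mul_of_nonneg_right (by linarith) (by positivity)
        rw [div_eq_mul_inv] at hcard' ⊢
        linarith
      have hexp : 4 * (a i : ℝ) ≤ c * n / S * (s i - s (i + 1)) := by
        rw [hs_succ]
        have h2 : c * (a i : ℝ) ^ 2 / 3 ≤ c * n / S := by
          rw [div_le_div_iff₀ (by norm_num) hS0]
          have := mul_le_mul_of_nonneg_left hSle (by positivity : 0 ≤ c * (a i : ℝ) ^ 2)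
          refine this.trans (le_of_eq ?_)
          field_simp
        have h3 : (1 : ℝ) ≤ a i * (1 / 2) ^ (r + i) := by
          rw [one_div, inv_pow, ← div_eq_mul_inv, one_le_div (by positivity)]
          exact_mod_cast ha_ge i
        calc 4 * (a i : ℝ) ≤ 4 * a i * (a i * (1 / 2) ^ (r + i)) :=
              le_mul_of_one_le_right (by positivity) h3
          _ = c * (a i : ℝ) ^ 2 / 3 * (u * (1 / 2) ^ (i + 1)) := by
              rw [hu]; field_simp; ring
          _ ≤ _ := mul_le_mul_of_nonneg_right h2 (by positivity)
      have h2 := hθ n hn1 (s (i + 1)) (s i) (by have := hs_ge (i + 1); linarith)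
        (by have := hs_succ i; have : 0 ≤ u * (1 / 2) ^ (i + 1) := by positivity
            linarith) (hs_le i)
      have h3 : (a i : ℝ) ^ 4 ≤
          Real.exp (c * n / S * (s i - s (i + 1))) := by
        refine le_trans ?_ (Real.exp_le_exp.2 hexp)
        have : Real.exp (4 * (a i : ℝ)) = Real.exp (a i) ^ 4 := by
          rw [← Real.exp_nat_mul]; norm_num
        rw [this]
        exact pow_le_pow_left₀ hai0.le (by linarith [Real.add_one_le_exp (a i : ℝ)]) 4
      have h4 : θ n (s i) ≤ ((a i : ℝ) ^ 4)⁻¹ := by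
        refine (hanti (N i) n (s i) ?_).trans ih
        rw [hn, hN_succ]
        exact Nat.le_mul_of_pos_right _ (by have := ha_two i; positivity)
      rcases le_or_gt (θ n (s (i + 1))) 0 with h0 | h0
      · exact h0.trans (by positivity)
      · have h5 : θ n (s (i + 1)) * (a i : ℝ) ^ 4 ≤ ((a i : ℝ) ^ 4)⁻¹ :=
          (mul_le_mul_of_nonneg_left h3 h0.le).trans (h2.trans h4)
        rw [ha_succ]
        push_cast
        rw [← le_div_iff₀ (by positivity)] at h5
        refine h5.trans (le_of_eq ?_)
        field_simp
  refine ⟨n₀, hn₀, b - u, by linarith, by linarith, fun n hn => ?_⟩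
  have hn' : (0 : ℝ) < n := by exact_mod_cast hn
  have hall : ∀ i, n < N i → θ n (b - u) ≤ n₀ / n := by
    intro i
    induction i with
    | zero =>
      intro h
      refine (h1 _ _).trans ((one_le_div hn').2 ?_)
      exact_mod_cast h.le
    | succ i ih =>
      intro h
      by_cases hlt : n < N i
      · exact ih hlt
      have hai : (0 : ℝ) < a i := by have := ha_two i; positivity
      refine (hmono _ _ _ (hs_ge i)).trans ((hanti _ _ _ (not_lt.1 hlt)).trans
        ((key i).trans ?_))
      rw [inv_le_comm₀ (by positivity) (by positivity), inv_div, div_le_iff₀ (by positivity)]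
      have h2 : n ≤ a i ^ 4 * n₀ := by
        refine h.le.trans ?_
        rw [hN_succ]
        calc N i * a i ^ 2 ≤ n₀ * a i ^ 2 * a i ^ 2 := Nat.mul_le_mul_right _ (hN_le i)
          _ = a i ^ 4 * n₀ := by ring
      exact_mod_cast h2
  exact hall n (hN_gt n)

lemma sum_inv_sqrt_le (n : ℕ) : ∑ j ∈ Finset.range n, 1 / √((j : ℝ) + 1) ≤ 2 * √n := by
  induction n with
  | zero => simp
  | succ n ih =>
    rw [Finset.sum_range_succ]
    have h0 : 0 < √((n : ℝ) + 1) := Real.sqrt_pos.2 (by positivity)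
    have h1 : 1 / √((n : ℝ) + 1) ≤ 2 * √((n : ℝ) + 1) - 2 * √n := by
      rw [div_le_iff₀ h0]
      have h2 := Real.sq_sqrt (by positivity : (0 : ℝ) ≤ (n : ℝ) + 1)
      have h3 := Real.sq_sqrt (by positivity : (0 : ℝ) ≤ (n : ℝ))
      nlinarith [sq_nonneg (√((n : ℝ) + 1) - √n)]
    push_cast
    linarith

lemma exists_le_exp_neg_sqrt (h1 : ∀ n q, θ n q ≤ 1) (hzero : ∀ q, θ 0 q = 1)
    (hmono : ∀ n q q', q ≤ q' → θ n q ≤ θ n q') (hanti : ∀ m n q, m ≤ n → θ n q ≤ θ m q)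
    (hc : 0 < c) (hb : Filter.Tendsto (fun n => θ n b) Filter.atTop (nhds 0))
    (hθ : ∀ n, 1 ≤ n → ∀ q q', 0 ≤ q → q ≤ q' → q' ≤ b →
      θ n q * Real.exp (c * n / (∑ j ∈ Finset.range (n + 1), √(θ j q')) * (q' - q)) ≤ θ n q')
    (hp : 0 ≤ p) (hpb : p < b) :
    ∃ C > 0, ∀ n : ℕ, θ n p ≤ Real.exp (-(C * √n)) := by
  have hS : ∀ n q, 0 < ∑ j ∈ Finset.range (n + 1), √(θ j q) := by
    intro n q
    refine lt_of_lt_of_le one_pos (le_trans ?_ (Finset.single_le_sum (f := fun j => √(θ j q))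
      (fun j _ => Real.sqrt_nonneg _) (Finset.mem_range.2 n.succ_pos)))
    simp [hzero]
  obtain ⟨n₀, hn₀, q, hpq, hqb, hq⟩ := exists_le_div h1 hmono hanti hc hb hθ hS hp hpb
  have hn₀' : (1 : ℝ) ≤ n₀ := by exact_mod_cast hn₀
  have hsn₀ : 1 ≤ √(n₀ : ℝ) := Real.one_le_sqrt.2 hn₀'
  refine ⟨c * (q - p) / (3 * √n₀), div_pos (mul_pos hc (by linarith)) (by positivity),
    fun n => ?_⟩
  rcases Nat.eq_zero_or_pos n with rfl | hn
  · simp [hzero]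
  have hn' : (1 : ℝ) ≤ n := by exact_mod_cast hn
  have hsn : 1 ≤ √(n : ℝ) := Real.one_le_sqrt.2 hn'
  set S := ∑ j ∈ Finset.range (n + 1), √(θ j q) with hSdef
  have hSle : S ≤ 3 * √n₀ * √n := by
    rw [hSdef, Finset.sum_range_succ']
    have h2 : ∀ j ∈ Finset.range n, √(θ (j + 1) q) ≤ √n₀ * (1 / √((j : ℝ) + 1)) := by
      intro j _
      refine (Real.sqrt_le_sqrt (hq (j + 1) (by omega))).trans (le_of_eq ?_)
      rw [Real.sqrt_div' _ (by positivity)]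
      push_cast
      ring
    have h3 := Finset.sum_le_sum h2
    rw [← Finset.mul_sum] at h3
    have h4 := mul_le_mul_of_nonneg_left (sum_inv_sqrt_le n) (Real.sqrt_nonneg (n₀ : ℝ))
    have h5 : 1 ≤ √(n₀ : ℝ) * √n := by nlinarith
    rw [hzero, Real.sqrt_one]
    linarith
  have h2 := (hθ n hn p q hp hpq.le hqb).trans (h1 n q)
  rw [← le_div_iff₀ (Real.exp_pos _), one_div, ← Real.exp_neg] at h2
  refine h2.trans (Real.exp_le_exp.2 (neg_le_neg ?_))
  have h3 : c * (q - p) / (3 * √(n₀ : ℝ)) * √n = c * n / (3 * √n₀ * √n) * (q - p) := by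
    field_simp
    rw [Real.sq_sqrt (by positivity)]
  rw [h3]
  have hS0 := hS n q
  refine mul_le_mul_of_nonneg_right ?_ (by linarith)
  exact div_le_div_of_nonneg_left (by positivity) hS0 hSle

end Bootstrap

/-! ### Comparison of the critical points -/

section Conclusion

variable {d κ : ℕ} {P : Measure (Config d)} {X : Config d} {p : ℝ}

/-- Injective open paths of length `k` from the origin. -/
def openPaths (κ k : ℕ) (X : Config d) (p : ℝ) : Set (ℕ → Vertex d) :=
  {x | x 0 = 0 ∧ (∀ i < k, openEdge κ X p s(x i, x (i + 1))) ∧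
    ∀ i ≤ k, ∀ j ≤ k, x i = x j → i = j}

lemma isClosed_openPaths (k : ℕ) : IsClosed (openPaths κ k X p) := by
  have h2 : ∀ (i j : ℕ) (S : Set (Vertex d × Vertex d)),
      IsClosed {x : ℕ → Vertex d | (x i, x j) ∈ S} := fun i j S =>
    (isClosed_discrete S).preimage (by fun_prop)
  refine IsClosed.inter (h2 0 0 {y | y.1 = 0}) (IsClosed.inter ?_ ?_)
  · have : {x : ℕ → Vertex d | ∀ i < k, openEdge κ X p s(x i, x (i + 1))} =
        ⋂ i, ⋂ (_ : i < k), {x | (x i, x (i + 1)) ∈ {y | openEdge κ X p s(y.1, y.2)}} := by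
      ext x; simp
    change IsClosed {x : ℕ → Vertex d | ∀ i < k, openEdge κ X p s(x i, x (i + 1))}
    rw [this]
    exact isClosed_iInter fun i => isClosed_iInter fun _ => h2 _ _ _
  · have : {x : ℕ → Vertex d | ∀ i ≤ k, ∀ j ≤ k, x i = x j → i = j} =
        ⋂ i, ⋂ (_ : i ≤ k), ⋂ j, ⋂ (_ : j ≤ k), {x | (x i, x j) ∈ {y | y.1 = y.2 → i = j}} := by
      ext x; simp
    change IsClosed {x : ℕ → Vertex d | ∀ i ≤ k, ∀ j ≤ k, x i = x j → i = j}
    rw [this]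
    exact isClosed_iInter fun i => isClosed_iInter fun _ => isClosed_iInter fun j =>
      isClosed_iInter fun _ => h2 _ _ _

lemma norm1_le_of_mem_openPaths {k : ℕ} {x : ℕ → Vertex d} (hx : x ∈ openPaths κ k X p) {i : ℕ}
    (hi : i ≤ k) : norm1 (x i) ≤ i := by
  induction i with
  | zero => simp [hx.1, norm1]
  | succ i ih =>
    have h1 := ih (by omega)
    have h2 : norm1 (x i - x (i + 1)) = 1 := adj_of_isNNEdge (hx.2.1 i (by omega)).1
    have h3 := norm1_sub_ge (x i) (x (i + 1))
    rw [h2, abs_le] at h3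
    push_cast
    linarith

lemma exists_mem_openPaths {k : ℕ} (h : X ∈ oneArm κ k p) :
    ∃ x ∈ openPaths κ k X p, ∀ i, x i ∈ ball d i := by
  obtain ⟨b, hb, hc⟩ := h
  obtain ⟨K, x, hx, hx0, hxK, ho⟩ := openConn_iff.2 hc
  have hxm : x ∈ openPaths κ K X p := ⟨hx0, ho, hx.2⟩
  have hkK : k ≤ K := by
    have := norm1_le_of_mem_openPaths hxm le_rfl
    rw [hxK, hb] at this
    exact_mod_cast this
  refine ⟨fun i => if i ≤ k then x i else 0, ⟨by simp [hx0], fun i hi => ?_, fun i hi j hj h => ?_⟩,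
    fun i => mem_ball.2 ?_⟩
  · simpa [hi.le, Nat.succ_le_iff.2 hi] using ho i (by omega)
  · exact hx.2 i (by omega) j (by omega) (by simpa [hi, hj] using h)
  · by_cases hi : i ≤ k
    · simpa [hi] using norm1_le_of_mem_openPaths hxm (hi.trans hkK)
    · simp [hi, norm1]

lemma zeroToInf_of_forall_mem_oneArm (h : ∀ k, X ∈ oneArm κ k p) : zeroToInf κ X p := by
  obtain ⟨x, hx⟩ := IsCompact.nonempty_iInter_of_sequence_nonempty_isCompact_isClosed
    (fun k => openPaths κ k X p ∩ Set.univ.pi fun i => (ball d i : Set (Vertex d)))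
    (fun k => Set.inter_subset_inter_left _ fun x hx =>
      ⟨hx.1, fun i hi => hx.2.1 i (by omega), fun i hi j hj => hx.2.2 i (by omega) j (by omega)⟩)
    (fun k => by
      obtain ⟨x, hx, hb⟩ := exists_mem_openPaths (h k)
      exact ⟨x, hx, fun i _ => hb i⟩)
    ((isCompact_univ_pi fun i => (ball d i).finite_toSet.isCompact).inter_left
      (isClosed_openPaths 0))
    (fun k => (isClosed_openPaths k).inter
      (isCompact_univ_pi fun i => (ball d i).finite_toSet.isCompact).isClosed)
  have hx' : ∀ k, x ∈ openPaths κ k X p := fun k => (Set.mem_iInter.1 hx k).1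
  exact ⟨x, (hx' 0).1, fun i => adj_of_isNNEdge ((hx' (i + 1)).2.1 i (by omega)).1,
    fun i j hij => (hx' (i + j)).2.2 i (by omega) j (by omega) hij,
    fun i => (hx' (i + 1)).2.1 i (by omega)⟩

lemma zeroToInf.mono {q : ℝ} (hpq : p ≤ q) (h : zeroToInf κ X p) : zeroToInf κ X q := by
  obtain ⟨x, h0, hadj, hinj, ho⟩ := h
  exact ⟨x, h0, hadj, hinj, fun i => openEdges_mono hpq (ho i)⟩

lemma thetaInf_eq_zero_iff (hP : IsProductUniform P) :
    thetaInf κ P p = 0 ↔ P {X | zeroToInf κ X p} = 0 := by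
  have := hP.1
  rw [thetaInf, measure_goodConfigs_and hP, ENNReal.toReal_eq_zero_iff]
  exact or_iff_left (measure_ne_top _ _)

lemma nullMeasurableSet_oneArm (hP : IsProductUniform P) (n : ℕ) :
    NullMeasurableSet (oneArm κ n p) P := by
  refine NullMeasurableSet.congr (s := ⋃ N, ⋂ M, ⋂ (_ : N ≤ M),
    evt κ (boxEdges d (n + M)) (arm n) p) ?_ ?_
  · exact (MeasurableSet.iUnion fun N => MeasurableSet.iInter fun M => MeasurableSet.iInter
      fun _ => measurableSet_evt).nullMeasurableSet
  · filter_upwards [hP.ae_regular] with X hX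
    obtain ⟨N, hN⟩ := hX.gt_chain n
    have h : ∀ M, N ≤ M → (X ∈ oneArm κ n p ↔ X ∈ evt κ (boxEdges d (n + M)) (arm n) p) :=
      fun M hM => hX.mem_oneArm_iff fun ⟨e, he, hc⟩ => hN ⟨e, he, hc.anti hM⟩
    refine propext (Iff.trans Set.mem_iUnion ?_)
    simp only [Set.mem_iInter]
    constructor
    · rintro ⟨M, hM⟩
      exact (h (max M N) (le_max_right _ _)).2 (hM _ (le_max_left _ _))
    · exact fun hX' => ⟨N, fun M hM => (h M hM).1 hX'⟩

lemma tendsto_theta (hP : IsProductUniform P) (h : thetaInf κ P p = 0) :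
    Filter.Tendsto (fun n => theta κ P n p) Filter.atTop (nhds 0) := by
  have := hP.1
  have h1 := tendsto_measure_iInter_atTop (fun n => nullMeasurableSet_oneArm (κ := κ) (p := p) hP n)
    (fun m n hmn => oneArm_anti hmn) ⟨0, measure_ne_top _ _⟩
  have h2 : P (⋂ n, oneArm κ n p) = 0 :=
    measure_mono_null (fun X hX => zeroToInf_of_forall_mem_oneArm (Set.mem_iInter.1 hX))
      ((thetaInf_eq_zero_iff hP).1 h)
  rw [h2] at h1
  have h3 := (ENNReal.tendsto_toReal ENNReal.zero_ne_top).comp h1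
  simp only [theta_eq hP]
  exact h3

lemma thetaInf_eq_zero_of_susceptibility_lt_top (hP : IsProductUniform P)
    (h : ∑' b : Vertex d, P {X | X ∈ goodConfigs d ∧ openConn κ X p 0 b} < ⊤) :
    thetaInf κ P p = 0 := by
  rw [thetaInf_eq_zero_iff hP]
  have h1 := ae_finite_setOfPred_mem h.ne
  rw [← nonpos_iff_eq_zero]
  refine (measure_mono_ae ?_).trans (measure_empty (μ := P)).le
  filter_upwards [h1, hP.ae_regular] with X hfin hX hz
  obtain ⟨x, h0, hadj, hinj, ho⟩ := hz
  refine Set.infinite_range_of_injective hinj (hfin.subset ?_)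
  rintro _ ⟨k, rfl⟩
  exact ⟨hX.mem_goodConfigs, k, x, ⟨fun i _ => hadj i, fun i _ j _ hij => hinj hij⟩, h0, rfl,
    fun i _ => ho i⟩

lemma exists_exp_neg_sqrt_le {C : ℝ} (hC : 0 < C) (m : ℕ) :
    ∃ K : ℝ, ∀ n : ℕ, ((2 * n + 1 : ℕ) : ℝ) ^ m * Real.exp (-(C * √n)) ≤ K / ((n : ℝ) + 1) ^ 2 := by
  refine ⟨2 ^ m * ((2 * (m + 2)).factorial * (C / 2)⁻¹ ^ (2 * (m + 2)) * Real.exp (C / 2)), ?_⟩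
  intro n
  rw [le_div_iff₀ (by positivity)]
  have hs : 0 ≤ √((n : ℝ) + 1) := Real.sqrt_nonneg _
  have h0 : (C / 2) * √((n : ℝ) + 1) ≤ C / 2 + C * √n := by
    have : √((n : ℝ) + 1) ≤ 1 + √n := by
      rw [Real.sqrt_le_left (by positivity)]
      nlinarith [Real.sq_sqrt (Nat.cast_nonneg (α := ℝ) n), Real.sqrt_nonneg (n : ℝ)]
    nlinarith [Real.sqrt_nonneg (n : ℝ)]
  have h1 := Real.pow_div_factorial_le_exp ((C / 2) * √((n : ℝ) + 1)) (by positivity)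
    (2 * (m + 2))
  rw [div_le_iff₀ (by positivity), mul_pow, pow_mul (√((n : ℝ) + 1)),
    Real.sq_sqrt (by positivity)] at h1
  have h2 : ((n : ℝ) + 1) ^ (m + 2) ≤ (2 * (m + 2)).factorial * (C / 2)⁻¹ ^ (2 * (m + 2)) *
      (Real.exp (C / 2) * Real.exp (C * √n)) := by
    rw [← Real.exp_add, inv_pow]
    have h3 := h1.trans (mul_le_mul_of_nonneg_right (Real.exp_le_exp.2 h0) (by positivity))
    rw [← div_eq_mul_inv, div_mul_eq_mul_div, le_div_iff₀ (by positivity)]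
    linarith
  rw [Real.exp_neg]
  have he := Real.exp_pos (C * √n)
  have h4 : ((2 * n + 1 : ℕ) : ℝ) ^ m ≤ 2 ^ m * ((n : ℝ) + 1) ^ m := by
    rw [← mul_pow]
    exact pow_le_pow_left₀ (by positivity) (by push_cast; linarith) m
  calc ((2 * n + 1 : ℕ) : ℝ) ^ m * (Real.exp (C * √n))⁻¹ * ((n : ℝ) + 1) ^ 2
      ≤ 2 ^ m * ((n : ℝ) + 1) ^ m * (Real.exp (C * √n))⁻¹ * ((n : ℝ) + 1) ^ 2 := by gcongr
    _ = 2 ^ m * ((n : ℝ) + 1) ^ (m + 2) * (Real.exp (C * √n))⁻¹ := by ring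
    _ ≤ 2 ^ m * ((2 * (m + 2)).factorial * (C / 2)⁻¹ ^ (2 * (m + 2)) *
      (Real.exp (C / 2) * Real.exp (C * √n))) * (Real.exp (C * √n))⁻¹ := by gcongr
    _ = _ := by field_simp

lemma susceptibility_lt_top_of_le_exp (hP : IsProductUniform P) {C : ℝ} (hC : 0 < C)
    (h : ∀ n : ℕ, theta κ P n p ≤ Real.exp (-(C * √n))) :
    ∑' b : Vertex d, P {X | X ∈ goodConfigs d ∧ openConn κ X p 0 b} < ⊤ := by
  have := hP.1
  obtain ⟨K, hK⟩ := exists_exp_neg_sqrt_le hC d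
  have hsum : Summable fun n : ℕ => K / ((n : ℝ) + 1) ^ 2 := by
    have := (summable_nat_add_iff 1).2 (Real.summable_one_div_nat_pow.2 one_lt_two)
    simpa [div_eq_mul_inv] using this.mul_left K
  have hsphere : ∀ n : ℕ, ∑' b : {b : Vertex d // (norm1 b).toNat = n},
      P {X | X ∈ goodConfigs d ∧ openConn κ X p 0 b.1} ≤ ENNReal.ofReal (K / ((n : ℝ) + 1) ^ 2) := by
    intro n
    have hn : ∀ b : Vertex d, (norm1 b).toNat = n → norm1 b = n := fun b hb => by
      have := norm1_nonneg b
      omega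
    have hle : ∀ b : {b : Vertex d // (norm1 b).toNat = n},
        P {X | X ∈ goodConfigs d ∧ openConn κ X p 0 b.1} ≤
          ENNReal.ofReal (Real.exp (-(C * √n))) := fun b => by
      refine le_trans ?_ (ENNReal.ofReal_le_ofReal (h n))
      rw [theta_eq hP, ofReal_measureReal]
      exact measure_mono fun X hX => ⟨b, hn _ b.2, openConn_iff.1 hX.2⟩
    have hsub : {b : Vertex d | (norm1 b).toNat = n} ⊆ ball d n := fun b hb =>
      mem_ball.2 (hn b hb).le
    let hfin : Fintype {b : Vertex d // (norm1 b).toNat = n} :=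
      ((ball d n).finite_toSet.subset hsub).fintype
    have hcard : Fintype.card {b : Vertex d // (norm1 b).toNat = n} ≤ (2 * n + 1) ^ d := by
      refine le_trans ?_ (card_ball_le d n)
      rw [← Fintype.card_coe]
      exact Fintype.card_le_of_injective (fun b => ⟨b.1, hsub b.2⟩)
        fun a b hab => Subtype.ext (congrArg (fun z => z.1) hab)
    rw [tsum_fintype]
    refine (Finset.sum_le_sum fun b _ => hle b).trans ?_
    rw [Finset.sum_const, Finset.card_univ, nsmul_eq_mul]
    refine le_trans ?_ (ENNReal.ofReal_le_ofReal (hK n))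
    rw [ENNReal.ofReal_mul (by positivity)]
    gcongr
    rw [← ENNReal.ofReal_natCast]
    exact ENNReal.ofReal_le_ofReal (by exact_mod_cast hcard)
  rw [← (Equiv.sigmaFiberEquiv fun b : Vertex d => (norm1 b).toNat).tsum_eq, ENNReal.tsum_sigma']
  exact (ENNReal.tsum_le_tsum hsphere).trans_lt hsum.tsum_ofReal_lt_top

lemma susceptibility_lt_top_of_lt (hP : IsProductUniform P) {b : ℝ} (hp : 0 ≤ p) (hpb : p < b)
    (hb : b < 1) (h : thetaInf κ P b = 0) :
    ∑' x : Vertex d, P {X | X ∈ goodConfigs d ∧ openConn κ X p 0 x} < ⊤ := by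
  obtain ⟨c, hc, hθ⟩ := exists_theta_mul_exp_le (κ := κ) hP (hp.trans hpb.le) hb
  obtain ⟨C, hC, hle⟩ := exists_le_exp_neg_sqrt (θ := theta κ P) (fun n _ => theta_le_one hP n)
    (fun _ => theta_zero hP) (fun n _ _ h => theta_mono hP n h) (fun _ _ _ h => theta_anti hP h)
    hc (tendsto_theta hP h) hθ hp hpb
  exact susceptibility_lt_top_of_le_exp hP hC hle

lemma susceptibility_zero_lt_top (hP : IsProductUniform P) :
    ∑' x : Vertex d, P {X | X ∈ goodConfigs d ∧ openConn κ X 0 0 x} < ⊤ := by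
  have := hP.1
  rw [tsum_eq_single 0]
  · exact measure_lt_top _ _
  intro x hx
  rw [← nonpos_iff_eq_zero]
  refine (measure_mono_ae ?_).trans (measure_empty (μ := P)).le
  have h1 : ∀ᵐ X ∂P, ∀ e : Edge d, X e ≠ 0 := ae_all_iff.2 fun e => by
    simpa [ae_iff] using hP.measure_coord_eq e 0
  filter_upwards [h1, hP.ae_mem_Icc] with X h2 h3
  rintro ⟨-, k, y, -, hy, rfl, ho⟩
  rcases Nat.eq_zero_or_pos k with rfl | hk
  · exact hx hy
  · exact h2 _ (le_antisymm (ho 0 hk).2.1 (h3 _).1)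

end Conclusion

/-- The critical point coincides with the susceptibility critical point: `p_c = p̂_c`. -/
theorem pc_eq_pcHat (d κ : ℕ) (hd : 2 ≤ d) (hκ₁ : 2 ≤ κ) (hκ₂ : κ ≤ 2 * d)
    (P : Measure (Config d)) (hP : IsProductUniform P) :
    pc κ P = pcHat κ P := by
  have hbdd : ∀ Q : ℝ → Prop, BddAbove {p : ℝ | p ∈ Set.Icc (0 : ℝ) 1 ∧ Q p} :=
    fun Q => ⟨1, fun p hp => hp.1.2⟩
  have h0 : (0 : ℝ) ∈ Set.Icc (0 : ℝ) 1 := ⟨le_rfl, zero_le_one⟩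
  have hχ := susceptibility_zero_lt_top (κ := κ) hP
  refine le_antisymm ?_ ?_
  · refine csSup_le ⟨0, h0, thetaInf_eq_zero_of_susceptibility_lt_top hP hχ⟩ ?_
    rintro b ⟨hb, hθ⟩
    by_contra! hlt
    obtain ⟨p, hp, hpb⟩ := exists_between hlt
    obtain ⟨q, hpq, hqb⟩ := exists_between hpb
    have hp0 : 0 ≤ p := (le_csSup (hbdd _) ⟨h0, hχ⟩).trans hp.le
    have hq : thetaInf κ P q = 0 := (thetaInf_eq_zero_iff hP).2
      (measure_mono_null (fun X hX => hX.mono hqb.le) ((thetaInf_eq_zero_iff hP).1 hθ))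
    exact hp.not_ge (le_csSup (hbdd _) ⟨⟨hp0, hpb.le.trans hb.2⟩,
      susceptibility_lt_top_of_lt hP hp0 hpq (hqb.trans_le hb.2) hq⟩)
  · exact csSup_le_csSup (hbdd _) ⟨0, h0, hχ⟩
      fun p hp => ⟨hp.1, thetaInf_eq_zero_of_susceptibility_lt_top hP hp.2⟩

end CDP
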